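/- arXiv:1811.01600 — 4 statements merged into one kernel-verified Lean document; each statement's English description precedes it below -/
import Mathlib

section
/- Let M be a matroid on a ground set of n elements, and for each k let I_k denote the number of independent sets of M of cardinality k. Then the sequence I_0, I_1, …, I_n is ultra log-concave: for every k with 1 < k < n (equivalently, 0 < k < n), one has (I_k / C(n,k))^2 ≥ (I_{k-1} / C(n,k-1)) · (I_{k+1} / C(n,k+1)), i.e. I_k^2 · C(n,k-1) · C(n,k+1) ≥ I_{k-1} · I_{k+1} · C(n,k)^2. -/
open Matrix MvPolynomial

structure PaperMatroid (n : ℕ) where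
  Indep : Finset (Fin n) → Prop
  indep_nonempty : ∃ S, Indep S
  indep_subset : ∀ ⦃S T : Finset (Fin n)⦄, S ⊆ T → Indep T → Indep S
  indep_exchange : ∀ ⦃S T : Finset (Fin n)⦄, Indep S → Indep T → S.card < T.card →
    ∃ i ∈ T \ S, Indep (insert i S)

/-- The number of independent sets of cardinality `k`. -/
noncomputable def numIndep {n : ℕ} (M : PaperMatroid n) (k : ℕ) : ℕ :=
  Nat.card {S : Finset (Fin n) // M.Indep S ∧ S.card = k}

section LinearAlgebra

variable {ι : Type*} [Fintype ι]

theorem Matrix.IsSymm.dotProduct_mulVec_comm {H : Matrix ι ι ℝ} (hH : H.IsSymm) (x y : ι → ℝ) :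
    x ⬝ᵥ H *ᵥ y = y ⬝ᵥ H *ᵥ x := by
  rw [dotProduct_mulVec, ← mulVec_transpose, hH.eq, dotProduct_comm]

/-- A symmetric form without positive eigenvalues relative to a positive diagonal form is
negative semidefinite. -/
theorem Matrix.IsSymm.dotProduct_mulVec_self_nonpos [DecidableEq ι] {T : Matrix ι ι ℝ}
    (hT : T.IsSymm) {c : ι → ℝ} (hc : ∀ i, 0 < c i)
    (h : ∀ l : ℝ, 0 < l → ∀ u : ι → ℝ, (∀ i, (T *ᵥ u) i = l * (c i * u i)) → u = 0)
    (v : ι → ℝ) : v ⬝ᵥ T *ᵥ v ≤ 0 := by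
  have hs : ∀ i, 0 < √(c i) := fun i => Real.sqrt_pos.2 (hc i)
  set S : Matrix ι ι ℝ := Matrix.of fun i j => -(T i j / (√(c i) * √(c j))) with hS
  have hSH : S.IsHermitian := by
    ext i j
    simp [hS, hT.apply i j, mul_comm]
  have hrow : ∀ (b : ι → ℝ) i, (T *ᵥ fun j => b j / √(c j)) i = -(√(c i) * (S *ᵥ b) i) := by
    intro b i
    simp only [mulVec, dotProduct, hS, Matrix.of_apply, Finset.mul_sum, ← Finset.sum_neg_distrib]
    refine Finset.sum_congr rfl fun j _ => ?_
    have := (hs i).ne'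
    have := (hs j).ne'
    field_simp
  have hpsd : S.PosSemidef := by
    rw [hSH.posSemidef_iff_eigenvalues_nonneg]
    intro k
    by_contra hk
    simp only [Pi.zero_apply, not_le] at hk
    have hb := hSH.mulVec_eigenvectorBasis k
    have hu := h (-hSH.eigenvalues k) (by linarith)
      (fun j => (hSH.eigenvectorBasis k) j / √(c j)) (fun i => by
        have hi := (hs i).ne'
        rw [hrow, hb]
        simp only [Pi.smul_apply, smul_eq_mul]
        linear_combination hSH.eigenvalues k * (hSH.eigenvectorBasis k) i *
          Real.div_sqrt (x := c i))
    refine hSH.eigenvectorBasis.toBasis.ne_zero k ?_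
    ext i
    have := congrFun hu i
    have hi := (hs i).ne'
    simpa [hi] using this
  have := hpsd.dotProduct_mulVec_nonneg fun i => √(c i) * v i
  have hv : (fun j => (√(c j) * v j) / √(c j)) = v := by
    ext j
    have := (hs j).ne'
    field_simp
  have h2 : ∀ i, (T *ᵥ v) i = -(√(c i) * (S *ᵥ fun i => √(c i) * v i) i) := by
    intro i
    rw [← hrow, hv]
  have h3 : v ⬝ᵥ T *ᵥ v =
      -((fun i => √(c i) * v i) ⬝ᵥ S *ᵥ fun i => √(c i) * v i) := by
    simp only [dotProduct, ← Finset.sum_neg_distrib]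
    refine Finset.sum_congr rfl fun i _ => ?_
    rw [h2]
    ring
  simp only [star_trivial] at this
  linarith

/-- The reverse Cauchy-Schwarz inequality for `H` at the vector `z`. -/
def ReverseCauchySchwarz (H : Matrix ι ι ℝ) (z : ι → ℝ) : Prop :=
  ∀ v, (z ⬝ᵥ H *ᵥ z) * (v ⬝ᵥ H *ᵥ v) ≤ (z ⬝ᵥ H *ᵥ v) ^ 2

theorem reverseCauchySchwarz_of_nonpos {H : Matrix ι ι ℝ} (hH : H.IsSymm) {z : ι → ℝ} (o : ι)
    (hz : 0 < z ⬝ᵥ H *ᵥ z) (h : ∀ v, (H *ᵥ v) o = 0 → v ⬝ᵥ H *ᵥ v ≤ 0) :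
    ReverseCauchySchwarz H z := by
  intro v
  have hzo : (H *ᵥ z) o ≠ 0 := fun h0 => (h z h0).not_gt hz
  set s := (H *ᵥ v) o / (H *ᵥ z) o with hs
  have h1 := h (v - s • z) (by
    simp only [mulVec_sub, mulVec_smul, Pi.sub_apply, Pi.smul_apply, smul_eq_mul, hs]
    field_simp
    ring)
  simp only [mulVec_sub, mulVec_smul, sub_dotProduct, dotProduct_sub, smul_dotProduct,
    dotProduct_smul, smul_eq_mul, hH.dotProduct_mulVec_comm v z] at h1
  nlinarith [sq_nonneg (s * (z ⬝ᵥ H *ᵥ z) - z ⬝ᵥ H *ᵥ v)]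

/-- A Perron-Frobenius argument: `H z` controls the quadratic form of `H` and the index `o` is
joined to every index whose row does not vanish. -/
theorem reverseCauchySchwarz_of_le_sum [DecidableEq ι] {H : Matrix ι ι ℝ} (hH : H.IsSymm)
    (hnn : ∀ i j, 0 ≤ H i j) {z : ι → ℝ} (hz : ∀ i, 0 < z i) {o : ι} (ho : 0 < H o o)
    (hrow : ∀ i, H o i = 0 → ∀ j, H i j = 0)
    (hle : ∀ v, v ⬝ᵥ H *ᵥ v ≤ ∑ i, z i * ((H *ᵥ v) i ^ 2 / (H *ᵥ z) i)) :
    ReverseCauchySchwarz H z := by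
  set g := H *ᵥ z with hg
  have hg0 : ∀ i, 0 ≤ g i := fun i =>
    Finset.sum_nonneg fun j _ => mul_nonneg (hnn i j) (hz j).le
  have hgz : ∀ i, g i = 0 → ∀ j, H i j = 0 := by
    intro i hi j
    have := (Finset.sum_eq_zero_iff_of_nonneg
      (fun j _ => mul_nonneg (hnn i j) (hz j).le)).1 hi j (Finset.mem_univ _)
    exact (mul_eq_zero.1 this).resolve_right (hz j).ne'
  have hgo : ∀ i, g i ≠ 0 → 0 < H o i := by
    intro i hi
    refine (hnn o i).lt_of_ne' fun h0 => hi ?_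
    simp [hg, mulVec, dotProduct, hrow i h0]
  set Z := z ⬝ᵥ g with hZ
  have hZ0 : 0 < Z := by
    have h1 : z o * (H o o * z o) ≤ z o * g o :=
      mul_le_mul_of_nonneg_left (Finset.single_le_sum (f := fun j => H o j * z j)
        (fun j _ => mul_nonneg (hnn o j) (hz j).le) (Finset.mem_univ o)) (hz o).le
    have h2 : z o * g o ≤ Z := Finset.single_le_sum (f := fun i => z i * g i)
      (fun i _ => mul_nonneg (hz i).le (hg0 i)) (Finset.mem_univ o)
    have h3 : 0 < z o * (H o o * z o) := mul_pos (hz o) (mul_pos ho (hz o))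
    linarith
  set T : Matrix ι ι ℝ := Matrix.of fun i j => H i j - g i * g j / Z with hT
  have hTs : T.IsSymm := by
    ext i j
    simp [hT, hH.apply i j, mul_comm]
  have hTv : ∀ v i, (T *ᵥ v) i = (H *ᵥ v) i - g i * (g ⬝ᵥ v) / Z := by
    intro v i
    simp only [hT, mulVec, dotProduct, Matrix.of_apply, sub_mul, Finset.sum_sub_distrib,
      Finset.mul_sum, Finset.sum_div]
    congr 1
    exact Finset.sum_congr rfl fun j _ => by ring
  have hzH : ∀ v, z ⬝ᵥ H *ᵥ v = g ⬝ᵥ v := fun v => by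
    rw [hH.dotProduct_mulVec_comm, dotProduct_comm]
  set c : ι → ℝ := fun i => if g i = 0 then 1 else g i / z i with hc
  have hc0 : ∀ i, 0 < c i := by
    intro i
    simp only [hc]
    split_ifs with h
    · exact one_pos
    · exact div_pos ((hg0 i).lt_of_ne' h) (hz i)
  have key := hTs.dotProduct_mulVec_self_nonpos hc0 (by
    intro l hl u hu
    have hu0 : ∀ i, g i = 0 → u i = 0 := by
      intro i hi
      have h1 := hu i
      have h2 : (H *ᵥ u) i = 0 := by simp [mulVec, dotProduct, hgz i hi]
      rw [hTv, h2, hi] at h1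
      have h3 : l * (c i * u i) = 0 := by rw [← h1]; ring
      have := hl.ne'
      have := (hc0 i).ne'
      simp_all
    have hcz : ∀ i, z i * (c i * u i) = g i * u i := by
      intro i
      by_cases h : g i = 0
      · simp [hu0 i h]
      · have := (hz i).ne'
        simp only [hc, if_neg h]
        field_simp
    have hgu : g ⬝ᵥ u = 0 := by
      have h1 : z ⬝ᵥ T *ᵥ u = l * (g ⬝ᵥ u) := by
        simp only [dotProduct, Finset.mul_sum]
        exact Finset.sum_congr rfl fun i _ => by rw [hu, ← hcz]; ring
      have h2 : z ⬝ᵥ T *ᵥ u = 0 := by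
        have : T *ᵥ u = H *ᵥ u - ((g ⬝ᵥ u) / Z) • g := by
          ext i
          rw [hTv]
          simp only [Pi.sub_apply, Pi.smul_apply, smul_eq_mul]
          ring
        rw [this, dotProduct_sub, hzH, dotProduct_smul, ← hZ, smul_eq_mul]
        field_simp
        ring
      rw [h2] at h1
      exact (mul_eq_zero.1 h1.symm).resolve_left hl.ne'
    have hHu : ∀ i, (H *ᵥ u) i = l * (c i * u i) := by
      intro i
      rw [← hu i, hTv, hgu]
      ring
    set q := ∑ i, c i * u i ^ 2 with hq
    have hq0 : 0 ≤ q := Finset.sum_nonneg fun i _ => mul_nonneg (hc0 i).le (sq_nonneg _)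
    have huHu : u ⬝ᵥ H *ᵥ u = l * q := by
      simp only [dotProduct, hq, Finset.mul_sum]
      exact Finset.sum_congr rfl fun i _ => by rw [hHu]; ring
    have hrhs : ∑ i, z i * ((H *ᵥ u) i ^ 2 / g i) = l ^ 2 * q := by
      simp only [hq, Finset.mul_sum]
      refine Finset.sum_congr rfl fun i _ => ?_
      rw [hHu]
      by_cases h : g i = 0
      · simp [hu0 i h]
      · have := (hz i).ne'
        simp only [hc, if_neg h]
        field_simp
    have hl1 := hle u
    rw [huHu, hrhs] at hl1
    rcases hq0.eq_or_lt with hq1 | hq1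
    · ext i
      have := (Finset.sum_eq_zero_iff_of_nonneg
        (fun i _ => mul_nonneg (hc0 i).le (sq_nonneg (u i)))).1 hq1.symm i (Finset.mem_univ _)
      simpa [(hc0 i).ne'] using this
    have hl2 : 1 ≤ l := by
      by_contra hcon
      have : l * q * l < l * q * 1 := mul_lt_mul_of_pos_left (not_le.1 hcon) (mul_pos hl hq1)
      nlinarith
    have hdiag : ∑ i, g i * (u i ^ 2 / z i) = q := by
      refine Finset.sum_congr rfl fun i _ => ?_
      by_cases h : g i = 0
      · simp [hu0 i h]
      · have := (hz i).ne'
        simp only [hc, if_neg h]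
        field_simp
    have hlap : ∑ i, ∑ j, H i j * (z i * z j * (u i / z i - u j / z j) ^ 2) =
        2 * (q - l * q) := by
      have e1 : ∑ i, ∑ j, H i j * (z j * (u i ^ 2 / z i)) = q := by
        rw [← hdiag]
        refine Finset.sum_congr rfl fun i _ => ?_
        simp only [hg, mulVec, dotProduct, Finset.sum_mul]
        exact Finset.sum_congr rfl fun j _ => by ring
      have e2 : ∑ i, ∑ j, H i j * (z i * (u j ^ 2 / z j)) = q := by
        rw [Finset.sum_comm, ← e1]
        exact Finset.sum_congr rfl fun i _ => Finset.sum_congr rfl fun j _ => by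
          rw [hH.apply]
      have e3 : ∑ i, ∑ j, H i j * (u i * u j) = l * q := by
        rw [← huHu]
        simp only [mulVec, dotProduct, Finset.mul_sum]
        exact Finset.sum_congr rfl fun i _ => Finset.sum_congr rfl fun j _ => by ring
      have e4 : 2 * (q - l * q) = ∑ i, ∑ j, H i j * (z j * (u i ^ 2 / z i)) +
          ∑ i, ∑ j, H i j * (z i * (u j ^ 2 / z j)) - 2 * ∑ i, ∑ j, H i j * (u i * u j) := by
        rw [e1, e2, e3]
        ring
      rw [e4]
      simp only [Finset.mul_sum, ← Finset.sum_add_distrib, ← Finset.sum_sub_distrib]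
      refine Finset.sum_congr rfl fun i _ => Finset.sum_congr rfl fun j _ => ?_
      have := (hz i).ne'
      have := (hz j).ne'
      field_simp
      ring
    have hnn2 : ∀ i j, 0 ≤ H i j * (z i * z j * (u i / z i - u j / z j) ^ 2) := fun i j =>
      mul_nonneg (hnn i j) (mul_nonneg (mul_nonneg (hz i).le (hz j).le) (sq_nonneg _))
    have hlap0 : ∑ i, ∑ j, H i j * (z i * z j * (u i / z i - u j / z j) ^ 2) = 0 :=
      le_antisymm (by rw [hlap]; nlinarith)
        (Finset.sum_nonneg fun i _ => Finset.sum_nonneg fun j _ => hnn2 i j)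
    have hterm : ∀ i, g i ≠ 0 → u i / z i = u o / z o := by
      intro i hi
      have h1 := (Finset.sum_eq_zero_iff_of_nonneg
        (fun i _ => Finset.sum_nonneg fun j _ => hnn2 i j)).1 hlap0 o (Finset.mem_univ _)
      have h2 := (Finset.sum_eq_zero_iff_of_nonneg
        (fun j _ => hnn2 o j)).1 h1 i (Finset.mem_univ _)
      simp only [mul_eq_zero, (hgo i hi).ne', (hz i).ne', (hz o).ne', false_or,
        pow_eq_zero_iff two_ne_zero] at h2
      linarith
    have hs : g ⬝ᵥ u = u o / z o * Z := by
      simp only [hZ, dotProduct, Finset.mul_sum]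
      refine Finset.sum_congr rfl fun i _ => ?_
      by_cases h : g i = 0
      · simp [h]
      · rw [← hterm i h]
        have := (hz i).ne'
        field_simp
    rw [hgu] at hs
    have hs0 : u o / z o = 0 := (mul_eq_zero.1 hs.symm).resolve_right hZ0.ne'
    ext i
    by_cases h : g i = 0
    · exact hu0 i h
    · have := hterm i h
      rw [hs0] at this
      exact (div_eq_zero_iff.1 this).resolve_right (hz i).ne')
  intro v
  have h1 := key v
  have h2 : v ⬝ᵥ T *ᵥ v = v ⬝ᵥ H *ᵥ v - (g ⬝ᵥ v) ^ 2 / Z := by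
    have : T *ᵥ v = H *ᵥ v - ((g ⬝ᵥ v) / Z) • g := by
      ext i
      rw [hTv]
      simp only [Pi.sub_apply, Pi.smul_apply, smul_eq_mul]
      ring
    rw [this, dotProduct_sub, dotProduct_smul, smul_eq_mul, dotProduct_comm v g]
    ring
  rw [h2, sub_nonpos, le_div_iff₀ hZ0] at h1
  rw [hzH v]
  linarith

/-- The local-to-global principle: if the slices of a symmetric nonnegative 3-tensor satisfy the
reverse Cauchy-Schwarz inequality at `z`, then so does its contraction with `z`. -/
theorem reverseCauchySchwarz_of_slices [DecidableEq ι] {H : Matrix ι ι ℝ} (hH : H.IsSymm)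
    {z : ι → ℝ} (hz : ∀ i, 0 < z i) {o : ι} (ho : 0 < H o o)
    (hrow : ∀ i, H o i = 0 → ∀ j, H i j = 0) (T : ι → Matrix ι ι ℝ)
    (hT0 : ∀ k i j, 0 ≤ T k i j) (hTsymm : ∀ k, (T k).IsSymm)
    (hT : ∀ k i j, T k i j = T i k j) {m : ℝ} (hm : 0 < m)
    (hTH : ∀ i j, ∑ k, z k * T k i j = m * H i j)
    (hTz : ∀ k, ReverseCauchySchwarz (T k) z) : ReverseCauchySchwarz H z := by
  have hnn : ∀ i j, 0 ≤ H i j := by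
    intro i j
    have : 0 ≤ m * H i j := by
      rw [← hTH]
      exact Finset.sum_nonneg fun k _ => mul_nonneg (hz k).le (hT0 k i j)
    exact nonneg_of_mul_nonneg_right this hm
  have hTkz : ∀ k, T k *ᵥ z = m • H k := by
    intro k
    ext i
    simp only [mulVec, dotProduct, Pi.smul_apply, smul_eq_mul]
    rw [← hH.apply, ← hTH]
    refine Finset.sum_congr rfl fun j _ => ?_
    rw [mul_comm, ← (hTsymm k).apply, hT, (hTsymm j).apply, ← (hTsymm j).apply]
  have hzT : ∀ k v, z ⬝ᵥ T k *ᵥ v = m * (H *ᵥ v) k := by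
    intro k v
    rw [(hTsymm k).dotProduct_mulVec_comm, hTkz, dotProduct_smul, smul_eq_mul, dotProduct_comm]
    rfl
  refine reverseCauchySchwarz_of_le_sum hH hnn hz ho hrow fun v => ?_
  have h1 : m * (v ⬝ᵥ H *ᵥ v) = ∑ k, z k * (v ⬝ᵥ T k *ᵥ v) := by
    simp only [mulVec, dotProduct, Finset.mul_sum]
    symm
    rw [Finset.sum_comm]
    refine Finset.sum_congr rfl fun i _ => ?_
    rw [Finset.sum_comm]
    refine Finset.sum_congr rfl fun j _ => ?_
    calc ∑ k, z k * (v i * (T k i j * v j)) = (∑ k, z k * T k i j) * (v i * v j) := by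
          rw [Finset.sum_mul]
          exact Finset.sum_congr rfl fun k _ => by ring
      _ = _ := by rw [hTH]; ring
  refine le_of_mul_le_mul_left (a := m) ?_ hm
  rw [h1, Finset.mul_sum]
  refine Finset.sum_le_sum fun k _ => ?_
  have h2 := hTz k v
  rw [hzT, hzT] at h2
  have hg : 0 ≤ (H *ᵥ z) k := Finset.sum_nonneg fun j _ => mul_nonneg (hnn k j) (hz j).le
  have h3 : v ⬝ᵥ T k *ᵥ v ≤ m * ((H *ᵥ v) k ^ 2 / (H *ᵥ z) k) := by
    rcases hg.eq_or_lt with h0 | h0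
    · have hHk : ∀ j, H k j = 0 := fun j => by
        have := (Finset.sum_eq_zero_iff_of_nonneg
          (fun j _ => mul_nonneg (hnn k j) (hz j).le)).1 h0.symm j (Finset.mem_univ _)
        exact (mul_eq_zero.1 this).resolve_right (hz j).ne'
      have hTk : ∀ i j, T k i j = 0 := by
        intro i j
        have h4 : (T k *ᵥ z) i = 0 := by rw [hTkz]; simp [hHk]
        have := (Finset.sum_eq_zero_iff_of_nonneg
          (fun j _ => mul_nonneg (hT0 k i j) (hz j).le)).1 h4 j (Finset.mem_univ _)
        exact (mul_eq_zero.1 this).resolve_right (hz j).ne'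
      have h5 : v ⬝ᵥ T k *ᵥ v = 0 := by simp [mulVec, dotProduct, hTk]
      rw [h5, ← h0]
      simp
    · rw [← mul_div_assoc, le_div_iff₀ h0]
      refine le_of_mul_le_mul_left (a := m) ?_ hm
      nlinarith
  calc z k * (v ⬝ᵥ T k *ᵥ v) ≤ z k * (m * ((H *ᵥ v) k ^ 2 / (H *ᵥ z) k)) :=
        mul_le_mul_of_nonneg_left h3 (hz k).le
    _ = _ := by ring

end LinearAlgebra

section SetFunctions

variable {α : Type*} [DecidableEq α]

/-- Discrete analogue of a partial derivative on functions of finite sets: `none` acts as the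
identity, and `some e` sends `Φ` to `S ↦ Φ (S ∪ {e})`, killing the sets containing `e`. -/
def insertDeriv (i : Option α) (Φ : Finset α → ℝ) (S : Finset α) : ℝ :=
  match i with
  | none => Φ S
  | some e => if e ∈ S then 0 else Φ (insert e S)

/-- The matrix of second discrete derivatives at `S`. -/
def insertHessian (Φ : Finset α → ℝ) (S : Finset α) : Matrix (Option α) (Option α) ℝ :=
  Matrix.of fun i j => insertDeriv i (insertDeriv j Φ) S

theorem insertDeriv_comm (i j : Option α) (Φ : Finset α → ℝ) :
    insertDeriv i (insertDeriv j Φ) = insertDeriv j (insertDeriv i Φ) := by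
  ext S
  rcases i with _ | e <;> rcases j with _ | f <;> simp only [insertDeriv]
  rw [Finset.insert_comm]
  by_cases he : e ∈ S <;> by_cases hf : f ∈ S <;> by_cases hef : e = f <;>
    simp_all [Finset.mem_insert, eq_comm]

theorem insertDeriv_const_mul (i : Option α) (a : ℝ) (Φ : Finset α → ℝ) (S : Finset α) :
    insertDeriv i (fun S => a * Φ S) S = a * insertDeriv i Φ S := by
  rcases i with _ | e <;> simp [insertDeriv]

theorem insertDeriv_sum {κ : Type*} [Fintype κ] (i : Option α) (a : κ → ℝ)
    (Φ : κ → Finset α → ℝ) (S : Finset α) :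
    insertDeriv i (fun S => ∑ k, a k * Φ k S) S = ∑ k, a k * insertDeriv i (Φ k) S := by
  rcases i with _ | e
  · rfl
  · simp only [insertDeriv]
    split_ifs <;> simp

theorem insertDeriv_nonneg (i : Option α) {Φ : Finset α → ℝ} (hΦ : ∀ S, 0 ≤ Φ S)
    (S : Finset α) : 0 ≤ insertDeriv i Φ S := by
  rcases i with _ | e
  · exact hΦ S
  · simp only [insertDeriv]
    split_ifs
    exacts [le_rfl, hΦ _]

theorem insertHessian_isSymm (Φ : Finset α → ℝ) (S : Finset α) : (insertHessian Φ S).IsSymm := by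
  ext i j
  simp only [insertHessian, transpose_apply, Matrix.of_apply]
  rw [insertDeriv_comm]

end SetFunctions

theorem sq_sum_le_card_mul_sum_fiber {α β : Type*} [DecidableEq β] (L : Finset α) (c : α → β)
    (v : α → ℝ) :
    (∑ e ∈ L, v e) ^ 2 ≤
      L.card * ∑ e ∈ L, ∑ f ∈ L, if c e = c f then v e * v f else 0 := by
  have h1 : ∑ e ∈ L, v e = ∑ b ∈ L.image c, ∑ e ∈ L with c e = b, v e :=
    (Finset.sum_fiberwise_of_maps_to (fun e he => Finset.mem_image_of_mem c he) v).symm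
  have h2 : ∑ e ∈ L, ∑ f ∈ L, (if c e = c f then v e * v f else 0) =
      ∑ b ∈ L.image c, (∑ e ∈ L with c e = b, v e) ^ 2 := by
    rw [← Finset.sum_fiberwise_of_maps_to (fun e he => Finset.mem_image_of_mem c he)]
    refine Finset.sum_congr rfl fun b _ => ?_
    rw [sq, Finset.sum_mul_sum]
    refine Finset.sum_congr rfl fun e he => ?_
    rw [Finset.sum_filter]
    refine Finset.sum_congr rfl fun f _ => ?_
    simp only [(Finset.mem_filter.1 he).2, eq_comm]
  rw [h1, h2]
  refine sq_sum_le_card_mul_sum_sq.trans ?_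
  refine mul_le_mul_of_nonneg_right ?_ (Finset.sum_nonneg fun _ _ => sq_nonneg _)
  exact_mod_cast Finset.card_image_le

/-- The divided power `y ^ (k - j) / (k - j)!`, extended by zero to `k < j`. -/
noncomputable def dividedPow (y : ℝ) (k j : ℕ) : ℝ :=
  if j ≤ k then y ^ (k - j) / (k - j).factorial else 0

theorem dividedPow_nonneg {y : ℝ} (hy : 0 ≤ y) (k j : ℕ) : 0 ≤ dividedPow y k j := by
  unfold dividedPow
  split_ifs <;> positivity

theorem dividedPow_zero (k j : ℕ) : dividedPow 0 k j = if j = k then 1 else 0 := by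
  unfold dividedPow
  rcases lt_trichotomy j k with h | rfl | h
  · simp [h.le, h.ne, (Nat.sub_pos_of_lt h).ne']
  · simp
  · simp [h.not_ge, h.ne']

theorem mul_dividedPow (y : ℝ) (k j : ℕ) :
    y * dividedPow y k j = ((k : ℝ) + 1 - j) * dividedPow y (k + 1) j := by
  unfold dividedPow
  rcases lt_trichotomy j (k + 1) with h | rfl | h
  · obtain ⟨m, rfl⟩ := Nat.exists_eq_add_of_le (Nat.lt_succ_iff.1 h)
    have e : j + m + 1 - j = m + 1 := by omega
    have hm : ((m : ℝ) + 1) ≠ 0 := by positivity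
    have hf : (m.factorial : ℝ) ≠ 0 := by positivity
    simp only [Nat.le_add_right, if_true, h.le, Nat.add_sub_cancel_left, e, Nat.factorial_succ]
    push_cast
    field_simp
    ring
  · simp
  · have h1 : ¬ j ≤ k := by omega
    have h2 : ¬ j ≤ k + 1 := by omega
    simp [h1, h2]

namespace PaperMatroid

variable {n : ℕ} (M : PaperMatroid n)

open Classical in
/-- The degree `d` truncated and homogenized generating function of the independent sets of
the contraction `M / S`, evaluated at `(y, 1, …, 1)`. -/
noncomputable def genFun (y : ℝ) (d : ℕ) (S : Finset (Fin n)) : ℝ :=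
  ∑ J : Finset (Fin n), if S ⊆ J ∧ M.Indep J then
    ((n - J.card).factorial : ℝ) * dividedPow y (S.card + d) J.card else 0

/-- The point at which generating functions are evaluated. -/
def evalPoint (n : ℕ) (y : ℝ) : Option (Fin n) → ℝ
  | none => y
  | some _ => 1

theorem evalPoint_pos {y : ℝ} (hy : 0 < y) (i : Option (Fin n)) : 0 < evalPoint n y i := by
  rcases i with _ | e
  exacts [hy, one_pos]

theorem genFun_nonneg {y : ℝ} (hy : 0 ≤ y) (d : ℕ) (S : Finset (Fin n)) :
    0 ≤ M.genFun y d S := by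
  refine Finset.sum_nonneg fun J _ => ?_
  split_ifs
  · exact mul_nonneg (Nat.cast_nonneg _) (dividedPow_nonneg hy _ _)
  · exact le_rfl

theorem genFun_pos {y : ℝ} (hy : 0 < y) (d : ℕ) {S : Finset (Fin n)} (hS : M.Indep S) :
    0 < M.genFun y d S := by
  refine Finset.sum_pos' (fun _ _ => ?_) ⟨S, Finset.mem_univ _, ?_⟩
  · split_ifs
    · exact mul_nonneg (Nat.cast_nonneg _) (dividedPow_nonneg hy.le _ _)
    · exact le_rfl
  · rw [if_pos ⟨subset_rfl, hS⟩]
    simp only [dividedPow, Nat.le_add_right, if_true]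
    positivity

theorem genFun_eq_zero (y : ℝ) (d : ℕ) {S : Finset (Fin n)} (hS : ¬ M.Indep S) :
    M.genFun y d S = 0 :=
  Finset.sum_eq_zero fun _ _ => if_neg fun h => hS (M.indep_subset h.1 h.2)

open Classical in
theorem genFun_zero (y : ℝ) (S : Finset (Fin n)) :
    M.genFun y 0 S = if M.Indep S then ((n - S.card).factorial : ℝ) else 0 := by
  split_ifs with hS
  · unfold genFun
    rw [Finset.sum_eq_single S]
    · simp [hS, dividedPow]
    · intro J _ hJ
      split_ifs with h
      · have := Finset.card_lt_card (h.1.ssubset_of_ne hJ.symm)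
        simp [dividedPow, this.not_ge]
      · rfl
    · simp
  · exact M.genFun_eq_zero y 0 hS

theorem sum_evalPoint_mul_insertDeriv_genFun (y : ℝ) (d : ℕ) (S : Finset (Fin n)) :
    ∑ k, evalPoint n y k * insertDeriv k (M.genFun y d) S =
      (d + 1) * M.genFun y (d + 1) S := by
  classical
  rw [Fintype.sum_option]
  simp only [evalPoint, insertDeriv, one_mul]
  have h1 : ∀ e, (if e ∈ S then 0 else M.genFun y d (insert e S)) =
      ∑ J : Finset (Fin n), if e ∈ J \ S then (if S ⊆ J ∧ M.Indep J then
        ((n - J.card).factorial : ℝ) * dividedPow y (S.card + d + 1) J.card else 0) else 0 := by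
    intro e
    by_cases he : e ∈ S
    · simp [he]
    · simp only [he, if_false, genFun, Finset.card_insert_of_notMem he, Finset.mem_sdiff,
        not_false_eq_true, and_true, Finset.insert_subset_iff]
      refine Finset.sum_congr rfl fun J _ => ?_
      simp only [← ite_and, and_assoc, add_right_comm]
  simp_rw [h1]
  rw [Finset.sum_comm]
  simp only [genFun, Finset.mul_sum, ← Finset.sum_add_distrib]
  refine Finset.sum_congr rfl fun J _ => ?_
  rw [← Finset.sum_filter, Finset.filter_univ_mem, Finset.sum_const, nsmul_eq_mul]
  split_ifs with h
  · rw [Finset.cast_card_sdiff h.1, mul_left_comm, mul_dividedPow, ← add_assoc]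
    push_cast
    ring
  · simp

theorem insertHessian_genFun_mulVec (y : ℝ) (d : ℕ) (S : Finset (Fin n)) (i : Option (Fin n)) :
    (insertHessian (M.genFun y d) S *ᵥ evalPoint n y) i =
      (d + 1) * insertDeriv i (M.genFun y (d + 1)) S := by
  rw [← insertDeriv_const_mul]
  simp_rw [← sum_evalPoint_mul_insertDeriv_genFun]
  rw [insertDeriv_sum]
  simp only [mulVec, dotProduct, insertHessian, Matrix.of_apply, mul_comm]

theorem insertHessian_genFun_none (y : ℝ) (d : ℕ) (S : Finset (Fin n)) :
    insertHessian (M.genFun y d) S none none = M.genFun y d S := rfl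

theorem insertHessian_genFun_nonneg {y : ℝ} (hy : 0 ≤ y) (d : ℕ) (S : Finset (Fin n))
    (i j : Option (Fin n)) : 0 ≤ insertHessian (M.genFun y d) S i j :=
  insertDeriv_nonneg i (fun T => insertDeriv_nonneg j (M.genFun_nonneg hy d) T) S

theorem insertHessian_genFun_eq_zero (y : ℝ) (d : ℕ) {S : Finset (Fin n)} (hS : ¬ M.Indep S) :
    insertHessian (M.genFun y d) S = 0 := by
  have h : ∀ (T : Finset (Fin n)), S ⊆ T → M.genFun y d T = 0 := fun T hT =>
    M.genFun_eq_zero y d fun hI => hS (M.indep_subset hT hI)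
  ext i j
  have h2 : ∀ T, S ⊆ T → insertDeriv j (M.genFun y d) T = 0 := by
    intro T hT
    rcases j with _ | f
    · exact h T hT
    · simp [insertDeriv, h _ (hT.trans (Finset.subset_insert f T))]
  rcases i with _ | e
  · exact h2 S subset_rfl
  · change (if e ∈ S then 0 else insertDeriv j (M.genFun y d) (insert e S)) = 0
    rw [h2 _ (Finset.subset_insert e S), ite_self]

theorem not_indep_insert_trans {S : Finset (Fin n)} {e f g : Fin n}
    (heS : e ∉ S) (hgS : g ∉ S) (heg : e ≠ g) (hf : M.Indep (insert f S))
    (hef : ¬ M.Indep (insert e (insert f S))) (hfg : ¬ M.Indep (insert g (insert f S))) :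
    ¬ M.Indep (insert e (insert g S)) := by
  intro h
  obtain ⟨i, hi, hI⟩ := M.indep_exchange hf h (by
    rw [Finset.card_insert_of_notMem (s := insert g S) (by simp [heg, heS]),
      Finset.card_insert_of_notMem hgS]
    exact Nat.lt_succ_of_le (Finset.card_insert_le f S))
  simp only [Finset.mem_sdiff, Finset.mem_insert, not_or] at hi
  rcases hi.1 with rfl | rfl | h3
  exacts [hef hI, hfg hI, hi.2.2 h3]

/-- In a contraction, being equal or parallel is the equality of suitable classes. -/
theorem exists_parallel_class (S : Finset (Fin n)) :
    ∃ c : Fin n → Finset (Fin n), ∀ e f, e ∉ S → f ∉ S → M.Indep (insert e S) →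
      M.Indep (insert f S) → (c e = c f ↔ e = f ∨ ¬ M.Indep (insert f (insert e S))) := by
  classical
  refine ⟨fun e => {g | g ∉ S ∧ M.Indep (insert g S) ∧
    (e = g ∨ ¬ M.Indep (insert g (insert e S)))}, fun e f heS hfS he hf => ⟨fun h => ?_, ?_⟩⟩
  · have h1 := (Finset.ext_iff.1 h f).2 (by simp [hfS, hf])
    exact (Finset.mem_filter.1 h1).2.2.2
  · have key : ∀ {e f}, e ∉ S → M.Indep (insert e S) → e ≠ f →
        ¬ M.Indep (insert f (insert e S)) → ∀ {g}, g ∉ S →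
        (e = g ∨ ¬ M.Indep (insert g (insert e S))) → f ∉ S →
        (f = g ∨ ¬ M.Indep (insert g (insert f S))) := by
      intro e f heS he hef hpar g hgS hg hfS
      by_cases hfg : f = g
      · exact Or.inl hfg
      rcases hg with rfl | hg
      · right
        rwa [Finset.insert_comm]
      · exact Or.inr (M.not_indep_insert_trans hgS hfS (Ne.symm hfg) he hg hpar)
    rintro (rfl | hpar)
    · rfl
    by_cases hef : e = f
    · rw [hef]
    ext g
    simp only [Finset.mem_filter, Finset.mem_univ, true_and]
    refine and_congr_right fun hgS => and_congr_right fun _ => ⟨fun hg => ?_, fun hg => ?_⟩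
    · exact key heS he hef hpar hgS hg hfS
    · exact key hfS hf (Ne.symm hef) (by rwa [Finset.insert_comm]) hgS hg heS

theorem insertHessian_genFun_zero_reverseCauchySchwarz {y : ℝ} (hy : 0 < y)
    {S : Finset (Fin n)} (hS : M.Indep S) :
    ReverseCauchySchwarz (insertHessian (M.genFun y 0) S) (evalPoint n y) := by
  classical
  set H := insertHessian (M.genFun y 0) S with hH
  have hHo : 0 < H none none := M.genFun_pos hy 0 hS
  have hHnn : ∀ i j, 0 ≤ H i j := M.insertHessian_genFun_nonneg hy.le 0 S
  have hz := evalPoint_pos (n := n) hy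
  refine reverseCauchySchwarz_of_nonpos (insertHessian_isSymm _ _) none ?_ fun v hv => ?_
  · have hHz : ∀ i, 0 ≤ (H *ᵥ evalPoint n y) i := fun i => by
      simp only [mulVec, dotProduct]
      exact Finset.sum_nonneg fun j _ => mul_nonneg (hHnn i j) (hz j).le
    refine Finset.sum_pos' (fun i _ => mul_nonneg (hz i).le (hHz i))
      ⟨none, Finset.mem_univ _, mul_pos (hz _) ?_⟩
    exact Finset.sum_pos' (fun j _ => mul_nonneg (hHnn _ j) (hz j).le)
      ⟨none, Finset.mem_univ _, mul_pos hHo (hz _)⟩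
  set N := n - S.card with hN
  set L : Finset (Fin n) := {e | e ∉ S ∧ M.Indep (insert e S)} with hL
  obtain ⟨c, hc⟩ := M.exists_parallel_class S
  have h00 : H none none = N.factorial := by
    rw [hH, insertHessian_genFun_none, genFun_zero, if_pos hS]
  have h0e : ∀ e, H none (some e) = if e ∈ L then ((N - 1).factorial : ℝ) else 0 := by
    intro e
    change (if e ∈ S then 0 else M.genFun y 0 (insert e S)) = _
    by_cases he : e ∈ S
    · simp [hL, he]
    · simp [hL, he, genFun_zero, Finset.card_insert_of_notMem he, hN, Nat.sub_sub]
  have he0 : ∀ e, H (some e) none = H none (some e) := fun e =>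
    (insertHessian_isSymm _ _).apply _ _
  have hef : ∀ e f, H (some e) (some f) =
      if e ∈ L ∧ f ∈ L ∧ c e ≠ c f then ((N - 2).factorial : ℝ) else 0 := by
    intro e f
    change (if e ∈ S then 0 else if f ∈ insert e S then 0 else
      M.genFun y 0 (insert f (insert e S))) = _
    by_cases he : e ∈ S
    · simp [hL, he]
    by_cases hf : f ∈ S
    · simp [hL, hf]
    by_cases hfe : f = e
    · simp [hfe]
    have hfeS : f ∉ insert e S := by simp [hfe, hf]
    rw [if_neg he, if_neg hfeS, genFun_zero, Finset.card_insert_of_notMem hfeS,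
      Finset.card_insert_of_notMem he]
    by_cases hI : M.Indep (insert f (insert e S))
    · have hI1 : M.Indep (insert e S) := M.indep_subset (Finset.subset_insert _ _) hI
      have hI2 : M.Indep (insert f S) :=
        M.indep_subset (Finset.insert_subset_insert f (Finset.subset_insert e S)) hI
      have : c e ≠ c f := by
        rw [Ne, hc e f he hf hI1 hI2]
        simp [Ne.symm hfe, hI]
      simp [hI, hL, he, hf, hI1, hI2, this, hN, Nat.sub_sub]
    · rw [if_neg hI, if_neg]
      rintro ⟨h1, h2, h3⟩
      simp only [hL, Finset.mem_filter] at h1 h2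
      exact h3 ((hc e f he hf h1.2.2 h2.2.2).2 (Or.inr hI))
  set σ := ∑ e ∈ L, v (some e) with hσ
  set Q := ∑ e ∈ L, ∑ f ∈ L, if c e = c f then v (some e) * v (some f) else 0 with hQ
  have hrow0 : (H *ᵥ v) none = N.factorial * v none + (N - 1).factorial * σ := by
    simp only [mulVec, dotProduct, Fintype.sum_option, h00, h0e, hσ, Finset.mul_sum, ite_mul,
      zero_mul]
    rw [Finset.sum_ite_mem, Finset.univ_inter]
  have hpair : ∑ e, ∑ f, v (some e) * (H (some e) (some f) * v (some f)) =
      (N - 2).factorial * (σ ^ 2 - Q) := by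
    have h1 : σ ^ 2 - Q = ∑ e ∈ L, ∑ f ∈ L,
        if c e = c f then 0 else v (some e) * v (some f) := by
      rw [hσ, hQ, sq, Finset.sum_mul_sum]
      simp only [← Finset.sum_sub_distrib]
      refine Finset.sum_congr rfl fun e _ => Finset.sum_congr rfl fun f _ => ?_
      split_ifs <;> ring
    rw [h1, Finset.mul_sum, ← Finset.univ_inter L, ← Finset.sum_ite_mem]
    refine Finset.sum_congr rfl fun e _ => ?_
    split_ifs with he
    · rw [Finset.mul_sum, Finset.univ_inter, ← Finset.univ_inter L, ← Finset.sum_ite_mem]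
      refine Finset.sum_congr rfl fun f _ => ?_
      rw [hef]
      by_cases hf : f ∈ L <;> by_cases h : c e = c f <;> simp [he, hf, h]
      ring
    · exact Finset.sum_eq_zero fun f _ => by simp [hef, he]
  have hvHv : v ⬝ᵥ H *ᵥ v = (N - 1).factorial * v none * σ +
      (N - 2).factorial * (σ ^ 2 - Q) := by
    rw [dotProduct, Fintype.sum_option, hv, mul_zero, zero_add, ← hpair]
    simp only [mulVec, dotProduct, Fintype.sum_option, mul_add, Finset.mul_sum,
      Finset.sum_add_distrib]
    congr 1
    rw [hσ, Finset.mul_sum, ← Finset.univ_inter L, ← Finset.sum_ite_mem]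
    refine Finset.sum_congr rfl fun e _ => ?_
    rw [he0, h0e]
    split_ifs <;> ring
  have hcard : L.card ≤ N := by
    have h1 : L ⊆ Sᶜ := fun e he => by
      simp only [hL, Finset.mem_filter] at he
      simpa using he.2.1
    have h2 := Finset.card_le_card h1
    rwa [Finset.card_compl, Fintype.card_fin] at h2
  have hQσ : σ ^ 2 ≤ L.card * Q := sq_sum_le_card_mul_sum_fiber L c fun e => v (some e)
  rw [hrow0] at hv
  rw [hvHv]
  rcases Nat.eq_zero_or_pos L.card with hL0 | hL0
  · have : L = ∅ := Finset.card_eq_zero.1 hL0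
    simp [hσ, hQ, this]
  have hLpos : (0 : ℝ) < L.card := by exact_mod_cast hL0
  have hQ0 : 0 ≤ Q := nonneg_of_mul_nonneg_right ((sq_nonneg σ).trans hQσ) hLpos
  have hNQ : σ ^ 2 ≤ N * Q :=
    hQσ.trans (mul_le_mul_of_nonneg_right (by exact_mod_cast hcard) hQ0)
  obtain ⟨m, hm⟩ : ∃ m, N = m + 1 := ⟨N - 1, by omega⟩
  rw [hm] at hv hNQ ⊢
  have hmf : (m.factorial : ℝ) ≠ 0 := by positivity
  simp only [Nat.add_sub_cancel, Nat.factorial_succ] at hv ⊢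
  push_cast at hv hNQ
  have hv0 : σ = -((m + 1) * v none) := by
    have : (m.factorial : ℝ) * ((m + 1) * v none + σ) = 0 := by linear_combination hv
    linarith [(mul_eq_zero.1 this).resolve_left hmf]
  have hm1 : (0 : ℝ) < m + 1 := by positivity
  refine nonpos_of_mul_nonpos_right (a := (m : ℝ) + 1) ?_ hm1
  have e1 : ((m : ℝ) + 1) * (m.factorial * v none * σ) = -(m.factorial * σ ^ 2) := by
    linear_combination (m.factorial * σ) * hv0
  rw [mul_add, e1]
  rcases m with _ | r
  · simp only [Nat.cast_zero, zero_add, one_mul] at hNQ ⊢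
    norm_num
    nlinarith
  · have e2 : r + 1 + 1 - 2 = r := by omega
    rw [e2, Nat.factorial_succ]
    push_cast at hNQ ⊢
    have hr : (0 : ℝ) ≤ r.factorial := by positivity
    nlinarith [mul_le_mul_of_nonneg_left hNQ hr]

/-- The homogenized generating functions of the contractions of a matroid are Lorentzian at
`(y, 1, …, 1)`. -/
theorem insertHessian_genFun_reverseCauchySchwarz {y : ℝ} (hy : 0 < y) (d : ℕ)
    (S : Finset (Fin n)) :
    ReverseCauchySchwarz (insertHessian (M.genFun y d) S) (evalPoint n y) := by
  classical
  induction d generalizing S with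
  | zero =>
    by_cases hS : M.Indep S
    · exact M.insertHessian_genFun_zero_reverseCauchySchwarz hy hS
    · rw [M.insertHessian_genFun_eq_zero y 0 hS]
      simp [ReverseCauchySchwarz]
  | succ d ih =>
    by_cases hS : M.Indep S
    swap
    · rw [M.insertHessian_genFun_eq_zero y _ hS]
      simp [ReverseCauchySchwarz]
    have hslice : ∀ e, (Matrix.of fun i j =>
        insertDeriv (some e) (insertDeriv i (insertDeriv j (M.genFun y d))) S) =
        if e ∈ S then 0 else insertHessian (M.genFun y d) (insert e S) := by
      intro e
      ext i j
      simp only [Matrix.of_apply]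
      conv_lhs => rw [insertDeriv]
      split_ifs <;> rfl
    refine reverseCauchySchwarz_of_slices (insertHessian_isSymm _ _) (evalPoint_pos hy)
      (o := none) (M.genFun_pos hy _ hS) ?_ (fun k => Matrix.of fun i j =>
        insertDeriv k (insertDeriv i (insertDeriv j (M.genFun y d))) S) ?_ ?_ ?_
      (m := (d : ℝ) + 1) (by positivity) ?_ ?_
    · rintro (_ | e) hi j
      · exact absurd hi (M.genFun_pos hy _ hS).ne'
      · change (if e ∈ S then 0 else M.genFun y (d + 1) (insert e S)) = 0 at hi
        change (if e ∈ S then 0 else insertHessian (M.genFun y (d + 1)) (insert e S) none j) = 0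
        split_ifs at hi ⊢ with he
        · rfl
        · rw [M.insertHessian_genFun_eq_zero y _ fun hI => (M.genFun_pos hy _ hI).ne' hi]
          rfl
    · exact fun k i j => insertDeriv_nonneg k (fun T =>
        M.insertHessian_genFun_nonneg hy.le d T i j) S
    · intro k
      ext i j
      simp only [transpose_apply, Matrix.of_apply]
      rw [insertDeriv_comm i j]
    · intro k i j
      simp only [Matrix.of_apply]
      rw [insertDeriv_comm]
    · intro i j
      simp only [Matrix.of_apply, insertHessian]
      have h1 : ∀ k, insertDeriv k (insertDeriv i (insertDeriv j (M.genFun y d))) =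
          insertDeriv i (insertDeriv j (insertDeriv k (M.genFun y d))) := fun k => by
        rw [insertDeriv_comm k i, insertDeriv_comm k j]
      simp_rw [h1]
      rw [← insertDeriv_sum, ← insertDeriv_const_mul]
      congr 1
      ext T
      rw [← insertDeriv_sum, ← insertDeriv_const_mul]
      congr 1
      ext U
      exact M.sum_evalPoint_mul_insertDeriv_genFun y d U
    · rintro (_ | e)
      · exact ih S
      · rw [hslice]
        split_ifs
        · simp [ReverseCauchySchwarz]
        · exact ih _

theorem genFun_mul_genFun_le {y : ℝ} (hy : 0 < y) (d : ℕ) :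
    ((d : ℝ) + 2) * (M.genFun y (d + 2) ∅ * M.genFun y d ∅) ≤
      (d + 1) * M.genFun y (d + 1) ∅ ^ 2 := by
  classical
  have h := M.insertHessian_genFun_reverseCauchySchwarz hy d ∅ (Pi.single none 1)
  have h1 : evalPoint n y ⬝ᵥ insertHessian (M.genFun y d) ∅ *ᵥ evalPoint n y =
      (d + 1) * ((d + 2) * M.genFun y (d + 2) ∅) := by
    simp only [dotProduct, insertHessian_genFun_mulVec, mul_left_comm _ ((d : ℝ) + 1)]
    rw [← Finset.mul_sum, sum_evalPoint_mul_insertDeriv_genFun]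
    push_cast
    ring
  have h2 : evalPoint n y ⬝ᵥ insertHessian (M.genFun y d) ∅ *ᵥ Pi.single none 1 =
      (d + 1) * M.genFun y (d + 1) ∅ := by
    rw [(insertHessian_isSymm _ _).dotProduct_mulVec_comm, single_one_dotProduct,
      insertHessian_genFun_mulVec]
    rfl
  have h3 : (Pi.single none 1 : Option (Fin n) → ℝ) ⬝ᵥ
      insertHessian (M.genFun y d) ∅ *ᵥ Pi.single none 1 = M.genFun y d ∅ := by
    rw [single_one_dotProduct, mulVec_single_one]
    rfl
  rw [h1, h2, h3] at h
  have hd : (0 : ℝ) < d + 1 := by positivity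
  refine le_of_mul_le_mul_left ?_ hd
  linarith

theorem continuous_genFun (d : ℕ) (S : Finset (Fin n)) :
    Continuous fun y => M.genFun y d S := by
  unfold genFun dividedPow
  refine continuous_finsetSum _ fun J _ => ?_
  split_ifs <;> fun_prop

theorem genFun_zero_empty (d : ℕ) :
    M.genFun 0 d ∅ = ((n - d).factorial : ℝ) * numIndep M d := by
  classical
  have h : numIndep M d = Finset.card {J : Finset (Fin n) | M.Indep J ∧ J.card = d} := by
    rw [numIndep, Nat.card_eq_fintype_card, Fintype.card_subtype]
  rw [h, mul_comm, ← nsmul_eq_mul, ← Finset.sum_const, Finset.sum_filter, genFun]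
  refine Finset.sum_congr rfl fun J _ => ?_
  by_cases hJ : M.Indep J <;> by_cases hd : J.card = d <;> simp [hJ, hd, dividedPow_zero]

theorem numIndep_mul_numIndep_le (m r : ℕ) (hn : n = m + 2 + r) :
    (m + 2) * (r + 2) * (numIndep M m * numIndep M (m + 2)) ≤
      (m + 1) * (r + 1) * numIndep M (m + 1) ^ 2 := by
  have hlim : ((m : ℝ) + 2) * (M.genFun 0 (m + 2) ∅ * M.genFun 0 m ∅) ≤
      (m + 1) * M.genFun 0 (m + 1) ∅ ^ 2 := by
    have hc := fun d => M.continuous_genFun d ∅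
    refine le_of_tendsto_of_tendsto (b := nhdsWithin (0 : ℝ) (Set.Ioi 0))
      (((continuous_const.mul ((hc (m + 2)).mul (hc m))).tendsto 0).mono_left
        nhdsWithin_le_nhds)
      (((continuous_const.mul ((hc (m + 1)).pow 2)).tendsto 0).mono_left nhdsWithin_le_nhds) ?_
    filter_upwards [self_mem_nhdsWithin] with y hy using M.genFun_mul_genFun_le hy m
  have e0 : n - m = r + 2 := by omega
  have e1 : n - (m + 1) = r + 1 := by omega
  have e2 : n - (m + 2) = r := by omega
  simp only [genFun_zero_empty, e0, e1, e2, Nat.factorial_succ] at hlim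
  have hr : (0 : ℝ) < r.factorial ^ 2 * (r + 1) := by positivity
  have : ((m : ℝ) + 2) * (r + 2) * (numIndep M m * numIndep M (m + 2)) ≤
      (m + 1) * (r + 1) * numIndep M (m + 1) ^ 2 := by
    refine le_of_mul_le_mul_left ?_ hr
    push_cast at hlim
    linarith
  exact_mod_cast this

end PaperMatroid

/-- **Mason's conjecture, strongest form (ultra log-concavity).**
For a matroid on `n` elements with `I_k` independent sets of size `k`, for `0 < k < n`:
`(I_k / C(n,k))² ≥ (I_{k-1} / C(n,k-1)) · (I_{k+1} / C(n,k+1))`, i.e.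
`I_k² · C(n,k-1) · C(n,k+1) ≥ I_{k-1} · I_{k+1} · C(n,k)²`. -/
theorem mason_ultra_log_concave {n : ℕ} (M : PaperMatroid n) (k : ℕ)
    (hk0 : 0 < k) (hkn : k < n) :
    numIndep M (k-1) * numIndep M (k+1) * (n.choose k) ^ 2 ≤
      (numIndep M k) ^ 2 * n.choose (k-1) * n.choose (k+1) := by
  obtain ⟨m, rfl⟩ : ∃ m, k = m + 1 := ⟨k - 1, by omega⟩
  obtain ⟨r, hr⟩ := Nat.exists_eq_add_of_le (show m + 2 ≤ n by omega)
  have h := M.numIndep_mul_numIndep_le m r hr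
  have h1 := Nat.choose_succ_right_eq n m
  have h2 := Nat.choose_succ_right_eq n (m + 1)
  rw [show n - m = r + 2 by omega] at h1
  rw [show n - (m + 1) = r + 1 by omega] at h2
  simp only [Nat.add_sub_cancel]
  refine Nat.le_of_mul_le_mul_left (c := (m + 2) * (r + 2)) ?_ (by positivity)
  calc (m + 2) * (r + 2) * (numIndep M m * numIndep M (m + 1 + 1) * n.choose (m + 1) ^ 2)
      = (m + 2) * (r + 2) * (numIndep M m * numIndep M (m + 2)) * n.choose (m + 1) ^ 2 := by ring
    _ ≤ (m + 1) * (r + 1) * numIndep M (m + 1) ^ 2 * n.choose (m + 1) ^ 2 :=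
        Nat.mul_le_mul_right _ h
    _ = numIndep M (m + 1) ^ 2 * (n.choose (m + 1) * (m + 1)) *
        (n.choose (m + 1) * (r + 1)) := by ring
    _ = numIndep M (m + 1) ^ 2 * (n.choose m * (r + 2)) *
        (n.choose (m + 1 + 1) * (m + 1 + 1)) := by rw [h1, h2]
    _ = _ := by ring
end

section
/- Let M be a matroid on a ground set of n elements, and for each k let I_k denote the number of independent sets of M of cardinality k. Then for every k with 0 < k < n, one has I_k^2 ≥ (1 + 1/k) · I_{k-1} · I_{k+1}, i.e. k · I_k^2 ≥ (k+1) · I_{k-1} · I_{k+1}. -/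
open Matrix MvPolynomial

/-- If every eigenvector of `A` with positive eigenvalue is a multiple of `z`, then `A` is
nonpositive on the orthogonal complement of `z`. -/
theorem Matrix.dotProduct_mulVec_self_nonpos {ι : Type*} [Fintype ι]
    {A : Matrix ι ι ℝ} (hA : A.IsHermitian) {z w : ι → ℝ}
    (hz : ∀ (μ : ℝ) (y : ι → ℝ), 0 < μ → A *ᵥ y = μ • y → ∃ c : ℝ, y = c • z)
    (hw : w ⬝ᵥ z = 0) : w ⬝ᵥ (A *ᵥ w) ≤ 0 := by
  classical
  let b := hA.eigenvectorBasis
  have hinner : ∀ (i : ι) (y : ι → ℝ), inner ℝ (b i) (WithLp.toLp 2 y) = y ⬝ᵥ (b i).ofLp := by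
    intro i y
    simp [EuclideanSpace.inner_eq_star_dotProduct]
  have hexp := b.sum_inner_mul_inner (WithLp.toLp 2 w) (WithLp.toLp 2 (A *ᵥ w))
  rw [EuclideanSpace.inner_toLp_toLp, star_trivial, dotProduct_comm] at hexp
  rw [← hexp]
  refine Finset.sum_nonpos fun i _ ↦ ?_
  have heig : A *ᵥ (b i).ofLp = hA.eigenvalues i • (b i).ofLp := hA.mulVec_eigenvectorBasis i
  have hAw : (A *ᵥ w) ⬝ᵥ (b i).ofLp = hA.eigenvalues i * (w ⬝ᵥ (b i).ofLp) := by
    have hT : Aᵀ = A := by rw [← conjTranspose_eq_transpose_of_trivial, hA.eq]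
    rw [← smul_eq_mul, ← dotProduct_smul, ← heig, dotProduct_mulVec, ← mulVec_transpose, hT]
  rw [real_inner_comm, hinner, hinner, hAw]
  rcases le_or_gt (hA.eigenvalues i) 0 with h | h
  · nlinarith [mul_self_nonneg (w ⬝ᵥ (b i).ofLp)]
  · obtain ⟨c, hc⟩ := hz _ _ h heig
    simp [hc, dotProduct_smul, hw]

/-- The bilinear form of a real matrix. -/
def bilin {ι : Type*} [Fintype ι] (H : ι → ι → ℝ) (v w : ι → ℝ) : ℝ :=
  ∑ i, v i * ∑ j, H i j * w j

section Hyperbolic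

variable {ι : Type*} [Fintype ι] {H : ι → ι → ℝ}

theorem bilin_comm (hH : ∀ i j, H i j = H j i) (v w : ι → ℝ) : bilin H v w = bilin H w v := by
  simp only [bilin, Finset.mul_sum]
  rw [Finset.sum_comm]
  refine Finset.sum_congr rfl fun i _ ↦ Finset.sum_congr rfl fun j _ ↦ ?_
  rw [hH j i]; ring

theorem bilin_combo_left (a b : ℝ) (v w u : ι → ℝ) :
    bilin H (fun i ↦ a * v i - b * w i) u = a * bilin H v u - b * bilin H w u := by
  simp only [bilin, Finset.mul_sum, ← Finset.sum_sub_distrib]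
  exact Finset.sum_congr rfl fun i _ ↦ Finset.sum_congr rfl fun j _ ↦ by ring

theorem bilin_nonneg (hH : ∀ i j, 0 ≤ H i j) {v w : ι → ℝ} (hv : ∀ i, 0 ≤ v i)
    (hw : ∀ i, 0 ≤ w i) : 0 ≤ bilin H v w :=
  Finset.sum_nonneg fun i _ ↦ mul_nonneg (hv i) <|
    Finset.sum_nonneg fun j _ ↦ mul_nonneg (hH i j) (hw j)

/-- A symmetric form that is nonpositive on a hyperplane satisfies the reversed Cauchy-Schwarz
inequality against every nonnegative vector off the hyperplane. -/
theorem bilin_mul_bilin_le_sq (hH : ∀ i j, H i j = H j i) {x : ι → ℝ} (hx : 0 ≤ bilin H x x)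
    (l : ι → ℝ) (hl : l ⬝ᵥ x ≠ 0) (hneg : ∀ w, l ⬝ᵥ w = 0 → bilin H w w ≤ 0) (v : ι → ℝ) :
    bilin H v v * bilin H x x ≤ bilin H v x ^ 2 := by
  have h := hneg (fun i ↦ (l ⬝ᵥ x) * v i - (l ⬝ᵥ v) * x i) (by
    have : (fun i ↦ (l ⬝ᵥ x) * v i - (l ⬝ᵥ v) * x i) = (l ⬝ᵥ x) • v - (l ⬝ᵥ v) • x := rfl
    rw [this, dotProduct_sub, dotProduct_smul, dotProduct_smul, smul_eq_mul, smul_eq_mul]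
    ring)
  rw [bilin_combo_left, bilin_comm hH v, bilin_comm hH x, bilin_combo_left, bilin_combo_left,
    bilin_comm hH x v] at h
  set p := l ⬝ᵥ x
  set q := l ⬝ᵥ v
  set a := bilin H v v
  set b := bilin H v x
  set c := bilin H x x
  have hp : 0 < p ^ 2 := by positivity
  refine le_of_mul_le_mul_left ?_ hp
  nlinarith [mul_le_mul_of_nonneg_right h hx, sq_nonneg (p * b - q * c)]

/-- The Laplacian identity of a weighted graph with the weights `H i j * x i * x j`. -/
theorem sum_laplacian (hH : ∀ i j, H i j = H j i) {x : ι → ℝ} (hx : ∀ i, 0 < x i) (v : ι → ℝ) :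
    ∑ i, ∑ j, H i j * x i * x j * (v i / x i - v j / x j) ^ 2
      = 2 * ∑ i, v i ^ 2 * ((∑ j, H i j * x j) / x i) - 2 * bilin H v v := by
  have h₁ : ∀ i j, H i j * x i * x j * (v i / x i - v j / x j) ^ 2
      = v i ^ 2 * ((H i j * x j) / x i) + v j ^ 2 * ((H j i * x i) / x j)
        - 2 * (v i * (H i j * v j)) := by
    intro i j
    have := (hx i).ne'
    have := (hx j).ne'
    rw [hH j i]
    field_simp
    ring
  simp only [h₁, Finset.sum_sub_distrib, Finset.sum_add_distrib]
  rw [Finset.sum_comm (f := fun i j ↦ v j ^ 2 * ((H j i * x i) / x j))]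
  simp only [bilin, Finset.mul_sum, Finset.sum_div]
  simp only [← Finset.sum_add_distrib]
  congr 1
  exact Finset.sum_congr rfl fun i _ ↦ Finset.sum_congr rfl fun j _ ↦ by ring

/-- If all eigenvalues of the normalization of a nonnegative symmetric matrix `H` lie outside the
open interval `(0, 1)` and the support of `H` is connected through `o`, then `H` is
nonpositive on the `H`-orthogonal complement of `x`. -/
theorem bilin_self_nonpos_of_le (hH : ∀ i j, H i j = H j i) (hpos : ∀ i j, 0 ≤ H i j)
    {x : ι → ℝ} (hx : ∀ i, 0 < x i) (o : ι) (ho : ∀ i, H o i = 0 → ∀ j, H i j = 0)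
    (hle : ∀ v, bilin H v v ≤ ∑ i, x i * ((∑ j, H i j * v j) ^ 2 / ∑ j, H i j * x j))
    {v : ι → ℝ} (hv : bilin H v x = 0) : bilin H v v ≤ 0 := by
  set r : ι → ℝ := fun i ↦ ∑ j, H i j * x j with hr
  have hr0 : ∀ i, 0 ≤ r i := fun i ↦
    Finset.sum_nonneg fun j _ ↦ mul_nonneg (hpos i j) (hx j).le
  have hrow : ∀ i, r i = 0 → ∀ j, H i j = 0 := by
    intro i hi j
    have := (Finset.sum_eq_zero_iff_of_nonneg
      fun j _ ↦ mul_nonneg (hpos i j) (hx j).le).1 hi j (Finset.mem_univ j)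
    exact (mul_eq_zero.1 this).resolve_right (hx j).ne'
  set s : ι → ℝ := fun i ↦ √(r i / x i) with hs
  have hs2 : ∀ i, s i ^ 2 = r i / x i := fun i ↦ Real.sq_sqrt (div_nonneg (hr0 i) (hx i).le)
  have hs0 : ∀ i, s i = 0 → r i = 0 := by
    intro i hi
    have := hs2 i
    rw [hi] at this
    have := (div_eq_zero_iff.1 (by simpa using this.symm)).resolve_right (hx i).ne'
    exact this
  let A : Matrix ι ι ℝ := Matrix.of fun i j ↦ H i j / (s i * s j)
  have hA : A.IsHermitian := by
    ext i j
    simp [A, hH i j, mul_comm]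
  have hAs : ∀ i j, s i * A i j * s j = H i j := by
    intro i j
    simp only [A, Matrix.of_apply]
    by_cases hi : s i = 0
    · simp [hi, hrow i (hs0 i hi) j]
    by_cases hj : s j = 0
    · simp [hj, hH i j, hrow j (hs0 j hj) i]
    field_simp
  have hAy : ∀ y i, (A *ᵥ y) i = (∑ j, H i j * (y j / s j)) / s i := by
    intro y i
    simp only [mulVec, dotProduct, A, Matrix.of_apply, Finset.sum_div]
    exact Finset.sum_congr rfl fun j _ ↦ by
      rw [div_mul_eq_mul_div, mul_div_assoc', div_div, mul_comm (s j)]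
  have hyAy : ∀ y, y ⬝ᵥ (A *ᵥ y) = bilin H (fun i ↦ y i / s i) (fun i ↦ y i / s i) := by
    intro y
    simp only [dotProduct, hAy, bilin]
    exact Finset.sum_congr rfl fun i _ ↦ by ring
  have key : ∀ (μ : ℝ) (y : ι → ℝ), 0 < μ → A *ᵥ y = μ • y →
      ∃ c : ℝ, y = c • fun i ↦ s i * x i := by
    intro μ y hμ hy
    set u : ι → ℝ := fun i ↦ y i / s i with hu
    have hyi : ∀ i, (∑ j, H i j * u j) / s i = μ * y i := by
      intro i
      rw [← hAy y i, hy]; rfl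
    have hy0 : ∀ i, s i = 0 → y i = 0 := by
      intro i hi
      have := hyi i
      rw [hi, div_zero] at this
      exact (mul_eq_zero.1 this.symm).resolve_left hμ.ne'
    have hus : ∀ i, u i * s i = y i := by
      intro i
      by_cases hi : s i = 0
      · simp [hi, hy0 i hi]
      · simp [hu, hi]
    have hyy : bilin H u u = μ * (y ⬝ᵥ y) := by
      rw [← hyAy, hy, dotProduct_smul, smul_eq_mul]
    have hup : bilin H u u ≤ μ ^ 2 * (y ⬝ᵥ y) := by
      refine (hle u).trans_eq ?_
      rw [dotProduct, Finset.mul_sum]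
      refine Finset.sum_congr rfl fun i _ ↦ ?_
      have : μ ^ 2 * (y i * y i) = (∑ j, H i j * u j) ^ 2 / s i ^ 2 := by
        rw [← div_pow, hyi]; ring
      rw [this, hs2]
      simp only [hr]
      rw [div_div_eq_mul_div]; ring
    have hlap := sum_laplacian hH hx u
    have hdiag : ∑ i, u i ^ 2 * ((∑ j, H i j * x j) / x i) = y ⬝ᵥ y := by
      rw [dotProduct]
      refine Finset.sum_congr rfl fun i _ ↦ ?_
      change u i ^ 2 * (r i / x i) = _
      rw [← hs2, ← mul_pow, hus, sq]
    have hyy0 : 0 ≤ y ⬝ᵥ y := Finset.sum_nonneg fun i _ ↦ mul_self_nonneg _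
    have hterm : ∀ i j, 0 ≤ H i j * x i * x j * (u i / x i - u j / x j) ^ 2 := fun i j ↦
      mul_nonneg (mul_nonneg (mul_nonneg (hpos i j) (hx i).le) (hx j).le) (sq_nonneg _)
    have hzero : ∑ i, ∑ j, H i j * x i * x j * (u i / x i - u j / x j) ^ 2 = 0 := by
      refine le_antisymm ?_ (Finset.sum_nonneg fun i _ ↦ Finset.sum_nonneg fun j _ ↦ hterm i j)
      rw [hlap, hdiag, hyy]
      rw [hyy] at hup
      have : 0 ≤ (μ - 1) * (y ⬝ᵥ y) := by
        refine nonneg_of_mul_nonneg_right ?_ hμ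
        nlinarith
      nlinarith
    refine ⟨u o / x o, funext fun i ↦ ?_⟩
    simp only [Pi.smul_apply, smul_eq_mul]
    by_cases hoi : H o i = 0
    · have hri : r i = 0 := Finset.sum_eq_zero fun j _ ↦ by rw [ho i hoi j, zero_mul]
      have hsi : s i = 0 := by simp [hs, hri]
      rw [hy0 i hsi, hsi]; simp
    · have h₁ := (Finset.sum_eq_zero_iff_of_nonneg fun i _ ↦
        Finset.sum_nonneg fun j _ ↦ hterm i j).1 hzero o (Finset.mem_univ o)
      have h₂ := (Finset.sum_eq_zero_iff_of_nonneg fun j _ ↦ hterm o j).1 h₁ i (Finset.mem_univ i)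
      have h₃ : u o / x o - u i / x i = 0 := by
        simpa [hoi, (hx o).ne', (hx i).ne'] using h₂
      rw [sub_eq_zero.1 h₃, ← hus]
      have := (hx i).ne'
      field_simp
  have hfin := Matrix.dotProduct_mulVec_self_nonpos hA key (w := fun i ↦ s i * v i) (by
    rw [← hv, bilin, dotProduct]
    refine Finset.sum_congr rfl fun i _ ↦ ?_
    have := (hx i).ne'
    calc s i * v i * (s i * x i) = s i ^ 2 * x i * v i := by ring
      _ = v i * r i := by rw [hs2]; field_simp)
  refine le_trans (le_of_eq ?_) hfin
  simp only [bilin, dotProduct, mulVec, Finset.mul_sum]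
  exact Finset.sum_congr rfl fun i _ ↦ Finset.sum_congr rfl fun j _ ↦ by rw [← hAs i j]; ring

/-- Local-to-global principle: a nonnegative symmetric matrix satisfies the reversed Cauchy-Schwarz
inequality when it is the average of the slices of a symmetric tensor which all satisfy it. -/
theorem bilin_mul_bilin_le_sq_of_slices (hpos : ∀ i j, 0 ≤ H i j) {T : ι → ι → ι → ℝ}
    (hT₁ : ∀ i j k, T i j k = T j i k) (hT₂ : ∀ i j k, T i j k = T i k j)
    (hTpos : ∀ i j k, 0 ≤ T i j k) {x : ι → ℝ} (hx : ∀ i, 0 < x i) {m : ℝ} (hm : 0 < m)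
    (hsum : ∀ i j, ∑ k, T i j k * x k = m * H i j)
    (o : ι) (ho : ∀ i, H o i = 0 → ∀ j, H i j = 0)
    (hyp : ∀ i v, bilin (T i) v v * bilin (T i) x x ≤ bilin (T i) v x ^ 2) (v : ι → ℝ) :
    bilin H v v * bilin H x x ≤ bilin H v x ^ 2 := by
  have hH : ∀ i j, H i j = H j i := by
    intro i j
    refine mul_left_cancel₀ hm.ne' ?_
    rw [← hsum, ← hsum]
    exact Finset.sum_congr rfl fun k _ ↦ by rw [hT₁]
  have hTx : ∀ i v, bilin (T i) v x = m * ∑ j, H i j * v j := by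
    intro i v
    rw [bilin, Finset.mul_sum]
    exact Finset.sum_congr rfl fun j _ ↦ by rw [hsum]; ring
  have hsumT : ∀ v, ∑ i, x i * bilin (T i) v v = m * bilin H v v := by
    intro v
    simp only [bilin, Finset.mul_sum]
    rw [Finset.sum_comm]
    refine Finset.sum_congr rfl fun j _ ↦ ?_
    rw [Finset.sum_comm]
    refine Finset.sum_congr rfl fun k _ ↦ ?_
    have : m * (v j * (H j k * v k)) = v j * v k * (m * H j k) := by ring
    rw [this, ← hsum, Finset.mul_sum]
    exact Finset.sum_congr rfl fun i _ ↦ by rw [hT₁ i j k, hT₂ j i k]; ring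
  have hle : ∀ v, bilin H v v ≤ ∑ i, x i * ((∑ j, H i j * v j) ^ 2 / ∑ j, H i j * x j) := by
    intro v
    refine le_of_mul_le_mul_left ?_ hm
    rw [← hsumT, Finset.mul_sum]
    refine Finset.sum_le_sum fun i _ ↦ ?_
    rw [mul_left_comm]
    refine mul_le_mul_of_nonneg_left ?_ (hx i).le
    have h := hyp i v
    rw [hTx, hTx] at h
    have hr0 : 0 ≤ ∑ j, H i j * x j :=
      Finset.sum_nonneg fun j _ ↦ mul_nonneg (hpos i j) (hx j).le
    rcases hr0.eq_or_lt with hr | hr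
    · have hz : ∀ j k, T i j k = 0 := by
        intro j k
        have h₁ := (Finset.sum_eq_zero_iff_of_nonneg
          fun j _ ↦ mul_nonneg (hpos i j) (hx j).le).1 hr.symm j (Finset.mem_univ j)
        have h₂ : ∑ k, T i j k * x k = 0 := by
          rw [hsum, (mul_eq_zero.1 h₁).resolve_right (hx j).ne', mul_zero]
        have h₃ := (Finset.sum_eq_zero_iff_of_nonneg
          fun k _ ↦ mul_nonneg (hTpos i j k) (hx k).le).1 h₂ k (Finset.mem_univ k)
        exact (mul_eq_zero.1 h₃).resolve_right (hx k).ne'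
      rw [← hr]
      simp [bilin, hz]
    · rw [mul_div_assoc', le_div_iff₀ hr]
      refine le_of_mul_le_mul_left ?_ hm
      linarith
  have hxx : 0 ≤ bilin H x x := bilin_nonneg hpos (fun i ↦ (hx i).le) fun i ↦ (hx i).le
  rcases hxx.eq_or_lt with h0 | h0
  · rw [← h0, mul_zero]
    positivity
  have hdot : ∀ w, (fun i ↦ ∑ j, H i j * x j) ⬝ᵥ w = bilin H w x := by
    intro w
    rw [dotProduct_comm]; rfl
  refine bilin_mul_bilin_le_sq hH hxx (fun i ↦ ∑ j, H i j * x j) ?_ (fun w hw ↦ ?_) v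
  · rw [hdot]; exact h0.ne'
  · rw [hdot] at hw
    exact bilin_self_nonpos_of_le hH hpos hx o ho hle hw

end Hyperbolic

/-- The coordinate operators on functions of finite sets: `none` acts as the identity, `some i`
adds `i` and kills the sets which already contain `i`. -/
def step {n : ℕ} : Option (Fin n) → (Finset (Fin n) → ℝ) → Finset (Fin n) → ℝ
  | none, g, S => g S
  | some i, g, S => if i ∈ S then 0 else g (insert i S)

/-- The evaluation point with `t` at the homogenizing coordinate and `1` elsewhere. -/
def evalPoint {n : ℕ} (t : ℝ) : Option (Fin n) → ℝ
  | none => t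
  | some _ => 1

open Classical in
/-- The value at `evalPoint t` of the degree `d` truncation of the homogenized independence
polynomial of the contraction of `M` by `S`, and `0` when `S` is dependent. -/
noncomputable def indepValue {n : ℕ} (M : PaperMatroid n) (t : ℝ) : ℕ → Finset (Fin n) → ℝ
  | 0, S => if M.Indep S then 1 else 0
  | d + 1, S => (∑ a, evalPoint t a * step a (indepValue M t d) S) / (d + 1)

section Step

variable {n : ℕ}

theorem step_comm (a b : Option (Fin n)) (g : Finset (Fin n) → ℝ) (S : Finset (Fin n)) :
    step a (step b g) S = step b (step a g) S := by
  rcases a with _ | i <;> rcases b with _ | j <;> simp only [step]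
  by_cases hij : i = j
  · subst hij; simp
  · have hji : j ≠ i := Ne.symm hij
    by_cases hi : i ∈ S <;> by_cases hj : j ∈ S <;>
      simp [hi, hj, hij, hji, Finset.insert_comm i j]

theorem step_sum {α : Type*} (s : Finset α) (c : α → ℝ) (g : α → Finset (Fin n) → ℝ)
    (a : Option (Fin n)) (S : Finset (Fin n)) :
    step a (fun U ↦ ∑ k ∈ s, c k * g k U) S = ∑ k ∈ s, c k * step a (g k) S := by
  rcases a with _ | i
  · rfl
  · by_cases hi : i ∈ S <;> simp [step, hi]

theorem step_const_mul (c : ℝ) (g : Finset (Fin n) → ℝ) (a : Option (Fin n))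
    (S : Finset (Fin n)) : step a (fun U ↦ c * g U) S = c * step a g S := by
  rcases a with _ | i
  · rfl
  · by_cases hi : i ∈ S <;> simp [step, hi]

theorem step_nonneg {g : Finset (Fin n) → ℝ} (hg : ∀ S, 0 ≤ g S) (a : Option (Fin n))
    (S : Finset (Fin n)) : 0 ≤ step a g S := by
  rcases a with _ | i
  · exact hg S
  · by_cases hi : i ∈ S <;> simp [step, hi, hg]

theorem evalPoint_pos {t : ℝ} (ht : 0 < t) (a : Option (Fin n)) : 0 < evalPoint t a := by
  rcases a with _ | i
  · exact ht
  · exact one_pos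

end Step

section IndepValue

variable {n : ℕ} (M : PaperMatroid n) {t : ℝ}

theorem sum_evalPoint_mul_step (d : ℕ) (S : Finset (Fin n)) :
    ∑ a, evalPoint t a * step a (indepValue M t d) S = (d + 1) * indepValue M t (d + 1) S := by
  rw [indepValue]
  have : (d + 1 : ℝ) ≠ 0 := by positivity
  field_simp

theorem indepValue_nonneg (ht : 0 ≤ t) (d : ℕ) (S : Finset (Fin n)) :
    0 ≤ indepValue M t d S := by
  induction d generalizing S with
  | zero => rw [indepValue]; split_ifs <;> norm_num
  | succ d ih =>
    rw [indepValue]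
    refine div_nonneg (Finset.sum_nonneg fun a _ ↦ mul_nonneg ?_ (step_nonneg ih a S))
      (by positivity)
    rcases a with _ | i
    · exact ht
    · exact zero_le_one

theorem indepValue_of_not_indep (d : ℕ) {S : Finset (Fin n)} (hS : ¬ M.Indep S) :
    indepValue M t d S = 0 := by
  induction d generalizing S with
  | zero => simp [indepValue, hS]
  | succ d ih =>
    rw [indepValue, Finset.sum_eq_zero, zero_div]
    rintro (_ | i) -
    · simp [step, ih hS]
    · simp [step, ih fun h ↦ hS (M.indep_subset (Finset.subset_insert i S) h)]

theorem indepValue_pos (ht : 0 < t) (d : ℕ) {S : Finset (Fin n)} (hS : M.Indep S) :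
    0 < indepValue M t d S := by
  induction d with
  | zero => simp [indepValue, hS]
  | succ d ih =>
    rw [indepValue]
    refine div_pos (Finset.sum_pos' (fun a _ ↦ mul_nonneg (evalPoint_pos ht a).le
      (step_nonneg (indepValue_nonneg M ht.le d) a S)) ⟨none, Finset.mem_univ _, ?_⟩)
      (by positivity)
    exact mul_pos ht ih

theorem continuous_indepValue (d : ℕ) (S : Finset (Fin n)) :
    Continuous fun t ↦ indepValue M t d S := by
  induction d generalizing S with
  | zero => simp only [indepValue]; exact continuous_const
  | succ d ih =>
    simp only [indepValue]
    refine Continuous.div_const (continuous_finsetSum _ fun a _ ↦ ?_) _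
    rcases a with _ | i
    · exact continuous_id.mul (ih S)
    · by_cases hi : i ∈ S
      · simp [step, hi, continuous_const]
      · simpa [step, hi, evalPoint] using ih (insert i S)

theorem bilin_step_right (d : ℕ) (S : Finset (Fin n)) (v : Option (Fin n) → ℝ) :
    bilin (fun a b ↦ step a (step b (indepValue M t d)) S) v (evalPoint t)
      = (d + 1) * ∑ a, v a * step a (indepValue M t (d + 1)) S := by
  rw [bilin, Finset.mul_sum]
  refine Finset.sum_congr rfl fun a _ ↦ ?_
  have h := step_sum Finset.univ (evalPoint t) (fun b ↦ step b (indepValue M t d)) a S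
  simp only [sum_evalPoint_mul_step, step_const_mul] at h
  have : ∑ b, step a (step b (indepValue M t d)) S * evalPoint t b
      = ∑ b, evalPoint t b * step a (step b (indepValue M t d)) S :=
    Finset.sum_congr rfl fun b _ ↦ mul_comm _ _
  rw [this, ← h]
  ring

/-- In the contraction by an independent set, parallelism of nonloops is transitive. -/
theorem PaperMatroid.parallel_trans {S : Finset (Fin n)} {i j l : Fin n}
    (hi : i ∉ S) (hl : l ∉ S) (hj : j ∉ S) (hSj : M.Indep (insert j S))
    (hij : i = j ∨ ¬ M.Indep (insert i (insert j S)))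
    (hlj : l = j ∨ ¬ M.Indep (insert l (insert j S))) :
    i = l ∨ ¬ M.Indep (insert i (insert l S)) := by
  by_contra! h
  obtain ⟨hil, hind⟩ := h
  obtain ⟨e, he, hin⟩ := M.indep_exchange hSj hind (by
    rw [Finset.card_insert_of_notMem hj, Finset.card_insert_of_notMem (by simp [hil, hi]),
      Finset.card_insert_of_notMem hl]
    omega)
  simp only [Finset.mem_sdiff, Finset.mem_insert, not_or] at he
  obtain ⟨rfl | rfl | he, hne, heS⟩ := he
  · exact hij.elim hne (fun h ↦ h hin)
  · exact hlj.elim hne (fun h ↦ h hin)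
  · exact heS he

/-- The quadratic form of a partition of `N` by the fibres of `c` is a sum of squares. -/
theorem sum_sum_fibre_nonneg {α β : Type*} [Fintype β] [DecidableEq β] (N : Finset α) (c : α → β)
    (w : α → ℝ) : 0 ≤ ∑ i ∈ N, ∑ j ∈ N, if c i = c j then w i * w j else 0 := by
  have h : ∑ i ∈ N, ∑ j ∈ N, (if c i = c j then w i * w j else 0)
      = ∑ C, (∑ i ∈ N, if c i = C then w i else 0) ^ 2 := by
    simp only [sq, Finset.sum_mul_sum]
    rw [Finset.sum_comm]
    rw [Finset.sum_comm (s := (Finset.univ : Finset β))]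
    rw [Finset.sum_comm]
    refine Finset.sum_congr rfl fun i _ ↦ ?_
    rw [Finset.sum_comm]
    refine Finset.sum_congr rfl fun j _ ↦ ?_
    simp [eq_comm]
  rw [h]
  exact Finset.sum_nonneg fun _ _ ↦ sq_nonneg _

theorem bilin_indepValue_zero_le (ht : 0 < t) (S : Finset (Fin n)) (v : Option (Fin n) → ℝ) :
    bilin (fun a b ↦ step a (step b (indepValue M t 0)) S) v v
      * bilin (fun a b ↦ step a (step b (indepValue M t 0)) S) (evalPoint t) (evalPoint t)
      ≤ bilin (fun a b ↦ step a (step b (indepValue M t 0)) S) v (evalPoint t) ^ 2 := by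
  classical
  set H : Option (Fin n) → Option (Fin n) → ℝ :=
    fun a b ↦ step a (step b (indepValue M t 0)) S with hH
  have hpos : ∀ a b, 0 ≤ H a b := fun a b ↦
    step_nonneg (step_nonneg (indepValue_nonneg M ht.le 0) b) a S
  by_cases hS : M.Indep S
  swap
  · have h0 : ∀ a b, H a b = 0 := by
      have hi : ∀ i, ¬ M.Indep (insert i S) := fun i h ↦
        hS (M.indep_subset (Finset.subset_insert i S) h)
      have hij : ∀ i j, ¬ M.Indep (insert i (insert j S)) := fun i j h ↦
        hi j (M.indep_subset (Finset.subset_insert i _) h)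
      rintro (_ | i) (_ | j) <;> simp [hH, step, indepValue, hS, hi, hij]
    simp [bilin, h0]
  set N : Finset (Fin n) := {i | i ∉ S ∧ M.Indep (insert i S)} with hN
  let par : Fin n → Fin n → Prop := fun i j ↦ i = j ∨ ¬ M.Indep (insert i (insert j S))
  have par_comm : ∀ i j, par i j → par j i := by
    intro i j h
    simpa only [par, Finset.insert_comm j i, eq_comm (a := j)] using h
  let c : Fin n → Finset (Fin n) := fun i ↦ N.filter (par i)
  have hc : ∀ i ∈ N, ∀ j ∈ N, (c i = c j ↔ par i j) := by
    intro i hi j hj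
    have hi' := hi
    have hj' := hj
    simp only [hN, Finset.mem_filter, Finset.mem_univ, true_and] at hi' hj'
    constructor
    · intro h
      have : j ∈ c i := by rw [h]; simp [c, hj, par]
      exact (Finset.mem_filter.1 this).2
    · intro h
      refine Finset.filter_congr fun l hl ↦ ?_
      simp only [hN, Finset.mem_filter, Finset.mem_univ, true_and] at hl
      constructor
      · intro h'
        exact M.parallel_trans hj'.1 hl.1 hi'.1 hi'.2 (par_comm _ _ h) (par_comm _ _ h')
      · intro h'
        exact M.parallel_trans hi'.1 hl.1 hj'.1 hj'.2 h (par_comm _ _ h')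
  have hnn : H none none = 1 := by simp [hH, step, indepValue, hS]
  have hni : ∀ i, H none (some i) = if i ∈ N then 1 else 0 := by
    intro i
    by_cases hi : i ∈ S <;> simp [hH, step, indepValue, hN, hi]
  have hin : ∀ i, H (some i) none = if i ∈ N then 1 else 0 := by
    intro i
    by_cases hi : i ∈ S <;> simp [hH, step, indepValue, hN, hi]
  have hij : ∀ i j, H (some i) (some j)
      = if i ∈ N then if j ∈ N then 1 - (if c i = c j then 1 else 0) else 0 else 0 := by
    intro i j
    have hsub : M.Indep (insert i (insert j S)) → M.Indep (insert i S) ∧ M.Indep (insert j S) :=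
      fun h ↦ ⟨M.indep_subset (Finset.insert_subset_insert i (Finset.subset_insert j S)) h,
        M.indep_subset (Finset.subset_insert i _) h⟩
    by_cases hi : i ∈ N
    · by_cases hj : j ∈ N
      · simp only [hc i hi j hj, if_pos hi, if_pos hj]
        simp only [hN, Finset.mem_filter, Finset.mem_univ, true_and] at hi hj
        by_cases h : i = j
        · simp [hH, step, par, h]
        · have h' : ¬ j = i := fun h' ↦ h h'.symm
          by_cases h'' : M.Indep (insert i (insert j S)) <;>
            simp [hH, step, par, h, h', hi.1, hj.1, indepValue, h'', Finset.insert_comm j i]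
      · simp only [if_pos hi, if_neg hj]
        simp only [hN, Finset.mem_filter, Finset.mem_univ, true_and] at hi hj
        simp only [hH, step, indepValue]
        grind
    · simp only [if_neg hi]
      simp only [hN, Finset.mem_filter, Finset.mem_univ, true_and] at hi
      simp only [hH, step, indepValue]
      grind
  have hxx : 0 ≤ bilin H (evalPoint t) (evalPoint t) :=
    bilin_nonneg hpos (fun a ↦ (evalPoint_pos ht a).le) fun a ↦ (evalPoint_pos ht a).le
  have hdot : ∀ w : Option (Fin n) → ℝ,
      (fun a ↦ H none a) ⬝ᵥ w = w none + ∑ i ∈ N, w (some i) := by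
    intro w
    simp [dotProduct, Fintype.sum_option, hnn, hni, Finset.sum_ite_mem]
  refine bilin_mul_bilin_le_sq (fun a b ↦ step_comm a b _ S) hxx (fun a ↦ H none a) ?_ ?_ v
  · rw [hdot]
    refine (add_pos_of_pos_of_nonneg ht ?_).ne'
    exact Finset.sum_nonneg fun i _ ↦ (evalPoint_pos ht _).le
  · intro w hw
    rw [hdot] at hw
    have hform : bilin H w w = (w none + ∑ i ∈ N, w (some i)) ^ 2
        - ∑ i ∈ N, ∑ j ∈ N, if c i = c j then w (some i) * w (some j) else 0 := by
      have hinner : ∀ i ∈ N, ∑ j ∈ N, (1 - if c i = c j then 1 else 0) * w (some j)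
          = (∑ j ∈ N, w (some j)) - ∑ j ∈ N, if c i = c j then w (some j) else 0 := by
        intro i _
        rw [← Finset.sum_sub_distrib]
        refine Finset.sum_congr rfl fun j _ ↦ ?_
        split_ifs <;> ring
      have hsum : bilin H w w = w none * (w none + ∑ i ∈ N, w (some i))
          + ∑ i ∈ N, w (some i) * (w none
            + ∑ j ∈ N, (1 - if c i = c j then 1 else 0) * w (some j)) := by
        simp only [bilin, Fintype.sum_option, hnn, hni, hin, hij]
        congr 1
        · simp [Finset.sum_ite_mem]
        · rw [← Finset.sum_filter_add_sum_filter_not Finset.univ (· ∈ N),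
            Finset.filter_univ_mem]
          rw [Finset.sum_eq_zero (s := Finset.univ.filter (· ∉ N)), add_zero]
          · refine Finset.sum_congr rfl fun i hi ↦ ?_
            simp only [if_pos hi, one_mul, ite_mul, zero_mul, Finset.sum_ite_mem,
              Finset.univ_inter]
          · intro i hi
            simp [(Finset.mem_filter.1 hi).2]
      have hterm : ∀ i ∈ N, w (some i) * (w none
            + ∑ j ∈ N, (1 - if c i = c j then 1 else 0) * w (some j))
          = w (some i) * (w none + ∑ j ∈ N, w (some j))
            - ∑ j ∈ N, if c i = c j then w (some i) * w (some j) else 0 := by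
        intro i hi
        have h : ∑ j ∈ N, (if c i = c j then w (some i) * w (some j) else 0)
            = w (some i) * ∑ j ∈ N, if c i = c j then w (some j) else 0 := by
          rw [Finset.mul_sum]
          exact Finset.sum_congr rfl fun j _ ↦ by rw [mul_ite, mul_zero]
        rw [h, hinner i hi]; ring
      rw [hsum, Finset.sum_congr rfl hterm, Finset.sum_sub_distrib, ← Finset.sum_mul]
      ring
    rw [hform, hw]
    have := sum_sum_fibre_nonneg N c fun i ↦ w (some i)
    linarith

theorem bilin_indepValue_le (ht : 0 < t) (d : ℕ) (S : Finset (Fin n))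
    (v : Option (Fin n) → ℝ) :
    bilin (fun a b ↦ step a (step b (indepValue M t d)) S) v v
      * bilin (fun a b ↦ step a (step b (indepValue M t d)) S) (evalPoint t) (evalPoint t)
      ≤ bilin (fun a b ↦ step a (step b (indepValue M t d)) S) v (evalPoint t) ^ 2 := by
  induction d generalizing S v with
  | zero => exact bilin_indepValue_zero_le M ht S v
  | succ d ih =>
    have hnn := indepValue_nonneg M ht.le
    refine bilin_mul_bilin_le_sq_of_slices (m := d + 1)
      (T := fun l a b ↦ step l (step a (step b (indepValue M t d))) S)
      (fun a b ↦ step_nonneg (step_nonneg (hnn _) b) a S)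
      (fun a b e ↦ step_comm a b _ S) (fun a b e ↦ ?_)
      (fun a b e ↦ step_nonneg (step_nonneg (step_nonneg (hnn _) e) b) a S)
      (evalPoint_pos ht) (by positivity) (fun a b ↦ ?_) none ?_ (fun l w ↦ ?_) v
    · exact congrArg (fun g ↦ step a g S) (funext fun U ↦ step_comm b e _ U)
    · have h := step_sum Finset.univ (evalPoint t)
        (fun e ↦ step b (step e (indepValue M t d))) a S
      have h' : (fun U ↦ ∑ e, evalPoint t e * step b (step e (indepValue M t d)) U)
          = fun U ↦ (d + 1 : ℝ) * step b (indepValue M t (d + 1)) U := by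
        funext U
        rw [← step_sum, ← step_const_mul]
        simp only [sum_evalPoint_mul_step]
      rw [h', step_const_mul] at h
      rw [h]
      exact Finset.sum_congr rfl fun e _ ↦ mul_comm _ _
    · have hdep : ∀ U, indepValue M t (d + 1) U = 0 → ∀ W, U ⊆ W →
          indepValue M t (d + 1) W = 0 := by
        intro U hU W hUW
        refine indepValue_of_not_indep M _ fun hW ↦ ?_
        exact (indepValue_pos M ht _ (M.indep_subset hUW hW)).ne' hU
      rintro (_ | i) h (_ | j)
      · exact h
      · simp only [step] at h ⊢
        split_ifs
        · rfl
        · exact hdep S h _ (Finset.subset_insert _ _)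
      · exact h
      · simp only [step] at h ⊢
        split_ifs at h ⊢
        · rfl
        · rfl
        · exact hdep _ h _ (Finset.subset_insert _ _)
    · rcases l with _ | i
      · exact ih S w
      · by_cases hi : i ∈ S
        · simp [step, hi, bilin]
        · simpa only [step, hi, if_false] using ih (insert i S) w

theorem indepValue_log_concave (ht : 0 < t) (d : ℕ) (S : Finset (Fin n)) :
    (d + 2) * (indepValue M t d S * indepValue M t (d + 2) S)
      ≤ (d + 1) * indepValue M t (d + 1) S ^ 2 := by
  have h := bilin_indepValue_le M ht d S fun a ↦ if a = none then 1 else 0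
  rw [bilin_step_right, bilin_step_right, sum_evalPoint_mul_step] at h
  simp only [bilin, ite_mul, mul_ite, one_mul, zero_mul, mul_one, mul_zero, Finset.sum_ite_eq',
    Finset.mem_univ, if_true, step] at h
  have hd : (0 : ℝ) < d + 1 := by positivity
  refine le_of_mul_le_mul_left ?_ hd
  push_cast at h
  linarith

open Classical in
theorem indepValue_zero_eq_card (d : ℕ) (S : Finset (Fin n)) :
    indepValue M 0 d S
      = (Finset.univ.filter fun T ↦ M.Indep T ∧ S ⊆ T ∧ T.card = S.card + d).card := by
  induction d generalizing S with
  | zero =>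
    have h : (Finset.univ.filter fun T ↦ M.Indep T ∧ S ⊆ T ∧ T.card = S.card + 0)
        = if M.Indep S then {S} else ∅ := by
      ext T
      have : S ⊆ T ∧ T.card = S.card + 0 ↔ T = S :=
        ⟨fun h ↦ (Finset.eq_of_subset_of_card_le h.1 h.2.le).symm, fun h ↦ by simp [h]⟩
      rw [Finset.mem_filter, this]
      split_ifs with hS
      · simp only [Finset.mem_univ, true_and, Finset.mem_singleton]
        exact ⟨fun h ↦ h.2, fun h ↦ ⟨h ▸ hS, h⟩⟩
      · simp only [Finset.mem_univ, true_and, Finset.notMem_empty, iff_false]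
        rintro ⟨h, rfl⟩
        exact hS h
    rw [h, indepValue]
    split_ifs <;> simp
  | succ d ih =>
    rw [indepValue, Fintype.sum_option]
    have hd : (d + 1 : ℝ) ≠ 0 := by positivity
    rw [div_eq_iff hd]
    simp only [evalPoint, zero_mul, zero_add, one_mul, step, ih]
    set P := Finset.univ.filter fun T ↦ M.Indep T ∧ S ⊆ T ∧ T.card = S.card + (d + 1) with hP
    have h₁ : ∀ i, (if i ∈ S then (0 : ℝ) else ((Finset.univ.filter fun T ↦ M.Indep T ∧
        insert i S ⊆ T ∧ T.card = (insert i S).card + d).card : ℝ))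
        = ∑ T ∈ P, if i ∈ T \ S then 1 else 0 := by
      intro i
      split_ifs with hi
      · simp [hi]
      · rw [← Finset.sum_filter, Finset.sum_const, nsmul_one, hP, Finset.filter_filter]
        congr 2
        refine Finset.filter_congr fun T _ ↦ ?_
        rw [Finset.card_insert_of_notMem hi, Finset.insert_subset_iff, Finset.mem_sdiff]
        have : S.card + 1 + d = S.card + (d + 1) := by ring
        rw [this]
        tauto
    rw [Finset.sum_congr rfl fun i _ ↦ h₁ i, Finset.sum_comm]
    have h₂ : ∀ T ∈ P, (∑ i, if i ∈ T \ S then (1 : ℝ) else 0) = d + 1 := by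
      intro T hT
      obtain ⟨-, -, hST, hcard⟩ := Finset.mem_filter.1 hT
      rw [Finset.sum_ite_mem, Finset.univ_inter, Finset.sum_const, nsmul_one,
        Finset.card_sdiff_of_subset hST, hcard]
      simp
    rw [Finset.sum_congr rfl h₂, Finset.sum_const, nsmul_eq_mul]

theorem indepValue_zero_empty (d : ℕ) : indepValue M 0 d ∅ = numIndep M d := by
  classical
  rw [indepValue_zero_eq_card, numIndep, Nat.card_eq_fintype_card, Fintype.card_subtype]
  simp

end IndepValue

/-- **Mason's conjecture, second form.** For a matroid on `n` elements with `I_k`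
independent sets of size `k`, for `0 < k < n`:
`I_k² ≥ (1 + 1/k) · I_{k-1} · I_{k+1}`, i.e. `k · I_k² ≥ (k+1) · I_{k-1} · I_{k+1}`. -/
theorem mason_strengthened_log_concave {n : ℕ} (M : PaperMatroid n) (k : ℕ)
    (hk0 : 0 < k) (hkn : k < n) :
    (k + 1) * (numIndep M (k-1) * numIndep M (k+1)) ≤ k * (numIndep M k) ^ 2 := by
  obtain ⟨d, rfl⟩ := Nat.exists_eq_succ_of_ne_zero hk0.ne'
  have hc := fun e ↦ (continuous_indepValue M e ∅).continuousWithinAt (s := Set.Ioi 0) (x := 0)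
  have h : ((d + 2 : ℕ) : ℝ) * (indepValue M 0 d ∅ * indepValue M 0 (d + 2) ∅)
      ≤ ((d + 1 : ℕ) : ℝ) * indepValue M 0 (d + 1) ∅ ^ 2 :=
    ContinuousWithinAt.closure_le (s := Set.Ioi 0) (by simp)
      (continuousWithinAt_const.mul ((hc d).mul (hc (d + 2))))
      (continuousWithinAt_const.mul ((hc (d + 1)).pow 2))
      (fun t ht ↦ by simpa using indepValue_log_concave M ht d ∅)
  simp only [indepValue_zero_empty] at h
  exact_mod_cast h
end

section
/- Let M be a matroid on a ground set of n elements, and for each k let I_k denote the number of independent sets of M of cardinality k. Then the sequence I_0, I_1, …, I_n is log-concave: for every k with 0 < k < n, one has I_k^2 ≥ I_{k-1} · I_{k+1}. -/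
open Matrix MvPolynomial

open Finset

/-- A symmetric operator with top eigenvector `a` of simple eigenvalue `1` and with no eigenvalue
in `(0, 1)` satisfies the reverse Cauchy-Schwarz inequality at `a`. -/
theorem LinearMap.IsSymmetric.inner_apply_mul_le_sq {E : Type*} [NormedAddCommGroup E]
    [InnerProductSpace ℝ E] [FiniteDimensional ℝ E] {T : E →ₗ[ℝ] E} (hT : T.IsSymmetric) {a : E}
    (h_gap : ∀ v, inner ℝ v (T v) ≤ inner ℝ (T v) (T v))
    (h_top : ∀ v, inner ℝ v (T v) ≤ inner ℝ v v)
    (ha : T a = a) (h_simple : ∀ v, T v = v → ∃ s : ℝ, v = s • a) (v : E) :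
    inner ℝ v (T v) * inner ℝ a a ≤ inner ℝ v a ^ 2 := by
  have neg_of_orth : ∀ u : E, inner ℝ u a = 0 → inner ℝ u (T u) ≤ 0 := by
    intro u hu
    set b := hT.eigenvectorBasis rfl
    set ev := hT.eigenvalues rfl
    have hb : ∀ i, T (b i) = ev i • b i := fun i =>
      hT.apply_eigenvectorBasis rfl i
    rw [← b.sum_inner_mul_inner u (T u)]
    refine sum_nonpos fun i _ => ?_
    have hbb : inner ℝ (b i) (b i) = (1 : ℝ) := by simp
    have h1 := h_gap (b i)
    have h2 := h_top (b i)
    rw [← hT (b i) u, hb i]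
    rw [hb i] at h1 h2
    simp only [real_inner_smul_left, real_inner_smul_right, hbb] at h1 h2 ⊢
    rw [real_inner_comm u (b i)]
    by_cases h : ev i = 1
    · obtain ⟨s, hs⟩ := h_simple (b i) (by rw [hb i, h, one_smul])
      simp [hs, real_inner_smul_right, hu]
    · have h3 : ev i < 1 := lt_of_le_of_ne (by linarith) h
      have h4 : ev i ≤ 0 := by nlinarith
      nlinarith [mul_self_nonneg (inner ℝ u (b i) : ℝ)]
  by_cases h0 : inner ℝ a a = (0 : ℝ)
  · rw [h0, mul_zero]; positivity
  have hpos : 0 < (inner ℝ a a : ℝ) := lt_of_le_of_ne real_inner_self_nonneg (Ne.symm h0)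
  set s : ℝ := inner ℝ v a / inner ℝ a a
  have hs : s * inner ℝ a a = inner ℝ v a := by simp only [s]; field_simp
  have hTa : inner ℝ a (T v) = (inner ℝ v a : ℝ) := by
    rw [← hT a v, ha, real_inner_comm]
  have hu := neg_of_orth (v - s • a) (by
    rw [inner_sub_left, real_inner_smul_left, hs, sub_self])
  rw [map_sub, map_smul, ha] at hu
  simp only [inner_sub_left, inner_sub_right, real_inner_smul_left, real_inner_smul_right,
    hTa] at hu
  nlinarith

/-- The analogue for the form of `T` bordered by a vector `q` and a corner `c`. -/
theorem LinearMap.IsSymmetric.bordered_form_mul_le_sq {E : Type*} [NormedAddCommGroup E]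
    [InnerProductSpace ℝ E] [FiniteDimensional ℝ E] {T : E →ₗ[ℝ] E} (hT : T.IsSymmetric)
    {a q : E} {c : ℝ}
    (h_gap : ∀ (y : ℝ) (v : E), c * y ^ 2 + 2 * y * inner ℝ q v + inner ℝ v (T v) ≤
      inner ℝ (y • q + T v) (y • q + T v))
    (h_top : ∀ v, inner ℝ v (T v) ≤ inner ℝ v v)
    (ha : T a = a) (h_simple : ∀ v, T v = v → ∃ s : ℝ, v = s • a) (y : ℝ) (v : E) :
    (c * y ^ 2 + 2 * y * inner ℝ q v + inner ℝ v (T v)) * inner ℝ a a ≤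
      (y * inner ℝ q a + inner ℝ v a) ^ 2 := by
  obtain ⟨u, hu⟩ : ∃ u, T u = q := by
    rw [← LinearMap.mem_range, ← (LinearMap.range T).orthogonal_orthogonal,
      Submodule.mem_orthogonal]
    intro z hz
    have hTz : T z = 0 := by
      refine ext_inner_right ℝ fun x => ?_
      rw [hT z x, inner_zero_left, real_inner_comm]
      exact (Submodule.mem_orthogonal _ _).1 hz _ (LinearMap.mem_range_self T x)
    by_contra hne
    rw [real_inner_comm] at hne
    have h := h_gap 1 (((inner ℝ q q - c + 1) / (2 * inner ℝ q z) : ℝ) • z)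
    rw [map_smul, hTz, smul_zero, inner_zero_right, add_zero, one_smul, add_zero,
      real_inner_smul_right] at h
    have : 2 * 1 * ((inner ℝ q q - c + 1) / (2 * inner ℝ q z) * inner ℝ q z) =
      (inner ℝ q q - c + 1 : ℝ) := by field_simp
    linarith
  have hsymm : ∀ x z, inner ℝ x (T z) = (inner ℝ (T x) z : ℝ) := fun x z => (hT x z).symm
  have hc : c - inner ℝ q u ≤ 0 := by
    have h := h_gap 1 (-u)
    rw [map_neg, hu, one_smul, add_neg_cancel, inner_zero_left, inner_neg_neg, inner_neg_right,
      real_inner_comm q u] at h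
    linarith
  have hw := hT.inner_apply_mul_le_sq (a := a) (fun v => by simpa using h_gap 0 v) h_top ha
    h_simple (v + y • u)
  have e1 : inner ℝ (v + y • u) (T (v + y • u)) =
      (inner ℝ v (T v) + 2 * y * inner ℝ q v + y ^ 2 * inner ℝ q u : ℝ) := by
    rw [map_add, map_smul, hu]
    simp only [inner_add_left, inner_add_right, real_inner_smul_left, real_inner_smul_right]
    rw [hsymm u v, hu, real_inner_comm q v, real_inner_comm q u]
    ring
  have e2 : inner ℝ (v + y • u) a = (y * inner ℝ q a + inner ℝ v a : ℝ) := by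
    rw [inner_add_left, real_inner_smul_left, ← hu, hT u a, ha]
    ring
  rw [e1, e2] at hw
  have := mul_nonneg (mul_nonneg (sq_nonneg y) (neg_nonneg.2 hc))
    (real_inner_self_nonneg (F := E) (x := a))
  nlinarith

/-- The analogue for a nonnegative symmetric matrix `B` bordered by a row `q` and a corner `c`. -/
theorem bordered_matrix_form_mul_le_sq {ι : Type*} [Fintype ι] [DecidableEq ι] {B : ι → ι → ℝ}
    {q w : ι → ℝ} {c : ℝ} (hB : ∀ i j, B i j = B j i) (hB0 : ∀ i j, 0 ≤ B i j)
    (hw : ∀ i, ∑ j, B i j = w i) (hq : ∀ i, w i = 0 → q i = 0)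
    (h_gap : ∀ (y : ℝ) (v : ι → ℝ),
      c * y ^ 2 + 2 * y * ∑ i, q i * v i + ∑ i, ∑ j, B i j * (v i * v j) ≤
        ∑ i, (y * q i + ∑ j, B i j * v j) ^ 2 / w i)
    (h_conn : ∀ v : ι → ℝ, (∀ i j, B i j ≠ 0 → v i = v j) →
      ∀ i j, w i ≠ 0 → w j ≠ 0 → v i = v j)
    (y : ℝ) (v : ι → ℝ) :
    (c * y ^ 2 + 2 * y * ∑ i, q i * v i + ∑ i, ∑ j, B i j * (v i * v j)) * ∑ i, w i ≤
      (y * ∑ i, q i + ∑ i, w i * v i) ^ 2 := by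
  have hw0 : ∀ i, 0 ≤ w i := fun i => hw i ▸ sum_nonneg fun j _ => hB0 i j
  obtain ⟨s, hs⟩ : ∃ s : ι → ℝ, ∀ i, s i * s i = w i :=
    ⟨fun i => √(w i), fun i => Real.mul_self_sqrt (hw0 i)⟩
  have hs0 : ∀ i, s i = 0 → w i = 0 := fun i h => by rw [← hs, h, zero_mul]
  have hBw : ∀ i j, s i = 0 → B i j = 0 := fun i j h =>
    (sum_eq_zero_iff_of_nonneg fun j _ => hB0 i j).1 ((hw i).trans (hs0 i h)) j (mem_univ j)
  let T : EuclideanSpace ℝ ι →ₗ[ℝ] EuclideanSpace ℝ ι :=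
    Matrix.toEuclideanLin (Matrix.of fun i j => B i j / (s i * s j))
  have hTapp : ∀ x i, T x i = (∑ j, B i j * (x j / s j)) / s i := fun x i => by
    simp only [T, Matrix.toLpLin_apply, Matrix.mulVec, dotProduct, Matrix.of_apply, sum_div]
    refine sum_congr rfl fun j _ => ?_
    rw [div_mul_eq_mul_div, mul_div_assoc', div_div, mul_comm (s i)]
  have inner_eq : ∀ x z : EuclideanSpace ℝ ι, inner ℝ x z = ∑ i, x i * z i := fun x z => by
    simp [PiLp.inner_apply, mul_comm]
  have hTinner : ∀ x z : EuclideanSpace ℝ ι,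
      inner ℝ x (T z) = ∑ i, ∑ j, B i j * (x i / s i * (z j / s j)) := fun x z => by
    rw [inner_eq]
    refine sum_congr rfl fun i _ => ?_
    rw [hTapp, sum_div, mul_sum]
    exact sum_congr rfl fun j _ => by ring
  have hT : T.IsSymmetric := fun x z => by
    rw [real_inner_comm, hTinner, hTinner, sum_comm]
    exact sum_congr rfl fun i _ => sum_congr rfl fun j _ => by rw [hB]; ring
  let q' : EuclideanSpace ℝ ι := WithLp.toLp 2 fun i => q i / s i
  let a : EuclideanSpace ℝ ι := WithLp.toLp 2 s
  have hwx : ∀ (x : EuclideanSpace ℝ ι) i, w i * (x i / s i) ^ 2 ≤ x i * x i := fun x i => by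
    by_cases h : s i = 0
    · rw [hs0 i h, zero_mul]; exact mul_self_nonneg _
    · rw [← hs]; apply le_of_eq; field_simp
  have dirichlet : ∀ u : ι → ℝ, ∑ i, ∑ j, B i j * (u i - u j) ^ 2 =
      2 * (∑ i, w i * u i ^ 2 - ∑ i, ∑ j, B i j * (u i * u j)) := fun u => by
    have e : ∑ i, w i * u i ^ 2 = ∑ i, ∑ j, B i j * u i ^ 2 :=
      sum_congr rfl fun i _ => by rw [← hw, sum_mul]
    have e' : ∑ i, w i * u i ^ 2 = ∑ i, ∑ j, B i j * u j ^ 2 := by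
      rw [e, sum_comm]
      exact sum_congr rfl fun i _ => sum_congr rfl fun j _ => by rw [hB]
    rw [mul_sub, two_mul]
    nth_rw 1 [e]
    rw [e', mul_sum, ← sum_add_distrib, ← sum_sub_distrib]
    refine sum_congr rfl fun i _ => ?_
    rw [mul_sum, ← sum_add_distrib, ← sum_sub_distrib]
    exact sum_congr rfl fun j _ => by ring
  have dirichlet_nonneg : ∀ (u : ι → ℝ) i j, 0 ≤ B i j * (u i - u j) ^ 2 := fun u i j =>
    mul_nonneg (hB0 i j) (sq_nonneg _)
  have h_top : ∀ x : EuclideanSpace ℝ ι, inner ℝ x (T x) ≤ inner ℝ x x := fun x => by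
    rw [hTinner, inner_eq]
    have h1 := dirichlet fun i => x i / s i
    have h2 := sum_nonneg fun i (_ : i ∈ univ) =>
      sum_nonneg fun j (_ : j ∈ univ) => dirichlet_nonneg (fun i => x i / s i) i j
    have h3 := sum_le_sum fun i (_ : i ∈ univ) => hwx x i
    linarith
  have h_simple : ∀ x, T x = x → ∃ t : ℝ, x = t • a := fun x hx => by
    have h1 := dirichlet fun i => x i / s i
    have h3 := sum_le_sum fun i (_ : i ∈ univ) => hwx x i
    rw [← hTinner, hx, inner_eq] at h1
    have h4 : ∑ i, ∑ j, B i j * (x i / s i - x j / s j) ^ 2 = 0 :=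
      le_antisymm (by linarith) (sum_nonneg fun i _ => sum_nonneg fun j _ =>
        dirichlet_nonneg (fun i => x i / s i) i j)
    have h5 := h_conn (fun i => x i / s i) fun i j hij => by
      have h := (sum_eq_zero_iff_of_nonneg fun i _ => sum_nonneg fun j _ =>
        dirichlet_nonneg (fun i => x i / s i) i j).1 h4 i (mem_univ i)
      have h := (sum_eq_zero_iff_of_nonneg fun j _ =>
        dirichlet_nonneg (fun i => x i / s i) i j).1 h j (mem_univ j)
      exact sub_eq_zero.1 (pow_eq_zero_iff two_ne_zero |>.1 ((mul_eq_zero.1 h).resolve_left hij))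
    have h6 : ∀ i, s i = 0 → x i = 0 := fun i hi => by rw [← hx, hTapp, hi, div_zero]
    by_cases hex : ∃ i, s i ≠ 0
    · obtain ⟨i, hi⟩ := hex
      refine ⟨x i / s i, PiLp.ext fun j => ?_⟩
      by_cases hj : s j = 0
      · simp [a, h6 j hj, hj]
      · have := h5 i j (by rw [← hs]; simpa using hi) (by rw [← hs]; simpa using hj)
        simp only at this
        simp only [PiLp.smul_apply, a, smul_eq_mul]
        rw [this]; field_simp
    · push Not at hex
      exact ⟨0, PiLp.ext fun j => by simp [h6 j (hex j)]⟩
  have ha : T a = a := PiLp.ext fun i => by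
    rw [hTapp]
    by_cases hi : s i = 0
    · simp [a, hi]
    · have : ∀ j, B i j * (s j / s j) = B i j := fun j => by
        by_cases hj : s j = 0
        · rw [hB, hBw j i hj, zero_mul]
        · rw [div_self hj, mul_one]
      simp only [a, this, hw, ← hs]
      field_simp
  have key := hT.bordered_form_mul_le_sq (a := a) (q := q') (c := c) (fun y x => by
      have h := h_gap y fun i => x i / s i
      rw [hTinner, inner_eq, inner_eq]
      convert h using 1
      · congr 3
        exact sum_congr rfl fun i _ => by simp only [q']; ring
      · refine sum_congr rfl fun i _ => ?_
        simp only [PiLp.add_apply, PiLp.smul_apply, hTapp, q', smul_eq_mul, ← hs]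
        ring) h_top ha h_simple y (WithLp.toLp 2 fun i => s i * v i)
  rw [hTinner, inner_eq, inner_eq, inner_eq, inner_eq] at key
  convert key using 1
  · congr 1
    · congr 1
      · congr 2
        refine sum_congr rfl fun i _ => ?_
        by_cases hi : s i = 0
        · simp [q', hq i (hs0 i hi)]
        · simp only [q']; field_simp
      · refine sum_congr rfl fun i _ => sum_congr rfl fun j _ => ?_
        by_cases hi : s i = 0
        · simp [hBw i j hi]
        by_cases hj : s j = 0
        · simp [hB i j, hBw j i hj]
        field_simp
    · exact sum_congr rfl fun i _ => (hs i).symm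
  · congr 2
    · congr 1
      refine sum_congr rfl fun i _ => ?_
      by_cases hi : s i = 0
      · simp [q', hq i (hs0 i hi)]
      · simp only [q', a]; field_simp
    · exact sum_congr rfl fun i _ => by simp only [a, ← hs]; ring

/-- The Cauchy-Schwarz inequality for a Lorentzian form, at a vector `(N, b)` in the closed light
cone. -/
theorem lorentz_reverse_cauchy_schwarz {ι : Type*} [Fintype ι] (b c : ι → ℝ) (N t : ℝ)
    (h : ∑ k, b k ^ 2 ≤ N ^ 2) :
    (t ^ 2 - ∑ k, c k ^ 2) * (N ^ 2 - ∑ k, b k ^ 2) ≤ (t * N - ∑ k, c k * b k) ^ 2 := by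
  by_cases hN : N = 0
  · have hb : N ^ 2 - ∑ k, b k ^ 2 = 0 :=
      le_antisymm (by rw [hN]; simpa using sum_nonneg fun k (_ : k ∈ univ) => sq_nonneg (b k))
        (sub_nonneg.2 h)
    rw [hb, mul_zero]
    positivity
  have h1 : 0 ≤ ∑ k, (c k * N - t * b k) ^ 2 := sum_nonneg fun k _ => sq_nonneg _
  have h2 : ∑ k, (c k * N - t * b k) ^ 2 =
      N ^ 2 * ∑ k, c k ^ 2 - 2 * N * t * ∑ k, c k * b k + t ^ 2 * ∑ k, b k ^ 2 := by
    simp only [mul_sum, ← sum_sub_distrib, ← sum_add_distrib]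
    exact sum_congr rfl fun k _ => by ring
  rw [h2] at h1
  have h3 := mul_nonneg (sub_nonneg.2 h) h1
  have hN2 : 0 < N ^ 2 := by positivity
  refine le_of_mul_le_mul_left ?_ hN2
  nlinarith [sq_nonneg (N * (t * N - ∑ k, c k * b k) - t * (N ^ 2 - ∑ k, b k ^ 2))]

theorem sum_sum_fiber {ι κ : Type*} [Fintype ι] [Fintype κ] [DecidableEq κ] (p : ι → κ)
    (f g : ι → ℝ) :
    ∑ k, (∑ i, if p i = k then f i else 0) * (∑ j, if p j = k then g j else 0) =
      ∑ i, ∑ j, if p i = p j then f i * g j else 0 := by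
  simp only [sum_mul_sum]
  rw [sum_comm]
  refine sum_congr rfl fun i _ => ?_
  rw [sum_comm]
  refine sum_congr rfl fun j _ => ?_
  simp [ite_mul, eq_comm]

namespace PaperMatroid

variable {n : ℕ} (M : PaperMatroid n)

open Classical in
/-- The number of independent sets of size `K` containing `R`. -/
noncomputable def extCount (R : Finset (Fin n)) (K : ℕ) : ℝ :=
  ((univ.filter fun S => M.Indep S ∧ S.card = K ∧ R ⊆ S).card : ℝ)

/-- The number of independent sets of size `K` containing `R` and the element `i` outside `R`. -/
noncomputable def extCountOne (R : Finset (Fin n)) (K : ℕ) (i : Fin n) : ℝ :=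
  if i ∈ R then 0 else M.extCount (insert i R) K

/-- The number of independent sets of size `K` containing `R` and the distinct elements `i`, `j`
outside `R`. -/
noncomputable def extCountTwo (R : Finset (Fin n)) (K : ℕ) (i j : Fin n) : ℝ :=
  if i ∈ R then 0 else M.extCountOne (insert i R) K j

variable {M} {R : Finset (Fin n)} {K : ℕ}

theorem extCount_nonneg : 0 ≤ M.extCount R K := Nat.cast_nonneg _

theorem extCountOne_nonneg (i : Fin n) : 0 ≤ M.extCountOne R K i := by
  unfold extCountOne
  split_ifs
  exacts [le_rfl, extCount_nonneg]

theorem extCountTwo_nonneg (i j : Fin n) : 0 ≤ M.extCountTwo R K i j := by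
  unfold extCountTwo
  split_ifs
  exacts [le_rfl, extCountOne_nonneg j]

theorem extCountTwo_comm (i j : Fin n) : M.extCountTwo R K i j = M.extCountTwo R K j i := by
  unfold extCountTwo extCountOne
  by_cases hi : i ∈ R <;> by_cases hj : j ∈ R <;>
    simp [hi, hj, eq_comm (a := i), Finset.insert_comm i j]

theorem sum_extCountOne : ∑ i, M.extCountOne R K i = (K - R.card : ℝ) * M.extCount R K := by
  classical
  have h1 : ∀ i, M.extCountOne R K i =
      ∑ S with M.Indep S ∧ S.card = K ∧ R ⊆ S, if i ∈ S \ R then (1 : ℝ) else 0 := by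
    intro i
    rw [← sum_filter, filter_filter, sum_const, nsmul_eq_mul, mul_one]
    unfold extCountOne extCount
    split_ifs with hi
    · simp [hi]
    · congr 2
      ext S
      simp [insert_subset_iff, hi]
      tauto
  simp only [h1]
  rw [sum_comm]
  have h2 : ∀ S ∈ univ.filter (fun S => M.Indep S ∧ S.card = K ∧ R ⊆ S),
      ∑ i, (if i ∈ S \ R then (1 : ℝ) else 0) = K - R.card := by
    intro S hS
    obtain ⟨-, -, hK, hRS⟩ := mem_filter.1 hS
    rw [sum_ite_mem, univ_inter, sum_const, nsmul_eq_mul, mul_one, card_sdiff_of_subset hRS,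
      Nat.cast_sub (card_le_card hRS), hK]
  rw [sum_congr rfl h2, sum_const, nsmul_eq_mul, mul_comm, extCount]

theorem sum_extCountTwo (i : Fin n) :
    ∑ j, M.extCountTwo R K i j = (K - R.card - 1 : ℝ) * M.extCountOne R K i := by
  by_cases hi : i ∈ R
  · simp [extCountTwo, extCountOne, hi]
  · simp only [extCountTwo, hi, if_false, sum_extCountOne, card_insert_of_notMem hi]
    rw [extCountOne, if_neg hi]
    push_cast
    ring

theorem sum_sum_extCountTwo : ∑ i, ∑ j, M.extCountTwo R K i j =
    (K - R.card - 1 : ℝ) * ((K - R.card) * M.extCount R K) := by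
  simp only [sum_extCountTwo, ← mul_sum, sum_extCountOne]

theorem sum_link_extCountOne (i : Fin n) :
    (∑ k, if k ∈ R then 0 else M.extCountOne (insert k R) K i) =
      (K - R.card - 1 : ℝ) * M.extCountOne R K i := by
  rw [← sum_extCountTwo]
  exact sum_congr rfl fun k _ => by rw [extCountTwo_comm, extCountTwo]

theorem sum_link_extCountTwo (i j : Fin n) :
    (∑ k, if k ∈ R then 0 else M.extCountTwo (insert k R) K i j) =
      (K - R.card - 2 : ℝ) * M.extCountTwo R K i j := by
  have h : ∀ k, (if k ∈ R then 0 else M.extCountTwo (insert k R) K i j) =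
      if i ∈ R then 0 else M.extCountTwo (insert i R) K j k := by
    intro k
    rw [extCountTwo_comm j k]
    by_cases hk : k ∈ R <;> by_cases hi : i ∈ R <;>
      simp [extCountTwo, hk, hi, eq_comm (a := i), Finset.insert_comm i k]
  rw [sum_congr rfl fun k _ => h k]
  by_cases hi : i ∈ R
  · simp [extCountTwo, hi]
  · simp only [hi, if_false, sum_extCountTwo, card_insert_of_notMem hi]
    rw [extCountTwo, if_neg hi]
    push_cast
    ring

theorem extCount_ne_zero_iff :
    M.extCount R K ≠ 0 ↔ ∃ S, M.Indep S ∧ S.card = K ∧ R ⊆ S := by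
  simp [extCount, Finset.filter_eq_empty_iff]

theorem indep_of_extCount_ne_zero (h : M.extCount R K ≠ 0) : M.Indep R := by
  obtain ⟨S, hS, -, hRS⟩ := extCount_ne_zero_iff.1 h
  exact M.indep_subset hRS hS

theorem Indep.exists_extension {R S : Finset (Fin n)} (hR : M.Indep R) (hS : M.Indep S)
    (h : R.card ≤ S.card) : ∃ T, M.Indep T ∧ T.card = S.card ∧ R ⊆ T ∧ T ⊆ R ∪ S := by
  obtain ⟨d, hd⟩ := Nat.exists_eq_add_of_le h
  induction d generalizing R with
  | zero => exact ⟨R, hR, by omega, Subset.rfl, subset_union_left⟩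
  | succ d ih =>
    obtain ⟨i, hi, hiR⟩ := M.indep_exchange hR hS (by omega)
    rw [mem_sdiff] at hi
    have hc := card_insert_of_notMem hi.2
    obtain ⟨T, hT, hTc, hRT, hTs⟩ := ih hiR (by omega) (by omega)
    refine ⟨T, hT, hTc, (subset_insert _ _).trans hRT, hTs.trans ?_⟩
    rw [insert_union]
    exact insert_subset (mem_union_right _ hi.1) Subset.rfl

theorem Indep.extCount_ne_zero {R R' : Finset (Fin n)} (hR : M.Indep R) (h : R.card ≤ K)
    (h' : M.extCount R' K ≠ 0) : M.extCount R K ≠ 0 := by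
  obtain ⟨S, hS, hSK, -⟩ := extCount_ne_zero_iff.1 h'
  obtain ⟨T, hT, hTc, hRT, -⟩ := hR.exists_extension hS (by omega)
  exact extCount_ne_zero_iff.2 ⟨T, hT, by omega, hRT⟩

theorem extCount_card [Decidable (M.Indep R)] :
    M.extCount R R.card = if M.Indep R then 1 else 0 := by
  classical
  have h : (univ.filter fun S => M.Indep S ∧ S.card = R.card ∧ R ⊆ S) =
      if M.Indep R then {R} else ∅ := by
    ext S
    have : S.card = R.card ∧ R ⊆ S ↔ S = R :=
      ⟨fun h => (eq_of_subset_of_card_le h.2 h.1.le).symm, by rintro rfl; simp⟩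
    rw [mem_filter, this]
    split_ifs with hR <;> simp
    · rintro rfl; exact hR
    · rintro h rfl; exact hR h
  rw [extCount, h]
  split_ifs <;> simp

/-- Parallelism over `R` is transitive. -/
theorem not_indep_insert_insert_trans {i j k : Fin n} (hi : i ∉ R) (hj : j ∉ R) (hk : k ∉ R)
    (hij : i ≠ j) (hjk : j ≠ k) (hik : i ≠ k) (hIj : M.Indep (insert j R))
    (h1 : ¬ M.Indep (insert i (insert j R))) (h2 : ¬ M.Indep (insert j (insert k R))) :
    ¬ M.Indep (insert i (insert k R)) := by
  intro h
  obtain ⟨x, hx, hxI⟩ := M.indep_exchange hIj h (by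
    rw [card_insert_of_notMem, card_insert_of_notMem, card_insert_of_notMem] <;> simp [*])
  simp only [mem_sdiff, mem_insert, not_or] at hx
  obtain ⟨rfl | rfl | hxR, -, hx'⟩ := hx
  · exact h1 hxI
  · exact h2 (by rwa [Finset.insert_comm])
  · exact hx' hxR

variable (M) in
/-- The Hessian at `(0, 1, …, 1)` of the generating polynomial `∑ y ^ (K + 2 - #S) / (K + 2 - #S)! x^S`
of the independent sets `S`, differentiated along `R`. -/
noncomputable def linkForm (R : Finset (Fin n)) (K : ℕ) (y : ℝ) (v : Fin n → ℝ) : ℝ :=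
  M.extCount R K * y ^ 2 + 2 * y * ∑ i, M.extCountOne R (K + 1) i * v i +
    ∑ i, ∑ j, M.extCountTwo R (K + 2) i j * (v i * v j)

theorem linkForm_eq_zero {y : ℝ} {v : Fin n → ℝ} (h : ¬ M.Indep R) : M.linkForm R K y v = 0 := by
  have h0 : ∀ R' L, R ⊆ R' → M.extCount R' L = 0 := fun R' L hR => by
    by_contra hne
    exact h (M.indep_subset hR (indep_of_extCount_ne_zero hne))
  have h1 : ∀ R' L i, R ⊆ R' → M.extCountOne R' L i = 0 := fun R' L i hR => by
    simp [extCountOne, h0 _ L (hR.trans (subset_insert i R'))]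
  simp [linkForm, extCountTwo, h0 R K Subset.rfl, h1 R _ _ Subset.rfl,
    fun i j => h1 (insert i R) (K + 2) j (subset_insert i R)]

theorem sum_link_linkForm (y : ℝ) (v : Fin n → ℝ) :
    (∑ k, if k ∈ R then 0 else M.linkForm (insert k R) K y v) =
      (K - R.card : ℝ) * M.linkForm R K y v := by
  have h : ∀ k, (if k ∈ R then 0 else M.linkForm (insert k R) K y v) =
      M.extCountOne R K k * y ^ 2 +
      2 * y * ∑ i, (if k ∈ R then 0 else M.extCountOne (insert k R) (K + 1) i) * v i +
      ∑ i, ∑ j, (if k ∈ R then 0 else M.extCountTwo (insert k R) (K + 2) i j) * (v i * v j) := by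
    intro k
    by_cases hk : k ∈ R <;> simp [hk, linkForm, extCountOne]
  rw [sum_congr rfl fun k _ => h k, sum_add_distrib, sum_add_distrib, ← sum_mul, sum_extCountOne,
    ← mul_sum, sum_comm, sum_comm (s := univ) (t := univ)
      (f := fun k i => ∑ j, (if k ∈ R then 0 else M.extCountTwo (insert k R) (K + 2) i j) * _)]
  have h1 : ∀ i, ∑ k, (if k ∈ R then 0 else M.extCountOne (insert k R) (K + 1) i) * v i =
      (K - R.card : ℝ) * (M.extCountOne R (K + 1) i * v i) := fun i => by
    rw [← sum_mul, sum_link_extCountOne]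
    push_cast
    ring
  have h2 : ∀ i, ∑ k, ∑ j,
      (if k ∈ R then 0 else M.extCountTwo (insert k R) (K + 2) i j) * (v i * v j) =
      (K - R.card : ℝ) * ∑ j, M.extCountTwo R (K + 2) i j * (v i * v j) := fun i => by
    rw [sum_comm, mul_sum]
    refine sum_congr rfl fun j _ => ?_
    rw [← sum_mul, sum_link_extCountTwo]
    push_cast
    ring
  simp only [h1, h2, ← mul_sum, linkForm]
  ring

/-- Parallelism of elements outside `R` in the contraction of `M` by `R`. -/
def parallelSetoid (M : PaperMatroid n) (R : Finset (Fin n)) : Setoid (Fin n) where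
  r i j := i = j ∨ (i ∉ R ∧ j ∉ R ∧ M.Indep (insert i R) ∧ M.Indep (insert j R)) ∧
    ¬ M.Indep (insert i (insert j R))
  iseqv := by
    refine ⟨fun i => Or.inl rfl, ?_, ?_⟩
    · rintro i j (rfl | ⟨⟨hi, hj, hIi, hIj⟩, h⟩)
      · exact Or.inl rfl
      · exact Or.inr ⟨⟨hj, hi, hIj, hIi⟩, by rwa [Finset.insert_comm]⟩
    · rintro i j k (rfl | ⟨⟨hi, hj, hIi, hIj⟩, h⟩) (rfl | ⟨⟨hj', hk, hIj', hIk⟩, h'⟩)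
      · exact Or.inl rfl
      · exact Or.inr ⟨⟨hj', hk, hIj', hIk⟩, h'⟩
      · exact Or.inr ⟨⟨hi, hj, hIi, hIj⟩, h⟩
      · by_cases hik : i = k
        · exact Or.inl hik
        · refine Or.inr ⟨⟨hi, hk, hIi, hIk⟩,
            not_indep_insert_insert_trans hi hj hk ?_ ?_ hik hIj h h'⟩
          · rintro rfl
            exact h (by rwa [insert_idem])
          · rintro rfl
            exact h' (by rwa [insert_idem])

theorem linkForm_card_mul_le_sq (hR : M.Indep R) (y : ℝ) (v : Fin n → ℝ) :
    M.linkForm R R.card y v * ∑ i, ∑ j, M.extCountTwo R (R.card + 2) i j ≤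
      (y * ∑ i, M.extCountOne R (R.card + 1) i +
        ∑ i, (∑ j, M.extCountTwo R (R.card + 2) i j) * v i) ^ 2 := by
  classical
  let p : Fin n → Quotient (M.parallelSetoid R) := fun i => ⟦i⟧
  have hp : ∀ i j, p i = p j ↔ i = j ∨ (i ∉ R ∧ j ∉ R ∧ M.Indep (insert i R) ∧
      M.Indep (insert j R)) ∧ ¬ M.Indep (insert i (insert j R)) := fun i j => Quotient.eq
  let l : Fin n → ℝ := fun i => if i ∉ R ∧ M.Indep (insert i R) then 1 else 0
  have hl0 : ∀ i, 0 ≤ l i := fun i => by simp only [l]; split_ifs <;> norm_num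
  have hc : M.extCount R R.card = 1 := by rw [extCount_card, if_pos hR]
  have hq : ∀ i, M.extCountOne R (R.card + 1) i = l i := fun i => by
    by_cases hi : i ∈ R
    · simp [extCountOne, l, hi]
    · rw [extCountOne, if_neg hi, ← card_insert_of_notMem hi, extCount_card]
      simp [l, hi]
  have hB : ∀ i j, M.extCountTwo R (R.card + 2) i j =
      l i * l j - if p i = p j then l i * l j else 0 := fun i j => by
    by_cases hi : i ∈ R
    · simp [extCountTwo, l, hi]
    by_cases hj : j ∈ R
    · simp [extCountTwo, extCountOne, l, hj]
    by_cases hij : i = j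
    · simp [extCountTwo, extCountOne, hij]
    have hj' : j ∉ insert i R := by simp [hj, Ne.symm hij]
    have hcard : R.card + 2 = (insert j (insert i R)).card := by
      rw [card_insert_of_notMem hj', card_insert_of_notMem hi]
    have h1 : M.Indep (insert i (insert j R)) → M.Indep (insert i R) :=
      M.indep_subset (insert_subset_insert i (subset_insert j R))
    have h2 : M.Indep (insert i (insert j R)) → M.Indep (insert j R) :=
      M.indep_subset (subset_insert i _)
    rw [extCountTwo, if_neg hi, extCountOne, if_neg hj', hcard, extCount_card, Finset.insert_comm]
    by_cases hI : M.Indep (insert i (insert j R))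
    · simp [hp, hij, hi, hj, l, hI, h1 hI, h2 hI]
    · by_cases hIi : M.Indep (insert i R) <;> by_cases hIj : M.Indep (insert j R) <;>
        simp [hp, hij, hi, hj, l, hI, hIi, hIj]
  set N := ∑ i, l i
  set t := y + ∑ i, l i * v i
  let b : Quotient (M.parallelSetoid R) → ℝ := fun k => ∑ i, if p i = k then l i else 0
  let c : Quotient (M.parallelSetoid R) → ℝ := fun k => ∑ i, if p i = k then l i * v i else 0
  have hbb : ∑ k, b k ^ 2 = ∑ i, ∑ j, if p i = p j then l i * l j else 0 := by
    simp only [sq, b, sum_sum_fiber]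
  have hcc : ∑ k, c k ^ 2 = ∑ i, ∑ j, if p i = p j then l i * v i * (l j * v j) else 0 := by
    simp only [sq, c, sum_sum_fiber]
  have hcb : ∑ k, c k * b k = ∑ i, ∑ j, if p i = p j then l i * v i * l j else 0 := by
    simp only [b, c, sum_sum_fiber]
  have hNN : N ^ 2 = ∑ i, ∑ j, l i * l j := by rw [sq, sum_mul_sum]
  have hb_le : ∑ k, b k ^ 2 ≤ N ^ 2 := by
    rw [hbb, hNN]
    refine sum_le_sum fun i _ => sum_le_sum fun j _ => ?_
    split_ifs
    exacts [le_rfl, mul_nonneg (hl0 i) (hl0 j)]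
  convert lorentz_reverse_cauchy_schwarz b c N t hb_le using 2
  · have e : (∑ i, l i * v i) ^ 2 = ∑ i, ∑ j, l i * v i * (l j * v j) := by rw [sq, sum_mul_sum]
    simp only [linkForm, hc, hq, hB, t]
    rw [add_sq, e, hcc, add_sub_assoc, ← sum_sub_distrib, one_mul]
    congr 1
    refine sum_congr rfl fun i _ => ?_
    rw [← sum_sub_distrib]
    refine sum_congr rfl fun j _ => ?_
    split_ifs <;> ring
  · rw [hNN, hbb, ← sum_sub_distrib]
    refine sum_congr rfl fun i _ => ?_
    rw [← sum_sub_distrib]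
    exact sum_congr rfl fun j _ => hB i j
  · have e : (∑ i, l i * v i) * N = ∑ i, ∑ j, l i * v i * l j := sum_mul_sum ..
    simp only [hq, t]
    rw [add_mul, e, hcb, add_sub_assoc, ← sum_sub_distrib]
    congr 1
    refine sum_congr rfl fun i _ => ?_
    rw [← sum_sub_distrib, sum_mul]
    refine sum_congr rfl fun j _ => ?_
    rw [hB]
    split_ifs <;> ring

/-- The graph of pairs extending `R` is connected. -/
theorem eq_of_extCountTwo_ne_zero {v : Fin n → ℝ} (hK : R.card + 2 ≤ K)
    (hR : M.extCount R K ≠ 0) (hv : ∀ i j, M.extCountTwo R K i j ≠ 0 → v i = v j) {i j : Fin n}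
    (hi : M.extCountOne R K i ≠ 0) (hj : M.extCountOne R K j ≠ 0) : v i = v j := by
  have one_ne : ∀ {i}, M.extCountOne R K i ≠ 0 → i ∉ R ∧ M.Indep (insert i R) := fun {i} h => by
    unfold extCountOne at h
    split_ifs at h with hi
    · exact absurd rfl h
    · exact ⟨hi, indep_of_extCount_ne_zero h⟩
  have two_ne : ∀ {i j}, i ∉ R → j ∉ R → i ≠ j → M.Indep (insert i (insert j R)) →
      v i = v j := fun {i j} hi hj hij h => by
    have hj' : j ∉ insert i R := by simp [hj, hij.symm]
    refine hv i j ?_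
    rw [extCountTwo, if_neg hi, extCountOne, if_neg hj']
    rw [Finset.insert_comm] at h
    refine h.extCount_ne_zero ?_ hR
    rw [card_insert_of_notMem hj', card_insert_of_notMem hi]
    omega
  obtain ⟨hiR, hIi⟩ := one_ne hi
  obtain ⟨hjR, hIj⟩ := one_ne hj
  by_cases hij : i = j
  · rw [hij]
  by_cases hIij : M.Indep (insert i (insert j R))
  · exact two_ne hiR hjR hij hIij
  obtain ⟨S, hS, hSK, -⟩ := extCount_ne_zero_iff.1 hR
  obtain ⟨k, hk, hIk⟩ := M.indep_exchange hIi hS (by rw [card_insert_of_notMem hiR]; omega)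
  simp only [mem_sdiff, mem_insert, not_or] at hk
  obtain ⟨-, hki, hkR⟩ := hk
  have hkj : k ≠ j := by
    rintro rfl
    exact hIij (by rwa [Finset.insert_comm])
  rw [← two_ne hkR hiR hki hIk]
  refine two_ne hkR hjR hkj ?_
  by_contra h
  refine not_indep_insert_insert_trans hkR hjR hiR hkj (Ne.symm hij) hki hIj h ?_ hIk
  rwa [Finset.insert_comm]

theorem linkForm_mul_le_sq (m : ℕ) (hK : R.card + m = K) (y : ℝ) (v : Fin n → ℝ) :
    M.linkForm R K y v * ∑ i, ∑ j, M.extCountTwo R (K + 2) i j ≤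
      (y * ∑ i, M.extCountOne R (K + 1) i +
        ∑ i, (∑ j, M.extCountTwo R (K + 2) i j) * v i) ^ 2 := by
  by_cases hR : M.extCount R (K + 2) = 0
  · rw [sum_sum_extCountTwo, hR, mul_zero, mul_zero, mul_zero]
    positivity
  induction m generalizing R y v with
  | zero =>
    obtain rfl : R.card = K := hK
    exact linkForm_card_mul_le_sq (indep_of_extCount_ne_zero hR) y v
  | succ m ih =>
    have hKR : (K : ℝ) = R.card + m + 1 := by rw [← hK]; push_cast; ring
    have hw : ∀ i, ∑ j, M.extCountTwo R (K + 2) i j = (m + 2) * M.extCountOne R (K + 2) i :=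
      fun i => by rw [sum_extCountTwo, Nat.cast_add, hKR]; push_cast; ring
    have hm : (0 : ℝ) < m + 1 := by positivity
    have indep_of_ne : ∀ {L i}, L ≤ K + 2 → M.extCountOne R L i ≠ 0 →
        i ∉ R ∧ M.Indep (insert i R) ∧ 0 < M.extCountOne R (K + 2) i := fun {L i} hL h => by
      unfold extCountOne at h ⊢
      split_ifs at h ⊢ with hi
      · exact absurd rfl h
      · have hI := indep_of_extCount_ne_zero h
        refine ⟨hi, hI, lt_of_le_of_ne extCount_nonneg
          (Ne.symm (hI.extCount_ne_zero ?_ hR))⟩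
        rw [card_insert_of_notMem hi]
        omega
    have link_le : ∀ (y : ℝ) (v : Fin n → ℝ) k,
        (if k ∈ R then 0 else M.linkForm (insert k R) K y v) ≤
          (m + 1) * ((y * M.extCountOne R (K + 1) k +
            ∑ j, M.extCountTwo R (K + 2) k j * v j) ^ 2 / ∑ j, M.extCountTwo R (K + 2) k j) := by
      intro y v k
      have hnn : 0 ≤ (m + 1) * ((y * M.extCountOne R (K + 1) k +
          ∑ j, M.extCountTwo R (K + 2) k j * v j) ^ 2 / ∑ j, M.extCountTwo R (K + 2) k j) :=
        mul_nonneg hm.le (div_nonneg (sq_nonneg _)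
          (sum_nonneg fun j _ => extCountTwo_nonneg k j))
      split_ifs with hk
      · exact hnn
      by_cases hI : M.Indep (insert k R)
      swap
      · rwa [linkForm_eq_zero hI]
      have hcard := card_insert_of_notMem hk
      have hne : M.extCount (insert k R) (K + 2) ≠ 0 :=
        hI.extCount_ne_zero (by omega) hR
      have hone : ∀ L, M.extCountOne R L k = M.extCount (insert k R) L := fun L => by
        rw [extCountOne, if_neg hk]
      have htwo : ∀ L j, M.extCountTwo R L k j = M.extCountOne (insert k R) L j := fun L j => by
        rw [extCountTwo, if_neg hk]
      have hpos : 0 < M.extCount (insert k R) (K + 2) := lt_of_le_of_ne extCount_nonneg hne.symm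
      have h := ih (R := insert k R) (by omega) y v hne
      have e1 : ∀ j, ∑ i, M.extCountTwo (insert k R) (K + 2) j i =
          (m + 1) * M.extCountTwo R (K + 2) k j := fun j => by
        rw [sum_extCountTwo, htwo, hcard, Nat.cast_add, hKR]; push_cast; ring
      have e2 : ∑ i, M.extCountOne (insert k R) (K + 1) i =
          (m + 1) * M.extCountOne R (K + 1) k := by
        rw [sum_extCountOne, hone, hcard, Nat.cast_add, hKR]; push_cast; ring
      simp only [e1, e2, ← mul_sum, mul_assoc] at h
      rw [← hone] at hpos
      rw [hw] at h ⊢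
      rw [← mul_div_assoc, le_div_iff₀ (by positivity)]
      refine le_of_mul_le_mul_left ?_ hm
      calc _ = _ := by ring
        _ ≤ _ := h
        _ = _ := by ring
    refine bordered_matrix_form_mul_le_sq extCountTwo_comm extCountTwo_nonneg (fun _ => rfl)
      ?_ ?_ ?_ y v
    · intro i hi
      by_contra hne
      have := (indep_of_ne (by omega) hne).2.2
      rw [hw] at hi
      have : 0 < (m + 2) * M.extCountOne R (K + 2) i := by positivity
      linarith
    · intro y v
      have h := sum_le_sum fun k (_ : k ∈ univ) => link_le y v k
      rw [sum_link_linkForm, ← mul_sum, hKR] at h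
      refine le_of_mul_le_mul_left (le_trans (le_of_eq ?_) h) hm
      rw [linkForm]
      ring
    · intro v hv i j hi hj
      rw [hw] at hi hj
      exact eq_of_extCountTwo_ne_zero (by omega) hR hv (right_ne_zero_of_mul hi)
        (right_ne_zero_of_mul hj)

theorem extCount_empty : M.extCount ∅ K = numIndep M K := by
  classical
  rw [extCount, numIndep, Nat.card_eq_fintype_card, Fintype.card_subtype]
  simp

end PaperMatroid

/-- **Mason's conjecture, first form (log-concavity).** For a matroid on `n` elements
with `I_k` independent sets of size `k`, for `0 < k < n`: `I_k² ≥ I_{k-1} · I_{k+1}`. -/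
theorem mason_log_concave {n : ℕ} (M : PaperMatroid n) (k : ℕ)
    (hk0 : 0 < k) (hkn : k < n) :
    numIndep M (k-1) * numIndep M (k+1) ≤ (numIndep M k) ^ 2 := by
  obtain ⟨m, rfl⟩ : ∃ m, k = m + 1 := ⟨k - 1, by omega⟩
  have h := PaperMatroid.linkForm_mul_le_sq (M := M) (R := ∅) (K := m) m (by simp) 1 0
  simp only [PaperMatroid.linkForm, PaperMatroid.sum_sum_extCountTwo, PaperMatroid.sum_extCountOne,
    PaperMatroid.extCount_empty, Pi.zero_apply, mul_zero, sum_const_zero, card_empty] at h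
  push_cast at h
  rw [Nat.add_sub_cancel]
  have key : (numIndep M m : ℝ) * numIndep M (m + 2) ≤ (numIndep M (m + 1) : ℝ) ^ 2 := by
    have hm : (0 : ℝ) < (m + 1) ^ 2 := by positivity
    refine le_of_mul_le_mul_left ?_ hm
    have h0 : (0 : ℝ) ≤ (m + 1) * (numIndep M m * numIndep M (m + 2)) := by positivity
    nlinarith
  exact_mod_cast key
end

section
/- For any matroid M = ([n], 𝓘), the homogeneous polynomial g_M(y, z_1, …, z_n) = Σ_{I ∈ 𝓘} y^{n−|I|} · Π_{i ∈ I} z_i in the n+1 variables y, z_1, …, z_n is completely log-concave. -/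
open Matrix MvPolynomial

/-- The directional derivative operator `D_v = ∑ i, v i • ∂_i`. -/
noncomputable def dirDeriv {m : ℕ} (v : Fin m → ℝ) (f : MvPolynomial (Fin m) ℝ) :
    MvPolynomial (Fin m) ℝ :=
  ∑ i, MvPolynomial.C (v i) * MvPolynomial.pderiv i f

/-- `f` is nonnegative and log-concave as a function on the nonnegative orthant. -/
def LogConcaveOn {m : ℕ} (f : MvPolynomial (Fin m) ℝ) : Prop :=
  (∀ x : Fin m → ℝ, (∀ i, 0 ≤ x i) → 0 ≤ MvPolynomial.eval x f) ∧
  ∀ u v : Fin m → ℝ, (∀ i, 0 ≤ u i) → (∀ i, 0 ≤ v i) →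
    ∀ t : ℝ, 0 ≤ t → t ≤ 1 →
      (MvPolynomial.eval u f) ^ t * (MvPolynomial.eval v f) ^ (1 - t) ≤
        MvPolynomial.eval (fun i => t * u i + (1 - t) * v i) f

/-- `f` is completely log-concave: every iterated directional derivative along
nonnegative directions is nonnegative and log-concave on the nonnegative orthant. -/
def CompletelyLogConcave {m : ℕ} (f : MvPolynomial (Fin m) ℝ) : Prop :=
  ∀ (k : ℕ) (v : Fin k → Fin m → ℝ), (∀ j i, 0 ≤ v j i) →
    LogConcaveOn ((List.ofFn v).foldr dirDeriv f)

/- The homogenized independent-set generating polynomial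
`g_M(y, z_1, …, z_n) = ∑_{I ∈ 𝓘} y^(n - |I|) ∏_{i ∈ I} z_i`,
where variable `0` is `y` and variable `i.succ` is `z_i`. -/
open Classical in
noncomputable def gM {n : ℕ} (M : PaperMatroid n) : MvPolynomial (Fin (n+1)) ℝ :=
  ∑ S : Finset (Fin n),
    if M.Indep S then
      MvPolynomial.X 0 ^ (n - S.card) * ∏ i ∈ S, MvPolynomial.X i.succ
    else 0

section DirectionalDerivatives

variable {m : ℕ}

lemma dirDeriv_add (v : Fin m → ℝ) (f g : MvPolynomial (Fin m) ℝ) :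
    dirDeriv v (f + g) = dirDeriv v f + dirDeriv v g := by
  simp [dirDeriv, mul_add, Finset.sum_add_distrib]

lemma dirDeriv_zero (v : Fin m → ℝ) : dirDeriv v (0 : MvPolynomial (Fin m) ℝ) = 0 := by
  simp [dirDeriv]

lemma dirDeriv_C_mul (v : Fin m → ℝ) (c : ℝ) (f : MvPolynomial (Fin m) ℝ) :
    dirDeriv v (C c * f) = C c * dirDeriv v f := by
  simp only [dirDeriv, pderiv_C_mul, Finset.mul_sum]
  exact Finset.sum_congr rfl fun i _ => by ring

lemma dirDeriv_sum (v : Fin m → ℝ) {ι : Type*} (s : Finset ι)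
    (f : ι → MvPolynomial (Fin m) ℝ) :
    dirDeriv v (∑ i ∈ s, f i) = ∑ i ∈ s, dirDeriv v (f i) := by
  classical
  induction s using Finset.induction_on with
  | empty => simp [dirDeriv_zero]
  | insert a s ha ih => rw [Finset.sum_insert ha, Finset.sum_insert ha, dirDeriv_add, ih]

lemma pderiv_comm' (i j : Fin m) (f : MvPolynomial (Fin m) ℝ) :
    pderiv i (pderiv j f) = pderiv j (pderiv i f) := by
  ext s
  rcases eq_or_ne i j with rfl | h
  · rfl
  · simp only [coeff_pderiv, Finsupp.add_apply, Finsupp.single_apply, h, h.symm, if_false]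
    rw [add_right_comm]
    push_cast
    ring

lemma pderiv_dirDeriv (i : Fin m) (v : Fin m → ℝ) (f : MvPolynomial (Fin m) ℝ) :
    pderiv i (dirDeriv v f) = dirDeriv v (pderiv i f) := by
  simp only [dirDeriv, map_sum, pderiv_C_mul, pderiv_comm' i]

lemma dirDeriv_comm (u v : Fin m → ℝ) (f : MvPolynomial (Fin m) ℝ) :
    dirDeriv u (dirDeriv v f) = dirDeriv v (dirDeriv u f) := by
  conv_lhs => rw [dirDeriv]
  conv_rhs => rw [dirDeriv.eq_1 u, dirDeriv_sum]
  simp only [pderiv_dirDeriv, dirDeriv_C_mul]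

lemma foldr_dirDeriv_zero (l : List (Fin m → ℝ)) :
    l.foldr dirDeriv (0 : MvPolynomial (Fin m) ℝ) = 0 := by
  induction l with
  | nil => rfl
  | cons v l ih => rw [List.foldr_cons, ih, dirDeriv_zero]

lemma pderiv_foldr_dirDeriv (i : Fin m) (l : List (Fin m → ℝ))
    (f : MvPolynomial (Fin m) ℝ) :
    pderiv i (l.foldr dirDeriv f) = l.foldr dirDeriv (pderiv i f) := by
  induction l with
  | nil => rfl
  | cons v l ih => rw [List.foldr_cons, List.foldr_cons, pderiv_dirDeriv, ih]

lemma dirDeriv_foldr_dirDeriv (u : Fin m → ℝ) (l : List (Fin m → ℝ))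
    (f : MvPolynomial (Fin m) ℝ) :
    dirDeriv u (l.foldr dirDeriv f) = l.foldr dirDeriv (dirDeriv u f) := by
  induction l with
  | nil => rfl
  | cons v l ih => rw [List.foldr_cons, List.foldr_cons, dirDeriv_comm, ih]

lemma dirDeriv_isHomogeneous (v : Fin m → ℝ) {f : MvPolynomial (Fin m) ℝ} {d : ℕ}
    (hf : f.IsHomogeneous d) : (dirDeriv v f).IsHomogeneous (d - 1) := by
  refine IsHomogeneous.sum _ _ _ fun i _ => ?_
  simpa using (isHomogeneous_C (Fin m) (v i)).mul (hf.pderiv (i := i))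

lemma foldr_dirDeriv_isHomogeneous (l : List (Fin m → ℝ)) {f : MvPolynomial (Fin m) ℝ} {d : ℕ}
    (hf : f.IsHomogeneous d) : (l.foldr dirDeriv f).IsHomogeneous (d - l.length) := by
  induction l with
  | nil => simpa using hf
  | cons v l ih => simpa [Nat.sub_sub] using dirDeriv_isHomogeneous v ih

lemma coeff_pderiv_nonneg {f : MvPolynomial (Fin m) ℝ} (hf : ∀ s, 0 ≤ coeff s f) (i : Fin m)
    (s : Fin m →₀ ℕ) : 0 ≤ coeff s (pderiv i f) := by
  rw [coeff_pderiv]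
  exact mul_nonneg (hf _) (by positivity)

lemma coeff_dirDeriv_nonneg {v : Fin m → ℝ} (hv : ∀ i, 0 ≤ v i) {f : MvPolynomial (Fin m) ℝ}
    (hf : ∀ s, 0 ≤ coeff s f) (s : Fin m →₀ ℕ) : 0 ≤ coeff s (dirDeriv v f) := by
  rw [dirDeriv, coeff_sum]
  refine Finset.sum_nonneg fun i _ => ?_
  rw [coeff_C_mul]
  exact mul_nonneg (hv i) (coeff_pderiv_nonneg hf i s)

lemma coeff_foldr_dirDeriv_nonneg {l : List (Fin m → ℝ)} (hl : ∀ v ∈ l, ∀ i, 0 ≤ v i)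
    {f : MvPolynomial (Fin m) ℝ} (hf : ∀ s, 0 ≤ coeff s f) (s : Fin m →₀ ℕ) :
    0 ≤ coeff s (l.foldr dirDeriv f) := by
  induction l generalizing s with
  | nil => exact hf s
  | cons v l ih =>
    exact coeff_dirDeriv_nonneg (hl v (by simp)) (ih fun u hu => hl u (by simp [hu])) s

lemma eval_nonneg_of_coeff_nonneg {f : MvPolynomial (Fin m) ℝ} (hf : ∀ s, 0 ≤ coeff s f)
    {x : Fin m → ℝ} (hx : ∀ i, 0 ≤ x i) : 0 ≤ eval x f := by
  rw [eval_eq]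
  exact Finset.sum_nonneg fun s _ =>
    mul_nonneg (hf s) (Finset.prod_nonneg fun i _ => pow_nonneg (hx i) _)

lemma eval_pos_of_coeff_nonneg {f : MvPolynomial (Fin m) ℝ} (hf : ∀ s, 0 ≤ coeff s f)
    (h0 : f ≠ 0) {x : Fin m → ℝ} (hx : ∀ i, 0 < x i) : 0 < eval x f := by
  rw [eval_eq]
  refine Finset.sum_pos (fun s hs => ?_) (support_nonempty.mpr h0)
  exact mul_pos (lt_of_le_of_ne (hf s) (mem_support_iff.mp hs).symm)
    (Finset.prod_pos fun i _ => pow_pos (hx i) _)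

/-- Euler's identity for homogeneous polynomials. -/
lemma eval_dirDeriv_self {f : MvPolynomial (Fin m) ℝ} {d : ℕ} (hf : f.IsHomogeneous d)
    (w : Fin m → ℝ) : eval w (dirDeriv w f) = d * eval w f := by
  have h := congrArg (eval w) hf.sum_X_mul_pderiv
  simpa [dirDeriv] using h

lemma eq_C_of_isHomogeneous_zero {f : MvPolynomial (Fin m) ℝ} (hf : f.IsHomogeneous 0) :
    f = C (coeff 0 f) :=
  totalDegree_eq_zero_iff_eq_C.mp ((totalDegree_zero_iff_isHomogeneous _).mpr hf)

lemma eval_zero_foldr_replicate (w : Fin m → ℝ) (d : ℕ) {f : MvPolynomial (Fin m) ℝ}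
    (hf : f.IsHomogeneous d) :
    eval 0 ((List.replicate d w).foldr dirDeriv f) = d.factorial * eval w f := by
  induction d generalizing f with
  | zero =>
    rw [eq_C_of_isHomogeneous_zero hf]
    simp
  | succ d ih =>
    rw [List.replicate_succ, List.foldr_cons, dirDeriv_foldr_dirDeriv,
      ih (by simpa using dirDeriv_isHomogeneous w hf), eval_dirDeriv_self hf, Nat.factorial_succ]
    push_cast
    ring

lemma eq_zero_of_pderiv_eq_zero {f : MvPolynomial (Fin m) ℝ} {d : ℕ}
    (hf : f.IsHomogeneous (d + 1)) (h : ∀ i, pderiv i f = 0) : f = 0 := by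
  have := hf.sum_X_mul_pderiv
  simp only [h, mul_zero, Finset.sum_const_zero] at this
  rw [eq_comm, nsmul_eq_mul] at this
  rcases mul_eq_zero.mp this with h | h
  · exact absurd h (by exact_mod_cast Nat.succ_ne_zero d)
  · exact h

lemma pderiv_eq_zero_of_dirDeriv_eq_zero {f : MvPolynomial (Fin m) ℝ}
    (hf : ∀ s, 0 ≤ coeff s f) {v : Fin m → ℝ} (hv : ∀ i, 0 < v i) (h : dirDeriv v f = 0)
    (i : Fin m) : pderiv i f = 0 := by
  ext s
  have hs := congrArg (coeff s) h
  rw [dirDeriv, coeff_sum, coeff_zero, Finset.sum_eq_zero_iff_of_nonneg] at hs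
  · have := hs i (Finset.mem_univ i)
    rw [coeff_C_mul] at this
    simpa [(hv i).ne'] using this
  · intro j _
    rw [coeff_C_mul]
    exact mul_nonneg (hv j).le (coeff_pderiv_nonneg hf j s)

lemma eq_zero_of_foldr_dirDeriv_eq_zero {l : List (Fin m → ℝ)} (hl : ∀ v ∈ l, ∀ i, 0 < v i)
    {f : MvPolynomial (Fin m) ℝ} (hf : ∀ s, 0 ≤ coeff s f) (hd : f.IsHomogeneous l.length)
    (h : l.foldr dirDeriv f = 0) : f = 0 := by
  induction l generalizing f with
  | nil => exact h
  | cons v l ih =>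
    refine eq_zero_of_pderiv_eq_zero hd fun i => ?_
    refine pderiv_eq_zero_of_dirDeriv_eq_zero hf (hl v (by simp)) ?_ i
    refine ih (fun u hu => hl u (by simp [hu])) (coeff_dirDeriv_nonneg
      (fun i => (hl v (by simp) i).le) hf) (by simpa using dirDeriv_isHomogeneous v hd) ?_
    rwa [List.foldr_cons, dirDeriv_foldr_dirDeriv] at h

end DirectionalDerivatives

section OnePositiveEigenvalue

/-- A real symmetric quadratic form is nonpositive on vectors orthogonal to all eigenvectors with
positive eigenvalue. -/
lemma dotProduct_mulVec_nonpos_of_eigenvectors {ι : Type*} [Fintype ι]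
    {S : Matrix ι ι ℝ} (hS : S.IsSymm) (y : ι → ℝ)
    (h : ∀ (b : ι → ℝ) (c : ℝ), S *ᵥ b = c • b → b ≠ 0 → 0 < c → b ⬝ᵥ y = 0) :
    y ⬝ᵥ S *ᵥ y ≤ 0 := by
  classical
  have hH : S.IsHermitian := by
    rw [Matrix.IsHermitian, Matrix.conjTranspose_eq_transpose_of_trivial]
    exact hS
  have key := hH.eigenvectorBasis.sum_inner_mul_inner (WithLp.toLp 2 y) (WithLp.toLp 2 (S *ᵥ y))
  simp only [EuclideanSpace.inner_eq_star_dotProduct, star_trivial] at key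
  rw [dotProduct_comm, ← key]
  refine Finset.sum_nonpos fun k _ => ?_
  have hb := hH.mulVec_eigenvectorBasis k
  set b : ι → ℝ := ⇑(hH.eigenvectorBasis k) with hbdef
  set c := hH.eigenvalues k
  have hSb : (S *ᵥ y) ⬝ᵥ b = c * (b ⬝ᵥ y) := by
    rw [dotProduct_comm, Matrix.dotProduct_mulVec, ← Matrix.mulVec_transpose, hS.eq, hb,
      smul_dotProduct, smul_eq_mul]
  rw [hSb]
  have hb0 : b ≠ 0 := by
    intro h0
    apply hH.eigenvectorBasis.orthonormal.ne_zero k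
    ext i
    exact congrFun h0 i
  rcases le_or_gt c 0 with hc | hc
  · have : b ⬝ᵥ y * (c * (b ⬝ᵥ y)) = c * (b ⬝ᵥ y) ^ 2 := by ring
    rw [this]
    exact mul_nonpos_of_nonpos_of_nonneg hc (sq_nonneg _)
  · have := h b c hb hb0 hc
    simp [this]

/-- If a symmetric nonnegative matrix `A` with a weight `w > 0` satisfies the Bochner-type
inequality `⟨x, A x⟩ ≤ ∑ i, w i * (A x) i ^ 2 / (A w) i`, and its support is connected through a
single vertex, then its quadratic form is nonpositive on the `A`-orthogonal complement of `w`. -/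
lemma quadratic_nonpos_of_bochner {ι : Type*} [Fintype ι] {A : Matrix ι ι ℝ}
    (hA : A.IsSymm) (hA0 : ∀ i j, 0 ≤ A i j) {w : ι → ℝ} (hw : ∀ i, 0 < w i)
    (hB : ∀ x : ι → ℝ, x ⬝ᵥ A *ᵥ x ≤ ∑ i, w i * (A *ᵥ x) i ^ 2 / (A *ᵥ w) i)
    (o : ι) (ho : ∀ i, (A *ᵥ w) i ≠ 0 → 0 < A i o)
    {x : ι → ℝ} (hx : x ⬝ᵥ A *ᵥ w = 0) : x ⬝ᵥ A *ᵥ x ≤ 0 := by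
  have hp : ∀ i, 0 ≤ (A *ᵥ w) i := fun i =>
    Finset.sum_nonneg fun j _ => mul_nonneg (hA0 i j) (hw j).le
  have hrow : ∀ i, (A *ᵥ w) i = 0 → ∀ j, A i j = 0 := by
    intro i hi j
    have := (Finset.sum_eq_zero_iff_of_nonneg
      (fun j _ => mul_nonneg (hA0 i j) (hw j).le)).mp hi j (Finset.mem_univ j)
    exact (mul_eq_zero.mp this).resolve_right (hw j).ne'
  have hsymm : ∀ i j, A i j = A j i := fun i j => hA.apply j i
  -- the normalisation `r i ^ 2 = w i / (A w) i`
  set r : ι → ℝ := fun i => Real.sqrt (w i / (A *ᵥ w) i) with hr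
  have hr2 : ∀ i, r i ^ 2 = w i / (A *ᵥ w) i := fun i =>
    Real.sq_sqrt (div_nonneg (hw i).le (hp i))
  have hr0 : ∀ i, (A *ᵥ w) i ≠ 0 → r i ≠ 0 := fun i hi h0 => by
    have := hr2 i
    rw [h0] at this
    exact (div_ne_zero (hw i).ne' hi) (by simpa using this.symm)
  have hrz : ∀ i, (A *ᵥ w) i = 0 → r i = 0 := fun i hi => by simp [hr, hi]
  let S : Matrix ι ι ℝ := fun i j => r i * A i j * r j
  have hS : S.IsSymm := by
    ext i j
    change r j * A j i * r i = r i * A i j * r j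
    rw [hsymm j i]
    ring
  have hSmul : ∀ b i, (S *ᵥ b) i = r i * (A *ᵥ fun j => r j * b j) i := by
    intro b i
    simp only [Matrix.mulVec, dotProduct, S, Finset.mul_sum]
    exact Finset.sum_congr rfl fun j _ => by ring
  have hSquad : ∀ b, b ⬝ᵥ S *ᵥ b = (fun j => r j * b j) ⬝ᵥ A *ᵥ (fun j => r j * b j) := by
    intro b
    simp only [dotProduct, hSmul]
    exact Finset.sum_congr rfl fun j _ => by ring
  have hxy : (fun j => r j * (x j / r j)) ⬝ᵥ A *ᵥ (fun j => r j * (x j / r j)) =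
      x ⬝ᵥ A *ᵥ x := by
    simp only [dotProduct, Matrix.mulVec, Finset.mul_sum]
    refine Finset.sum_congr rfl fun i _ => Finset.sum_congr rfl fun j _ => ?_
    by_cases hi : (A *ᵥ w) i = 0
    · simp [hrow i hi j]
    by_cases hj : (A *ᵥ w) j = 0
    · simp [hsymm i j, hrow j hj i]
    rw [mul_div_cancel₀ _ (hr0 i hi), mul_div_cancel₀ _ (hr0 j hj)]
  rw [← hxy, ← hSquad]
  refine dotProduct_mulVec_nonpos_of_eigenvectors hS _ fun b c hb hb0 hc => ?_
  set z : ι → ℝ := fun j => r j * b j with hz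
  have hbb : 0 < ∑ i, b i ^ 2 := by
    obtain ⟨i, hi⟩ := Function.ne_iff.mp hb0
    exact Finset.sum_pos' (fun i _ => sq_nonneg _) ⟨i, Finset.mem_univ i, by
      have : b i ≠ 0 := hi
      positivity⟩
  have hquad : z ⬝ᵥ A *ᵥ z = c * ∑ i, b i ^ 2 := by
    rw [← hSquad, hb, dotProduct_smul, smul_eq_mul]
    simp [dotProduct, sq]
  have hAz : ∀ i, r i * (A *ᵥ z) i = c * b i := fun i => by
    rw [← hSmul, hb]; rfl
  have hsum : ∑ i, w i * (A *ᵥ z) i ^ 2 / (A *ᵥ w) i = c ^ 2 * ∑ i, b i ^ 2 := by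
    rw [Finset.mul_sum]
    refine Finset.sum_congr rfl fun i _ => ?_
    calc w i * (A *ᵥ z) i ^ 2 / (A *ᵥ w) i = (r i * (A *ᵥ z) i) ^ 2 := by
          rw [mul_pow, hr2]; ring
      _ = c ^ 2 * b i ^ 2 := by rw [hAz]; ring
  have hc1 : 1 ≤ c := by
    have h1 := hB z
    rw [hquad, hsum] at h1
    have h2 : c ≤ c ^ 2 := le_of_mul_le_mul_right h1 hbb
    nlinarith
  -- the Perron–Frobenius inequality with its defect term
  have hdefect : ∑ i, ∑ j, A i j * w i * w j * (z i / w i - z j / w j) ^ 2 =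
      2 * (∑ i, (A *ᵥ w) i / w i * z i ^ 2 - z ⬝ᵥ A *ᵥ z) := by
    have h1 : ∑ i, (A *ᵥ w) i / w i * z i ^ 2 = ∑ i, ∑ j, A i j * w j / w i * z i ^ 2 := by
      refine Finset.sum_congr rfl fun i _ => ?_
      simp only [Matrix.mulVec, dotProduct, Finset.sum_div, Finset.sum_mul]
    have h2 : ∑ i, ∑ j, A i j * w j / w i * z i ^ 2 =
        ∑ i, ∑ j, A i j * w i / w j * z j ^ 2 := by
      rw [Finset.sum_comm]
      exact Finset.sum_congr rfl fun i _ => Finset.sum_congr rfl fun j _ => by rw [hsymm i j]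
    have h3 : z ⬝ᵥ A *ᵥ z = ∑ i, ∑ j, A i j * z i * z j := by
      simp only [dotProduct, Matrix.mulVec, Finset.mul_sum]
      exact Finset.sum_congr rfl fun i _ => Finset.sum_congr rfl fun j _ => by ring
    rw [mul_sub, two_mul, h1]
    nth_rewrite 2 [h2]
    rw [h3, Finset.mul_sum, ← Finset.sum_add_distrib, ← Finset.sum_sub_distrib]
    refine Finset.sum_congr rfl fun i _ => ?_
    rw [Finset.mul_sum, ← Finset.sum_add_distrib, ← Finset.sum_sub_distrib]
    refine Finset.sum_congr rfl fun j _ => ?_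
    have := (hw i).ne'
    have := (hw j).ne'
    field_simp
    ring
  have hle : ∑ i, (A *ᵥ w) i / w i * z i ^ 2 ≤ ∑ i, b i ^ 2 := by
    refine Finset.sum_le_sum fun i _ => ?_
    rw [hz]
    simp only [mul_pow, hr2]
    by_cases hi : (A *ᵥ w) i = 0
    · simp [hi, sq_nonneg]
    · have := (hw i).ne'
      apply le_of_eq
      field_simp
  have hnn : ∀ i j, 0 ≤ A i j * w i * w j * (z i / w i - z j / w j) ^ 2 := fun i j =>
    mul_nonneg (mul_nonneg (mul_nonneg (hA0 i j) (hw i).le) (hw j).le) (sq_nonneg _)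
  have hzero : ∑ i, ∑ j, A i j * w i * w j * (z i / w i - z j / w j) ^ 2 = 0 := by
    refine le_antisymm ?_ (Finset.sum_nonneg fun i _ => Finset.sum_nonneg fun j _ => hnn i j)
    rw [hdefect, hquad]
    nlinarith
  have hconst : ∀ i, (A *ᵥ w) i ≠ 0 → z i = z o / w o * w i := by
    intro i hi
    have h1 := (Finset.sum_eq_zero_iff_of_nonneg fun i _ =>
      Finset.sum_nonneg fun j _ => hnn i j).mp hzero i (Finset.mem_univ i)
    have h2 := (Finset.sum_eq_zero_iff_of_nonneg fun j _ => hnn i j).mp h1 o (Finset.mem_univ o)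
    have h3 : (z i / w i - z o / w o) ^ 2 = 0 := (mul_eq_zero.mp h2).resolve_left
      (mul_pos (mul_pos (ho i hi) (hw i)) (hw o)).ne'
    have h4 : z i / w i = z o / w o := sub_eq_zero.mp (pow_eq_zero_iff two_ne_zero |>.mp h3)
    rw [← h4, div_mul_cancel₀ _ (hw i).ne']
  have hfin : b ⬝ᵥ (fun j => x j / r j) = z o / w o * (x ⬝ᵥ A *ᵥ w) := by
    simp only [dotProduct, Finset.mul_sum]
    refine Finset.sum_congr rfl fun i _ => ?_
    by_cases hi : (A *ᵥ w) i = 0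
    · simp [hi, hrz i hi]
    have h1 : b i = z i / r i := by rw [hz]; field_simp [hr0 i hi]
    have h2 := hr0 i hi
    have h3 := (hw i).ne'
    rw [h1, hconst i hi]
    calc z o / w o * w i / r i * (x i / r i) = z o / w o * w i * x i / r i ^ 2 := by
          field_simp
      _ = z o / w o * (x i * (A *ᵥ w) i) := by rw [hr2]; field_simp
  rw [hfin, hx, mul_zero]

/-- The reversed Cauchy–Schwarz inequality for a symmetric form that is nonpositive on a
hyperplane. -/
lemma mul_le_sq_of_nonpos_on_ker {ι : Type*} [Fintype ι] {A : Matrix ι ι ℝ} (hA : A.IsSymm)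
    {φ : (ι → ℝ) →ₗ[ℝ] ℝ} (hφ : ∀ x, φ x = 0 → x ⬝ᵥ A *ᵥ x ≤ 0) {w : ι → ℝ}
    (hw : 0 ≤ w ⬝ᵥ A *ᵥ w) (x : ι → ℝ) :
    (x ⬝ᵥ A *ᵥ x) * (w ⬝ᵥ A *ᵥ w) ≤ (x ⬝ᵥ A *ᵥ w) ^ 2 := by
  by_cases h : φ w = 0
  · rw [le_antisymm (hφ w h) hw, mul_zero]
    exact sq_nonneg _
  · set c := φ x / φ w with hc
    have h1 := hφ (x - c • w) (by simp [hc, h])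
    have h2 : w ⬝ᵥ A *ᵥ x = x ⬝ᵥ A *ᵥ w := by
      rw [Matrix.dotProduct_mulVec, ← Matrix.mulVec_transpose, hA.eq, dotProduct_comm]
    simp only [Matrix.mulVec_sub, Matrix.mulVec_smul, dotProduct_sub, sub_dotProduct,
      dotProduct_smul, smul_dotProduct, smul_eq_mul, h2] at h1
    nlinarith [sq_nonneg (x ⬝ᵥ A *ᵥ w - c * (w ⬝ᵥ A *ᵥ w)), mul_nonneg hw (neg_nonneg.mpr h1)]

end OnePositiveEigenvalue

section Lorentzian

variable {m : ℕ}

/-- The Hessian matrix of a polynomial at the origin. -/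
noncomputable def hessianZero (f : MvPolynomial (Fin m) ℝ) : Matrix (Fin m) (Fin m) ℝ :=
  Matrix.of fun i j => eval 0 (pderiv i (pderiv j f))

lemma hessianZero_apply (f : MvPolynomial (Fin m) ℝ) (i j : Fin m) :
    hessianZero f i j = eval 0 (pderiv i (pderiv j f)) := rfl

lemma hessianZero_isSymm (f : MvPolynomial (Fin m) ℝ) : (hessianZero f).IsSymm := by
  ext i j
  rw [Matrix.transpose_apply, hessianZero_apply, hessianZero_apply, pderiv_comm']

lemma hessianZero_nonneg {f : MvPolynomial (Fin m) ℝ} (hf : ∀ s, 0 ≤ coeff s f) (i j : Fin m) :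
    0 ≤ hessianZero f i j :=
  eval_nonneg_of_coeff_nonneg (coeff_pderiv_nonneg (coeff_pderiv_nonneg hf j) i) fun _ => le_rfl

lemma hessianZero_mulVec (f : MvPolynomial (Fin m) ℝ) (y : Fin m → ℝ) (i : Fin m) :
    (hessianZero f *ᵥ y) i = eval 0 (pderiv i (dirDeriv y f)) := by
  simp [Matrix.mulVec, dotProduct, hessianZero_apply, dirDeriv, mul_comm]

lemma dotProduct_hessianZero (f : MvPolynomial (Fin m) ℝ) (x y : Fin m → ℝ) :
    x ⬝ᵥ hessianZero f *ᵥ y = eval 0 (dirDeriv x (dirDeriv y f)) := by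
  simp only [dotProduct, hessianZero_mulVec]
  rw [dirDeriv.eq_1 x]
  simp only [map_sum, map_mul, eval_C]

lemma hessianZero_dirDeriv_mulVec (f : MvPolynomial (Fin m) ℝ) (w x : Fin m → ℝ) (i : Fin m) :
    (hessianZero (dirDeriv w f) *ᵥ x) i = x ⬝ᵥ hessianZero (pderiv i f) *ᵥ w := by
  rw [hessianZero_mulVec, dotProduct_hessianZero, pderiv_dirDeriv, pderiv_dirDeriv]

lemma dotProduct_hessianZero_dirDeriv (f : MvPolynomial (Fin m) ℝ) (w x : Fin m → ℝ) :
    x ⬝ᵥ hessianZero (dirDeriv w f) *ᵥ x = ∑ i, w i * (x ⬝ᵥ hessianZero (pderiv i f) *ᵥ x) := by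
  simp only [dotProduct_hessianZero]
  rw [dirDeriv_comm x w f, dirDeriv_comm x w, dirDeriv.eq_1 w]
  simp [pderiv_dirDeriv]

/-- All Hessians of `d`-fold derivatives of `f` along positive directions are nonpositive on some
hyperplane. -/
def HasLorentzianHessians (d : ℕ) (f : MvPolynomial (Fin m) ℝ) : Prop :=
  ∀ l : List (Fin m → ℝ), l.length = d → (∀ v ∈ l, ∀ i, 0 < v i) →
    ∃ φ : (Fin m → ℝ) →ₗ[ℝ] ℝ, ∀ x, φ x = 0 →
      x ⬝ᵥ hessianZero (l.foldr dirDeriv f) *ᵥ x ≤ 0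

lemma HasLorentzianHessians.of_pderiv {d : ℕ} {f : MvPolynomial (Fin m) ℝ}
    (hf : ∀ s, 0 ≤ coeff s f) (hom : f.IsHomogeneous (d + 3))
    (hi : ∀ i, HasLorentzianHessians d (pderiv i f)) (o : Fin m)
    (ho : ∀ i, pderiv i f ≠ 0 → pderiv o (pderiv i f) ≠ 0) :
    HasLorentzianHessians (d + 1) f := by
  intro l hl hpos
  obtain ⟨w, l, rfl⟩ := List.exists_cons_of_length_eq_add_one hl
  have hl' : l.length = d := by simpa using hl
  have hw : ∀ i, 0 < w i := hpos w (by simp)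
  have hpos' : ∀ v ∈ l, ∀ i, 0 < v i := fun v hv => hpos v (by simp [hv])
  rw [List.foldr_cons]
  set F := l.foldr dirDeriv f with hF
  have hF0 : ∀ s, 0 ≤ coeff s F :=
    coeff_foldr_dirDeriv_nonneg (fun v hv i => (hpos' v hv i).le) hf
  have hwF0 : ∀ s, 0 ≤ coeff s (dirDeriv w F) := coeff_dirDeriv_nonneg (fun i => (hw i).le) hF0
  have hA0 := hessianZero_nonneg hwF0
  have hAi0 := fun i => hessianZero_nonneg (coeff_pderiv_nonneg hF0 i)
  have hsymm := hessianZero_isSymm (dirDeriv w F)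
  refine ⟨(dotProductBilin ℝ ℝ).flip (hessianZero (dirDeriv w F) *ᵥ w), fun x hx => ?_⟩
  refine quadratic_nonpos_of_bochner hsymm hA0 hw ?_ o ?_ hx
  · intro x
    rw [dotProduct_hessianZero_dirDeriv]
    refine Finset.sum_le_sum fun i _ => ?_
    rw [mul_div_assoc]
    refine mul_le_mul_of_nonneg_left ?_ (hw i).le
    rw [hessianZero_dirDeriv_mulVec, hessianZero_dirDeriv_mulVec]
    have hterm : ∀ j k, 0 ≤ w j * (hessianZero (pderiv i F) j k * w k) := fun j k =>
      mul_nonneg (hw j).le (mul_nonneg (hAi0 i j k) (hw k).le)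
    have hexp : w ⬝ᵥ hessianZero (pderiv i F) *ᵥ w =
        ∑ j, ∑ k, w j * (hessianZero (pderiv i F) j k * w k) := by
      simp only [dotProduct, Matrix.mulVec, Finset.mul_sum]
    have hww : 0 ≤ w ⬝ᵥ hessianZero (pderiv i F) *ᵥ w := by
      rw [hexp]
      exact Finset.sum_nonneg fun j _ => Finset.sum_nonneg fun k _ => hterm j k
    rcases hww.eq_or_lt with h0 | h0
    · have hz : hessianZero (pderiv i F) = 0 := by
        ext j k
        have h1 := (Finset.sum_eq_zero_iff_of_nonneg fun j _ =>
          Finset.sum_nonneg fun k _ => hterm j k).mp (hexp.symm.trans h0.symm) j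
            (Finset.mem_univ j)
        have h2 := (Finset.sum_eq_zero_iff_of_nonneg fun k _ => hterm j k).mp h1 k
          (Finset.mem_univ k)
        simpa [(hw j).ne', (hw k).ne'] using h2
      simp [hz]
    · rw [le_div_iff₀ h0]
      obtain ⟨φ, hφ⟩ := hi i l hl' hpos'
      rw [← pderiv_foldr_dirDeriv] at hφ
      exact mul_le_sq_of_nonpos_on_ker (hessianZero_isSymm _) hφ hww x
  · intro i hi0
    have hcomm : hessianZero (dirDeriv w F) i o =
        eval 0 ((w :: l).foldr dirDeriv (pderiv o (pderiv i f))) := by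
      rw [hessianZero_apply, pderiv_comm', pderiv_dirDeriv, pderiv_dirDeriv, hF,
        pderiv_foldr_dirDeriv, pderiv_foldr_dirDeriv, List.foldr_cons]
    have hne : pderiv i f ≠ 0 := by
      intro h
      apply hi0
      rw [hessianZero_dirDeriv_mulVec, hF, pderiv_foldr_dirDeriv, h, foldr_dirDeriv_zero,
        dotProduct_hessianZero]
      simp [dirDeriv_zero]
    have hnn := coeff_pderiv_nonneg (coeff_pderiv_nonneg hf i) o
    have hdeg : (pderiv o (pderiv i f)).IsHomogeneous (w :: l).length := by
      rw [hl]
      exact (hom.pderiv (i := i)).pderiv (i := o)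
    have h0 : (w :: l).foldr dirDeriv (pderiv o (pderiv i f)) ≠ 0 := fun h =>
      ho i hne (eq_zero_of_foldr_dirDeriv_eq_zero hpos hnn hdeg h)
    have hd0 : ((w :: l).foldr dirDeriv (pderiv o (pderiv i f))).IsHomogeneous 0 := by
      simpa using foldr_dirDeriv_isHomogeneous (w :: l) hdeg
    have hc0 := coeff_foldr_dirDeriv_nonneg (fun v hv i => (hpos v hv i).le) hnn 0
    rw [hcomm]
    rw [eq_C_of_isHomogeneous_zero hd0] at h0 ⊢
    rw [eval_C]
    refine lt_of_le_of_ne hc0 fun h => h0 ?_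
    rw [← h, C_0]

/-- The Lorentzian property, evaluated at a positive point, is a log-concavity inequality for
directional second derivatives. -/
lemma HasLorentzianHessians.eval_mul_le_sq {n : ℕ} {f : MvPolynomial (Fin m) ℝ}
    (hL : HasLorentzianHessians n f) (hf : ∀ s, 0 ≤ coeff s f) (hom : f.IsHomogeneous (n + 2))
    {l : List (Fin m → ℝ)} (hl : l.length ≤ n) (hpos : ∀ v ∈ l, ∀ i, 0 < v i)
    {w : Fin m → ℝ} (hw : ∀ i, 0 < w i) (x : Fin m → ℝ) :
    eval w (l.foldr dirDeriv f) * eval w (dirDeriv x (dirDeriv x (l.foldr dirDeriv f))) ≤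
      eval w (dirDeriv x (l.foldr dirDeriv f)) ^ 2 := by
  obtain ⟨e, rfl⟩ := Nat.exists_eq_add_of_le hl
  set F := l.foldr dirDeriv f with hF
  have hFh : F.IsHomogeneous (e + 2) := by
    have := foldr_dirDeriv_isHomogeneous l hom
    rwa [show l.length + e + 2 - l.length = e + 2 by omega] at this
  have hF0 : ∀ s, 0 ≤ coeff s F :=
    coeff_foldr_dirDeriv_nonneg (fun v hv i => (hpos v hv i).le) hf
  have hxF : (dirDeriv x F).IsHomogeneous (e + 1) := dirDeriv_isHomogeneous x hFh
  have hxxF : (dirDeriv x (dirDeriv x F)).IsHomogeneous e := dirDeriv_isHomogeneous x hxF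
  obtain ⟨φ, hφ⟩ := hL (List.replicate e w ++ l) (by simp [add_comm]) (by
    intro v hv
    rcases List.mem_append.mp hv with h | h
    · rw [List.eq_of_mem_replicate h]; exact hw
    · exact hpos v h)
  rw [List.foldr_append, ← hF] at hφ
  set G := (List.replicate e w).foldr dirDeriv F with hG
  have hxx : x ⬝ᵥ hessianZero G *ᵥ x =
      e.factorial * eval w (dirDeriv x (dirDeriv x F)) := by
    rw [dotProduct_hessianZero, hG, dirDeriv_foldr_dirDeriv, dirDeriv_foldr_dirDeriv,
      eval_zero_foldr_replicate w e hxxF]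
  have hxw : x ⬝ᵥ hessianZero G *ᵥ w = (e + 1).factorial * eval w (dirDeriv x F) := by
    rw [dotProduct_hessianZero, hG, dirDeriv_comm, dirDeriv_foldr_dirDeriv,
      ← eval_zero_foldr_replicate w (e + 1) hxF, List.replicate_succ, List.foldr_cons]
  have hww : w ⬝ᵥ hessianZero G *ᵥ w = (e + 2).factorial * eval w F := by
    rw [dotProduct_hessianZero, hG, ← eval_zero_foldr_replicate w (e + 2) hFh,
      List.replicate_succ, List.foldr_cons, List.replicate_succ, List.foldr_cons]
  have hFw : 0 ≤ eval w F := eval_nonneg_of_coeff_nonneg hF0 fun i => (hw i).le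
  have key := mul_le_sq_of_nonpos_on_ker (hessianZero_isSymm G) hφ
    (by rw [hww]; positivity) x
  rw [hxx, hxw, hww, Nat.factorial_succ (e + 1), Nat.factorial_succ e] at key
  push_cast at key
  set a := eval w (dirDeriv x F)
  set b := eval w (dirDeriv x (dirDeriv x F))
  set c := eval w F
  have hfac : (0 : ℝ) < e.factorial := by exact_mod_cast e.factorial_pos
  have he : (0 : ℝ) ≤ e := e.cast_nonneg
  have h1 : ((e.factorial : ℝ) ^ 2 * (e + 1)) * ((e + 2) * (c * b)) ≤
      ((e.factorial : ℝ) ^ 2 * (e + 1)) * ((e + 1) * a ^ 2) := by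
    nlinarith [key]
  have h2 : (e + 2) * (c * b) ≤ (e + 1) * a ^ 2 := le_of_mul_le_mul_left h1 (by positivity)
  by_contra! hcon
  nlinarith [sq_nonneg a]

end Lorentzian

section LogConcavity

variable {m : ℕ}

lemma hasDerivAt_eval_line (f : MvPolynomial (Fin m) ℝ) (p x : Fin m → ℝ) (s : ℝ) :
    HasDerivAt (fun s : ℝ => eval (p + s • x) f) (eval (p + s • x) (dirDeriv x f)) s := by
  induction f using MvPolynomial.induction_on with
  | C a => simpa [dirDeriv] using hasDerivAt_const s a
  | add f g hf hg =>
    simp only [dirDeriv_add, map_add]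
    exact hf.add hg
  | mul_X f i hf =>
    have h1 : dirDeriv x (f * X i) = dirDeriv x f * X i + f * C (x i) := by
      simp only [dirDeriv, pderiv_mul, pderiv_X, mul_add, Finset.sum_add_distrib, Finset.sum_mul,
        mul_assoc]
      congr 1
      rw [Finset.sum_eq_single i]
      · simp [mul_comm]
      · intro j _ hj
        simp [hj.symm]
      · simp
    have h2 : HasDerivAt (fun s : ℝ => p i + s * x i) (x i) s := by
      simpa using ((hasDerivAt_id s).mul_const (x i)).const_add (p i)
    have h3 : HasDerivAt (fun s : ℝ => eval (p + s • x) f * (p i + s * x i))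
        (eval (p + s • x) (dirDeriv x f) * (p i + s * x i) + eval (p + s • x) f * x i) s :=
      hf.mul h2
    rw [h1]
    simpa using h3

lemma rpow_mul_rpow_le_eval {f : MvPolynomial (Fin m) ℝ} (hf : ∀ s, 0 ≤ coeff s f)
    (hH : ∀ w : Fin m → ℝ, (∀ i, 0 < w i) → ∀ x : Fin m → ℝ,
      eval w f * eval w (dirDeriv x (dirDeriv x f)) ≤ eval w (dirDeriv x f) ^ 2)
    {u v : Fin m → ℝ} (hu : ∀ i, 0 < u i) (hv : ∀ i, 0 < v i) {t : ℝ} (ht0 : 0 ≤ t)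
    (ht1 : t ≤ 1) :
    eval u f ^ t * eval v f ^ (1 - t) ≤ eval (fun i => t * u i + (1 - t) * v i) f := by
  by_cases hf0 : f = 0
  · subst hf0
    simp only [map_zero]
    rcases ht0.eq_or_lt with rfl | ht0
    · simp
    · simp [Real.zero_rpow ht0.ne']
  have hpos : ∀ s ∈ Set.Icc (0 : ℝ) 1, ∀ i, 0 < (v + s • (u - v)) i := by
    rintro s ⟨h0, h1⟩ i
    have : (v + s • (u - v)) i = (1 - s) * v i + s * u i := by simp; ring
    rw [this]
    rcases h0.eq_or_lt with rfl | h0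
    · simpa using hv i
    · exact add_pos_of_nonneg_of_pos (mul_nonneg (by linarith) (hv i).le) (mul_pos h0 (hu i))
  have hfp : ∀ s ∈ Set.Icc (0 : ℝ) 1, 0 < eval (v + s • (u - v)) f := fun s hs =>
    eval_pos_of_coeff_nonneg hf hf0 (hpos s hs)
  have hd := fun s => hasDerivAt_eval_line f v (u - v) s
  have hdd := fun s => hasDerivAt_eval_line (dirDeriv (u - v) f) v (u - v) s
  have hconc : ConcaveOn ℝ (Set.Icc (0 : ℝ) 1)
      (fun s => Real.log (eval (v + s • (u - v)) f)) := by
    refine concaveOn_of_hasDerivWithinAt2_nonpos (convex_Icc 0 1)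
      (fun s hs => ((hd s).continuousAt.log (hfp s hs).ne').continuousWithinAt)
      (fun s hs => ((hd s).log (hfp s (interior_subset hs)).ne').hasDerivWithinAt)
      (fun s hs => ((hdd s).div (hd s) (hfp s (interior_subset hs)).ne').hasDerivWithinAt)
      fun s hs => ?_
    have h := hH _ (hpos s (interior_subset hs)) (u - v)
    exact div_nonpos_of_nonpos_of_nonneg (by nlinarith) (sq_nonneg _)
  have hc := hconc.2 (Set.right_mem_Icc.mpr zero_le_one) (Set.left_mem_Icc.mpr zero_le_one)
    ht0 (sub_nonneg.mpr ht1) (add_sub_cancel t 1)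
  have e1 : v + (1 : ℝ) • (u - v) = u := by simp
  have e0 : v + (0 : ℝ) • (u - v) = v := by simp
  have et : v + (t * (1 : ℝ) + (1 - t) * (0 : ℝ)) • (u - v) =
      fun i => t * u i + (1 - t) * v i := by
    ext i
    simp
    ring
  simp only [e1, e0, et, smul_eq_mul] at hc
  have hu' := eval_pos_of_coeff_nonneg hf hf0 hu
  have hv' := eval_pos_of_coeff_nonneg hf hf0 hv
  have ht' : 0 < eval (fun i => t * u i + (1 - t) * v i) f := by
    have := hfp t ⟨ht0, ht1⟩
    rwa [show v + t • (u - v) = fun i => t * u i + (1 - t) * v i by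
      ext i; simp; ring] at this
  rw [Real.rpow_def_of_pos hu', Real.rpow_def_of_pos hv', ← Real.exp_add]
  calc _ ≤ Real.exp (Real.log (eval (fun i => t * u i + (1 - t) * v i) f)) := by
        apply Real.exp_le_exp.mpr
        linarith
    _ = _ := Real.exp_log ht'

lemma continuous_eval_foldr_dirDeriv (l : List (Fin m → ℝ)) (f : MvPolynomial (Fin m) ℝ)
    {p : ℝ → Fin m → ℝ} (hp : Continuous p) :
    Continuous fun ε : ℝ =>
      eval (p ε) ((l.map fun v i => v i + ε).foldr dirDeriv f) := by
  induction l generalizing f with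
  | nil => exact (MvPolynomial.continuous_eval f).comp hp
  | cons v l ih =>
    simp only [List.map_cons, List.foldr_cons]
    have h : ∀ ε : ℝ, eval (p ε) (dirDeriv (fun i => v i + ε)
        ((l.map fun v i => v i + ε).foldr dirDeriv f)) =
        ∑ i, (v i + ε) * eval (p ε) ((l.map fun v i => v i + ε).foldr dirDeriv (pderiv i f)) := by
      intro ε
      rw [dirDeriv.eq_1]
      simp [pderiv_foldr_dirDeriv]
    simp only [h]
    exact continuous_finsetSum _ fun i _ => (continuous_const.add continuous_id).mul (ih _)

/-- Complete log-concavity follows from a second-derivative inequality at positive points for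
derivatives along positive directions. -/
lemma completelyLogConcave_of_eval_mul_le_sq {f : MvPolynomial (Fin m) ℝ}
    (hf : ∀ s, 0 ≤ coeff s f)
    (hH : ∀ l : List (Fin m → ℝ), (∀ v ∈ l, ∀ i, 0 < v i) →
      ∀ w : Fin m → ℝ, (∀ i, 0 < w i) → ∀ x : Fin m → ℝ,
      eval w (l.foldr dirDeriv f) * eval w (dirDeriv x (dirDeriv x (l.foldr dirDeriv f))) ≤
        eval w (dirDeriv x (l.foldr dirDeriv f)) ^ 2) :
    CompletelyLogConcave f := by
  intro k d hd
  set l := List.ofFn d with hl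
  have hl0 : ∀ v ∈ l, ∀ i, 0 ≤ v i := by
    intro v hv
    obtain ⟨j, rfl⟩ := (List.mem_ofFn' d v).mp hv
    exact hd j
  refine ⟨fun x hx => eval_nonneg_of_coeff_nonneg (coeff_foldr_dirDeriv_nonneg hl0 hf) hx, ?_⟩
  intro u v hu hv t ht0 ht1
  have hcont : ∀ p : ℝ → Fin m → ℝ, Continuous p →
      Filter.Tendsto (fun ε : ℝ => eval (p ε) ((l.map fun v i => v i + ε).foldr dirDeriv f))
        (nhdsWithin 0 (Set.Ioi 0)) (nhds (eval (p 0) (l.foldr dirDeriv f))) := by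
    intro p hp
    have h := (continuous_eval_foldr_dirDeriv l f hp).tendsto 0
    simp only [add_zero, List.map_id'] at h
    exact h.mono_left nhdsWithin_le_nhds
  have hu' := hcont (fun ε i => u i + ε) (by fun_prop)
  have hv' := hcont (fun ε i => v i + ε) (by fun_prop)
  have ht' := hcont (fun ε i => t * (u i + ε) + (1 - t) * (v i + ε)) (by fun_prop)
  simp only [add_zero] at hu' hv' ht'
  refine le_of_tendsto_of_tendsto ((hu'.rpow_const (Or.inr ht0)).mul
    (hv'.rpow_const (Or.inr (sub_nonneg.mpr ht1)))) ht' ?_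
  filter_upwards [self_mem_nhdsWithin] with ε hε
  have hε : 0 < ε := hε
  have hlε : ∀ v ∈ l.map (fun v i => v i + ε), ∀ i, 0 < v i := by
    intro v hv i
    obtain ⟨v', hv', rfl⟩ := List.mem_map.mp hv
    exact add_pos_of_nonneg_of_pos (hl0 v' hv' i) hε
  exact rpow_mul_rpow_le_eval
    (coeff_foldr_dirDeriv_nonneg (fun v hv i => (hlε v hv i).le) hf) (hH _ hlε)
    (fun i => add_pos_of_nonneg_of_pos (hu i) hε) (fun i => add_pos_of_nonneg_of_pos (hv i) hε)
    ht0 ht1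

lemma completelyLogConcave_of_hasLorentzianHessians {n : ℕ} {f : MvPolynomial (Fin m) ℝ}
    (hf : ∀ s, 0 ≤ coeff s f) (hom : f.IsHomogeneous n)
    (hL : ∀ d, n = d + 2 → HasLorentzianHessians d f) : CompletelyLogConcave f := by
  refine completelyLogConcave_of_eval_mul_le_sq hf fun l hl w hw x => ?_
  by_cases hn : l.length + 2 ≤ n
  · obtain ⟨d, rfl⟩ := Nat.exists_eq_add_of_le' (le_of_add_le_right hn)
    exact (hL d rfl).eval_mul_le_sq hf hom (by omega) hl hw x
  · have h : (dirDeriv x (l.foldr dirDeriv f)).IsHomogeneous 0 := by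
      have := dirDeriv_isHomogeneous x (foldr_dirDeriv_isHomogeneous l hom)
      rwa [show n - l.length - 1 = 0 by omega] at this
    have h0 : dirDeriv x (dirDeriv x (l.foldr dirDeriv f)) = 0 := by
      rw [eq_C_of_isHomogeneous_zero h]
      simp [dirDeriv]
    rw [h0, map_zero, mul_zero]
    exact sq_nonneg _

end LogConcavity

section ExponentialCoefficients

variable {m : ℕ}

/-- The coefficient of `f` at the divided-power monomial with exponent `s`. -/
noncomputable def egfCoeff (f : MvPolynomial (Fin m) ℝ) (s : Fin m →₀ ℕ) : ℝ :=
  (∏ j, ((s j).factorial : ℝ)) * coeff s f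

lemma prod_factorial_pos (s : Fin m →₀ ℕ) : (0 : ℝ) < ∏ j, ((s j).factorial : ℝ) :=
  Finset.prod_pos fun j _ => by exact_mod_cast (s j).factorial_pos

lemma egfCoeff_ne_zero_iff {f : MvPolynomial (Fin m) ℝ} {s : Fin m →₀ ℕ} :
    egfCoeff f s ≠ 0 ↔ coeff s f ≠ 0 := by
  simp [egfCoeff, (prod_factorial_pos s).ne']

lemma coeff_nonneg_of_egfCoeff_nonneg {f : MvPolynomial (Fin m) ℝ} {s : Fin m →₀ ℕ}
    (h : 0 ≤ egfCoeff f s) : 0 ≤ coeff s f :=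
  nonneg_of_mul_nonneg_right h (prod_factorial_pos s)

lemma egfCoeff_pderiv (f : MvPolynomial (Fin m) ℝ) (i : Fin m) (s : Fin m →₀ ℕ) :
    egfCoeff (pderiv i f) s = egfCoeff f (s + Finsupp.single i 1) := by
  have h : ∀ j : Fin m, (((s + Finsupp.single i 1 : Fin m →₀ ℕ) j).factorial : ℝ) =
      ((s j).factorial : ℝ) * (if j = i then (s i + 1 : ℝ) else 1) := by
    intro j
    by_cases hj : j = i
    · subst hj
      simp [Nat.factorial_succ, mul_comm]
    · simp [hj]
  simp only [egfCoeff, h, Finset.prod_mul_distrib, Finset.prod_ite_eq', Finset.mem_univ, if_true,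
    coeff_pderiv]
  ring

lemma eval_zero_eq_egfCoeff (f : MvPolynomial (Fin m) ℝ) : eval 0 f = egfCoeff f 0 := by
  simp [egfCoeff, eval_zero, constantCoeff_eq]

end ExponentialCoefficients

section Matroid

/-- The exponent vector `(k, 1_S)`. -/
noncomputable def indicatorExponent {n : ℕ} (S : Finset (Fin n)) (k : ℕ) : Fin (n + 1) →₀ ℕ :=
  Finsupp.equivFunOnFinite.symm (Fin.cons k fun i => if i ∈ S then 1 else 0)

variable {n : ℕ}

@[simp]
lemma indicatorExponent_zero (S : Finset (Fin n)) (k : ℕ) : indicatorExponent S k 0 = k := rfl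

@[simp]
lemma indicatorExponent_succ (S : Finset (Fin n)) (k : ℕ) (i : Fin n) :
    indicatorExponent S k i.succ = if i ∈ S then 1 else 0 := rfl

lemma indicatorExponent_inj {S T : Finset (Fin n)} {k l : ℕ}
    (h : indicatorExponent S k = indicatorExponent T l) : S = T := by
  ext i
  have := DFunLike.congr_fun h i.succ
  simp only [indicatorExponent_succ] at this
  split_ifs at this <;> simp_all

lemma indicatorExponent_add_single_zero (S : Finset (Fin n)) (k l : ℕ) :
    indicatorExponent S k + Finsupp.single 0 l = indicatorExponent S (k + l) := by
  ext i
  refine Fin.cases ?_ (fun i => ?_) i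
  · simp
  · simp

lemma indicatorExponent_add_single_succ {S : Finset (Fin n)} {i : Fin n} (hi : i ∉ S) (k : ℕ) :
    indicatorExponent S k + Finsupp.single i.succ 1 = indicatorExponent (insert i S) k := by
  ext j
  refine Fin.cases ?_ (fun j => ?_) j
  · simp
  · by_cases h : j = i
    · subst h
      simp [hi]
    · simp [h]

lemma sum_indicatorExponent (S : Finset (Fin n)) (k : ℕ) :
    ∑ i, indicatorExponent S k i = k + S.card := by
  simp [Fin.sum_univ_succ]

lemma monomial_indicatorExponent (S : Finset (Fin n)) (k : ℕ) :
    (monomial (indicatorExponent S k) (1 : ℝ)) = X 0 ^ k * ∏ i ∈ S, X i.succ := by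
  rw [monomial_eq, C_1, one_mul, Finsupp.prod_fintype _ _ (fun i => pow_zero _),
    Fin.prod_univ_succ]
  simp [pow_ite, Finset.prod_ite_mem]

open Classical in
lemma gM_eq_sum_monomial (M : PaperMatroid n) :
    gM M = ∑ S : Finset (Fin n), if M.Indep S then
      monomial (indicatorExponent S (n - S.card)) (1 : ℝ) else 0 := by
  simp only [gM, monomial_indicatorExponent]

lemma gM_isHomogeneous (M : PaperMatroid n) : (gM M).IsHomogeneous n := by
  refine IsHomogeneous.sum _ _ _ fun S _ => ?_
  split_ifs
  · have h := (isHomogeneous_X_pow (R := ℝ) (0 : Fin (n + 1)) (n - S.card)).mul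
      (IsHomogeneous.prod S (fun i => (X i.succ : MvPolynomial (Fin (n + 1)) ℝ)) (fun _ => 1)
        fun i _ => isHomogeneous_X _ _)
    have hS : S.card ≤ n := by simpa using S.card_le_univ
    simpa [Nat.sub_add_cancel hS] using h
  · exact isHomogeneous_zero _ _ _

open Classical in
lemma coeff_gM_indicatorExponent (M : PaperMatroid n) (S : Finset (Fin n)) :
    coeff (indicatorExponent S (n - S.card)) (gM M) = if M.Indep S then 1 else 0 := by
  rw [gM_eq_sum_monomial, coeff_sum, Finset.sum_eq_single S]
  · split_ifs <;> simp
  · intro T _ hT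
    split_ifs
    · rw [coeff_monomial, if_neg fun h => hT (indicatorExponent_inj h)]
    · simp
  · simp

lemma exists_indep_of_coeff_gM_ne_zero (M : PaperMatroid n) {s : Fin (n + 1) →₀ ℕ}
    (h : coeff s (gM M) ≠ 0) : ∃ S, M.Indep S ∧ s = indicatorExponent S (n - S.card) := by
  classical
  rw [gM_eq_sum_monomial, coeff_sum] at h
  obtain ⟨S, -, hS⟩ := Finset.exists_ne_zero_of_sum_ne_zero h
  by_cases hI : M.Indep S
  · refine ⟨S, hI, ?_⟩
    rw [if_pos hI, coeff_monomial] at hS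
    by_contra hne
    exact hS (if_neg fun h => hne h.symm)
  · simp [hI] at hS

lemma coeff_gM_nonneg (M : PaperMatroid n) (s : Fin (n + 1) →₀ ℕ) : 0 ≤ coeff s (gM M) := by
  classical
  rw [gM_eq_sum_monomial, coeff_sum]
  refine Finset.sum_nonneg fun S _ => ?_
  split_ifs
  · rw [coeff_monomial]
    split_ifs <;> norm_num
  · simp

lemma egfCoeff_gM_nonneg (M : PaperMatroid n) (s : Fin (n + 1) →₀ ℕ) :
    0 ≤ egfCoeff (gM M) s :=
  mul_nonneg (prod_factorial_pos s).le (coeff_gM_nonneg M s)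

open Classical in
lemma egfCoeff_gM_indicatorExponent (M : PaperMatroid n) {S : Finset (Fin n)} {k : ℕ}
    (hk : k + S.card = n) :
    egfCoeff (gM M) (indicatorExponent S k) = if M.Indep S then (k.factorial : ℝ) else 0 := by
  obtain rfl : k = n - S.card := by omega
  rw [egfCoeff, coeff_gM_indicatorExponent, Fin.prod_univ_succ]
  have h : ∀ i : Fin n, ((indicatorExponent S (n - S.card) i.succ).factorial : ℝ) = 1 := by
    intro i
    rw [indicatorExponent_succ]
    split_ifs <;> simp
  rw [Finset.prod_congr rfl fun i _ => h i]
  simp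

lemma egfCoeff_gM_eq_zero (M : PaperMatroid n) {s : Fin (n + 1) →₀ ℕ} {i : Fin n}
    (h : 1 < s i.succ) : egfCoeff (gM M) s = 0 := by
  by_contra hne
  obtain ⟨S, -, rfl⟩ := exists_indep_of_coeff_gM_ne_zero M (egfCoeff_ne_zero_iff.mp hne)
  rw [indicatorExponent_succ] at h
  split_ifs at h <;> omega

/-- An exponent below the support of `gM M` is the exponent of an independent set. -/
lemma exists_indep_of_egfCoeff_add_ne_zero (M : PaperMatroid n) {s β : Fin (n + 1) →₀ ℕ}
    (h : egfCoeff (gM M) (s + β) ≠ 0) : ∃ I k, M.Indep I ∧ β = indicatorExponent I k := by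
  classical
  obtain ⟨S, hS, hs⟩ := exists_indep_of_coeff_gM_ne_zero M (egfCoeff_ne_zero_iff.mp h)
  have hle : ∀ i : Fin n, β i.succ ≤ if i ∈ S then 1 else 0 := by
    intro i
    have := DFunLike.congr_fun hs i.succ
    rw [Finsupp.add_apply, indicatorExponent_succ] at this
    omega
  refine ⟨Finset.univ.filter fun i => β i.succ = 1, β 0, M.indep_subset ?_ hS, ?_⟩
  · intro i hi
    have h1 := hle i
    rw [(Finset.mem_filter.mp hi).2] at h1
    by_contra hiS
    simp [hiS] at h1
  · ext j
    refine Fin.cases ?_ (fun j => ?_) j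
    · rfl
    · have := hle j
      rw [indicatorExponent_succ]
      simp only [Finset.mem_filter, Finset.mem_univ, true_and]
      split_ifs at this ⊢ <;> omega

end Matroid

section Fibers

variable {ι κ : Type*} [DecidableEq κ]

lemma sum_sum_ite_eq_sum_sq_fiber (N : Finset ι) (ρ : ι → κ) (x : ι → ℝ) :
    ∑ i ∈ N, ∑ j ∈ N, (if ρ i = ρ j then x i * x j else 0) =
      ∑ c ∈ N.image ρ, (∑ i ∈ N with ρ i = c, x i) ^ 2 := by
  rw [← Finset.sum_fiberwise_of_maps_to (g := ρ) (t := N.image ρ)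
    fun i hi => Finset.mem_image_of_mem ρ hi]
  refine Finset.sum_congr rfl fun c _ => ?_
  rw [sq, Finset.sum_mul]
  refine Finset.sum_congr rfl fun i hi => ?_
  rw [(Finset.mem_filter.mp hi).2, Finset.mul_sum, Finset.sum_filter]
  exact Finset.sum_congr rfl fun j _ => by simp only [eq_comm]

lemma sum_sum_ite_eq_nonneg (N : Finset ι) (ρ : ι → κ) (x : ι → ℝ) :
    0 ≤ ∑ i ∈ N, ∑ j ∈ N, (if ρ i = ρ j then x i * x j else 0) := by
  rw [sum_sum_ite_eq_sum_sq_fiber]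
  positivity

lemma sq_sum_le_card_mul_sum_sum_ite_eq (N : Finset ι) (ρ : ι → κ) (x : ι → ℝ) :
    (∑ i ∈ N, x i) ^ 2 ≤
      N.card * ∑ i ∈ N, ∑ j ∈ N, (if ρ i = ρ j then x i * x j else 0) := by
  refine le_trans ?_ (mul_le_mul_of_nonneg_right
    (Nat.cast_le.mpr (Finset.card_image_le (s := N) (f := ρ))) (sum_sum_ite_eq_nonneg N ρ x))
  rw [sum_sum_ite_eq_sum_sq_fiber, ← Finset.sum_fiberwise_of_maps_to (g := ρ) (t := N.image ρ)
    fun i hi => Finset.mem_image_of_mem ρ hi]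
  exact sq_sum_le_card_mul_sum_sq

end Fibers

section LorentzianMatroid

variable {n : ℕ} (M : PaperMatroid n)

open Classical in
/-- The elements which extend the independent set `I`, i.e. the nonloops of `M / I`. -/
noncomputable def extensions (I : Finset (Fin n)) : Finset (Fin n) :=
  Finset.univ.filter fun i => i ∉ I ∧ M.Indep (insert i I)

variable {M} in
lemma mem_extensions {I : Finset (Fin n)} {i : Fin n} :
    i ∈ extensions M I ↔ i ∉ I ∧ M.Indep (insert i I) := by
  simp [extensions]

/-- The relation of being equal or parallel in the contraction `M / I`. -/
def Parallel (I : Finset (Fin n)) (i j : Fin n) : Prop :=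
  i = j ∨ ¬ M.Indep (insert i (insert j I))

variable {M}

lemma Parallel.symm {I : Finset (Fin n)} {i j : Fin n} (h : Parallel M I i j) :
    Parallel M I j i := by
  rcases h with h | h
  · exact Or.inl h.symm
  · exact Or.inr (by rwa [Finset.insert_comm])

lemma Parallel.trans {I : Finset (Fin n)} {i j l : Fin n} (hi : i ∈ extensions M I)
    (hj : j ∈ extensions M I) (hl : l ∈ extensions M I) (hij : Parallel M I i j)
    (hjl : Parallel M I j l) : Parallel M I i l := by
  rcases hij with rfl | hij
  · exact hjl
  rcases hjl with rfl | hjl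
  · exact Or.inr hij
  by_cases hil : i = l
  · exact Or.inl hil
  refine Or.inr fun hind => ?_
  rw [mem_extensions] at hi hj hl
  obtain ⟨e, he, hei⟩ := M.indep_exchange hj.2 hind (by
    rw [Finset.card_insert_of_notMem hj.1, Finset.card_insert_of_notMem (by simp [hil, hi.1]),
      Finset.card_insert_of_notMem hl.1]
    omega)
  simp only [Finset.mem_sdiff, Finset.mem_insert, not_or] at he
  rcases he with ⟨rfl | rfl | he, hej, heI⟩
  · exact hij hei
  · exact hjl (by rwa [Finset.insert_comm])
  · exact heI he

open Classical in
/-- The parallel class of `i` in the contraction `M / I`. -/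
noncomputable def parallelClass (M : PaperMatroid n) (I : Finset (Fin n)) (i : Fin n) :
    Finset (Fin n) :=
  (extensions M I).filter (Parallel M I i)

lemma parallelClass_eq_iff {I : Finset (Fin n)} {i j : Fin n} (hi : i ∈ extensions M I)
    (hj : j ∈ extensions M I) :
    parallelClass M I i = parallelClass M I j ↔ Parallel M I i j := by
  classical
  constructor
  · intro h
    have hmem : j ∈ parallelClass M I j := Finset.mem_filter.mpr ⟨hj, Or.inl rfl⟩
    rw [← h] at hmem
    exact (Finset.mem_filter.mp hmem).2
  · intro h
    refine Finset.filter_congr fun l hl => ⟨fun hil => ?_, fun hjl => ?_⟩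
    · exact h.symm.trans hj hi hl hil
    · exact h.trans hi hj hl hjl

lemma hessianZero_eq_egfCoeff {m : ℕ} (f : MvPolynomial (Fin m) ℝ) (i j : Fin m) :
    hessianZero f i j = egfCoeff f (Finsupp.single i 1 + Finsupp.single j 1) := by
  rw [hessianZero_apply, eval_zero_eq_egfCoeff, egfCoeff_pderiv, egfCoeff_pderiv, zero_add]

variable {f : MvPolynomial (Fin (n + 1)) ℝ} {I : Finset (Fin n)} {k : ℕ}

lemma hessianZero_zero_zero (hI : M.Indep I) (hk : k + 2 + I.card = n)
    (hf : ∀ s, egfCoeff f s = egfCoeff (gM M) (s + indicatorExponent I k)) :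
    hessianZero f 0 0 = k.factorial * ((k + 2) * (k + 1)) := by
  rw [hessianZero_eq_egfCoeff, hf, add_comm _ (indicatorExponent I k), ← Finsupp.single_add,
    indicatorExponent_add_single_zero, egfCoeff_gM_indicatorExponent M (by omega), if_pos hI]
  push_cast [Nat.factorial_succ]
  ring

lemma hessianZero_succ_zero (hk : k + 2 + I.card = n)
    (hf : ∀ s, egfCoeff f s = egfCoeff (gM M) (s + indicatorExponent I k)) (i : Fin n) :
    hessianZero f i.succ 0 =
      if i ∈ extensions M I then (k.factorial * (k + 1) : ℝ) else 0 := by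
  classical
  rw [hessianZero_eq_egfCoeff, hf]
  by_cases hi : i ∈ I
  · rw [if_neg fun h => (mem_extensions.mp h).1 hi, egfCoeff_gM_eq_zero M (i := i)]
    simp [hi]
  · rw [add_comm _ (indicatorExponent I k), add_comm (Finsupp.single _ _), ← add_assoc, indicatorExponent_add_single_zero,
      indicatorExponent_add_single_succ hi, egfCoeff_gM_indicatorExponent M
        (by rw [Finset.card_insert_of_notMem hi]; omega)]
    refine if_congr ⟨fun h => mem_extensions.mpr ⟨hi, h⟩, fun h => (mem_extensions.mp h).2⟩ ?_ rfl
    push_cast [Nat.factorial_succ]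
    ring

open Classical in
lemma hessianZero_succ_succ (hk : k + 2 + I.card = n)
    (hf : ∀ s, egfCoeff f s = egfCoeff (gM M) (s + indicatorExponent I k)) (i j : Fin n) :
    hessianZero f i.succ j.succ =
      if i ∈ extensions M I ∧ j ∈ extensions M I ∧ ¬ Parallel M I i j
      then (k.factorial : ℝ) else 0 := by
  rw [hessianZero_eq_egfCoeff, hf]
  by_cases hij : i = j
  · subst hij
    rw [if_neg fun h => h.2.2 (Or.inl rfl), egfCoeff_gM_eq_zero M (i := i)]
    simp only [Finsupp.add_apply, Finsupp.single_eq_same]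
    omega
  by_cases hi : i ∈ I
  · rw [if_neg fun h => (mem_extensions.mp h.1).1 hi, egfCoeff_gM_eq_zero M (i := i)]
    simp [hi]
  by_cases hj : j ∈ I
  · rw [if_neg fun h => (mem_extensions.mp h.2.1).1 hj, egfCoeff_gM_eq_zero M (i := j)]
    simp [hj]
  have hi' : i ∉ insert j I := by simp [hij, hi]
  rw [add_comm _ (indicatorExponent I k), add_comm (Finsupp.single _ _), ← add_assoc, indicatorExponent_add_single_succ hj,
    indicatorExponent_add_single_succ hi', egfCoeff_gM_indicatorExponent M
      (by rw [Finset.card_insert_of_notMem hi', Finset.card_insert_of_notMem hj]; omega)]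
  refine if_congr ⟨fun h => ⟨?_, ?_, ?_⟩, fun h => ?_⟩ rfl rfl
  · exact mem_extensions.mpr ⟨hi, M.indep_subset
      (Finset.insert_subset_insert i (Finset.subset_insert j I)) h⟩
  · exact mem_extensions.mpr ⟨hj, M.indep_subset (Finset.subset_insert i _) h⟩
  · exact fun hp => hp.elim hij fun hn => hn h
  · by_contra hn
    exact h.2.2 (Or.inr hn)

lemma dotProduct_hessianZero_matroid (hI : M.Indep I) (hk : k + 2 + I.card = n)
    (hf : ∀ s, egfCoeff f s = egfCoeff (gM M) (s + indicatorExponent I k))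
    (x : Fin (n + 1) → ℝ) :
    x ⬝ᵥ hessianZero f *ᵥ x = k.factorial * ((k + 2) * (k + 1) * x 0 ^ 2 +
      2 * (k + 1) * x 0 * (∑ i ∈ extensions M I, x i.succ) +
      (∑ i ∈ extensions M I, x i.succ) ^ 2 -
      ∑ i ∈ extensions M I, ∑ j ∈ extensions M I,
        (if parallelClass M I i = parallelClass M I j then x i.succ * x j.succ else 0)) := by
  classical
  have hzs : ∀ i : Fin n, hessianZero f 0 i.succ = hessianZero f i.succ 0 := fun i => by
    rw [hessianZero_apply, hessianZero_apply, pderiv_comm']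
  have hcross : ∑ i : Fin n, hessianZero f i.succ 0 * x i.succ =
      k.factorial * (k + 1) * ∑ i ∈ extensions M I, x i.succ := by
    simp only [hessianZero_succ_zero hk hf, ite_mul, zero_mul, Finset.sum_ite_mem,
      Finset.univ_inter, Finset.mul_sum]
  have hpair : ∑ i : Fin n, x i.succ * ∑ j : Fin n, hessianZero f i.succ j.succ * x j.succ =
      k.factorial * ((∑ i ∈ extensions M I, x i.succ) ^ 2 -
      ∑ i ∈ extensions M I, ∑ j ∈ extensions M I,
        (if parallelClass M I i = parallelClass M I j then x i.succ * x j.succ else 0)) := by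
    rw [sq, Finset.sum_mul, ← Finset.sum_sub_distrib, Finset.mul_sum,
      ← Finset.sum_subset (Finset.subset_univ (extensions M I))]
    · refine Finset.sum_congr rfl fun i hi => ?_
      rw [Finset.mul_sum _ _ (x i.succ), Finset.mul_sum _ _ (x i.succ),
        ← Finset.sum_sub_distrib, Finset.mul_sum,
        ← Finset.sum_subset (Finset.subset_univ (extensions M I))]
      · refine Finset.sum_congr rfl fun j hj => ?_
        rw [hessianZero_succ_succ hk hf]
        simp only [hi, hj, true_and, parallelClass_eq_iff hi hj]
        split_ifs <;> first | contradiction | ring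
      · intro j _ hj
        simp [hessianZero_succ_succ hk hf, hj]
    · intro i _ hi
      simp [hessianZero_succ_succ hk hf, hi]
  have hexpand : x ⬝ᵥ hessianZero f *ᵥ x = hessianZero f 0 0 * x 0 ^ 2 +
      2 * x 0 * (∑ i : Fin n, hessianZero f i.succ 0 * x i.succ) +
      ∑ i : Fin n, x i.succ * ∑ j : Fin n, hessianZero f i.succ j.succ * x j.succ := by
    simp only [dotProduct, Matrix.mulVec, Fin.sum_univ_succ, hzs, mul_add,
      Finset.sum_add_distrib]
    have h : ∑ i : Fin n, x i.succ * (hessianZero f i.succ 0 * x 0) =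
        x 0 * ∑ i : Fin n, hessianZero f i.succ 0 * x i.succ := by
      rw [Finset.mul_sum]
      exact Finset.sum_congr rfl fun i _ => by ring
    rw [h]
    ring
  rw [hexpand, hcross, hpair, hessianZero_zero_zero hI hk hf]
  ring

lemma exists_dotProduct_hessianZero_matroid_nonpos (hI : M.Indep I) (hk : k + 2 + I.card = n)
    (hf : ∀ s, egfCoeff f s = egfCoeff (gM M) (s + indicatorExponent I k)) :
    ∃ φ : (Fin (n + 1) → ℝ) →ₗ[ℝ] ℝ, ∀ x, φ x = 0 → x ⬝ᵥ hessianZero f *ᵥ x ≤ 0 := by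
  refine ⟨((k : ℝ) + 2) • LinearMap.proj 0 + ∑ i ∈ extensions M I, LinearMap.proj i.succ,
    fun x hx => ?_⟩
  have hx' : ((k : ℝ) + 2) * x 0 + ∑ i ∈ extensions M I, x i.succ = 0 := by
    simpa [LinearMap.sum_apply] using hx
  have hcard : (extensions M I).card ≤ k + 2 := by
    have hd : Disjoint (extensions M I) I :=
      Finset.disjoint_left.mpr fun i hi => (mem_extensions.mp hi).1
    have h := (extensions M I ∪ I).card_le_univ
    rw [Finset.card_union_of_disjoint hd, Fintype.card_fin] at h
    omega
  rw [dotProduct_hessianZero_matroid hI hk hf]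
  have hR := sum_sum_ite_eq_nonneg (extensions M I) (parallelClass M I) fun i => x i.succ
  have hS := sq_sum_le_card_mul_sum_sum_ite_eq (extensions M I) (parallelClass M I)
    fun i => x i.succ
  have hcard' : ((extensions M I).card : ℝ) ≤ k + 2 := by exact_mod_cast hcard
  have hS' := hS.trans (mul_le_mul_of_nonneg_right hcard' hR)
  set R := ∑ i ∈ extensions M I, ∑ j ∈ extensions M I,
    (if parallelClass M I i = parallelClass M I j then x i.succ * x j.succ else 0)
  set S := ∑ i ∈ extensions M I, x i.succ
  refine mul_nonpos_of_nonneg_of_nonpos (Nat.cast_nonneg _) ?_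
  have hk0 : (0 : ℝ) < k + 2 := by positivity
  refine nonpos_of_mul_nonpos_right ?_ hk0
  obtain hSx : S = -((k + 2) * x 0) := by linarith
  rw [hSx] at hS' ⊢
  linarith

/-- The derivatives of `gM M`, recorded through their divided-power coefficients, have Lorentzian
Hessians. -/
lemma hasLorentzianHessians_of_egfCoeff (M : PaperMatroid n) (d : ℕ) (β : Fin (n + 1) →₀ ℕ)
    (f : MvPolynomial (Fin (n + 1)) ℝ) (hf : ∀ s, egfCoeff f s = egfCoeff (gM M) (s + β))
    (hom : f.IsHomogeneous (d + 2)) (hβ : ∑ i, β i + d + 2 = n) :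
    HasLorentzianHessians d f := by
  induction d generalizing β f with
  | zero =>
    intro l hl _
    obtain rfl := List.length_eq_zero_iff.mp hl
    rw [List.foldr_nil]
    by_cases h0 : ∃ s, egfCoeff f s ≠ 0
    · obtain ⟨s, hs⟩ := h0
      obtain ⟨I, k, hI, rfl⟩ := exists_indep_of_egfCoeff_add_ne_zero M (hf s ▸ hs)
      rw [sum_indicatorExponent] at hβ
      exact exists_dotProduct_hessianZero_matroid_nonpos hI (by omega) hf
    · push Not at h0
      have hz : hessianZero f = 0 := by
        ext i j
        rw [hessianZero_eq_egfCoeff, h0, Matrix.zero_apply]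
      exact ⟨0, fun x _ => by simp [hz]⟩
  | succ d ih =>
    have hpd : ∀ i s, egfCoeff (pderiv i f) s =
        egfCoeff (gM M) (s + (β + Finsupp.single i 1)) := fun i s => by
      rw [egfCoeff_pderiv, hf, add_assoc, add_comm (Finsupp.single i 1)]
    have hsum : ∀ i, ∑ j, (β + Finsupp.single i 1 : Fin (n + 1) →₀ ℕ) j + d + 2 = n := fun i => by
      simp only [Finsupp.add_apply, Finset.sum_add_distrib, Finsupp.single_apply,
        Finset.sum_ite_eq, Finset.mem_univ, if_true]
      omega
    refine HasLorentzianHessians.of_pderiv (fun s => coeff_nonneg_of_egfCoeff_nonneg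
      (hf s ▸ egfCoeff_gM_nonneg M _)) hom (fun i => ih _ _ (hpd i) (hom.pderiv (i := i)) (hsum i))
      0 fun i hi h0 => ?_
    obtain ⟨s, hs⟩ := ne_zero_iff.mp hi
    have hs' := egfCoeff_ne_zero_iff.mpr hs
    rw [hpd] at hs'
    obtain ⟨I, k, hI, hIk⟩ := exists_indep_of_egfCoeff_add_ne_zero M hs'
    have hcard := hsum i
    rw [hIk, sum_indicatorExponent] at hcard
    have hc : egfCoeff (pderiv 0 (pderiv i f)) (Finsupp.single 0 (d + 1)) =
        (k + (d + 2)).factorial := by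
      rw [egfCoeff_pderiv, hpd, hIk, ← Finsupp.single_add, add_comm _ (indicatorExponent I k),
        indicatorExponent_add_single_zero, egfCoeff_gM_indicatorExponent M (by omega), if_pos hI]
    rw [h0, egfCoeff, coeff_zero, mul_zero] at hc
    exact (Nat.cast_ne_zero.mpr (Nat.factorial_ne_zero _)) hc.symm

end LorentzianMatroid

/-- For any matroid `M`, the homogenized independent-set generating polynomial
`g_M(y, z_1, …, z_n) = ∑_{I ∈ 𝓘} y^(n−|I|) ∏_{i ∈ I} z_i` is completely log-concave. -/
theorem gM_completelyLogConcave {n : ℕ} (M : PaperMatroid n) :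
    CompletelyLogConcave (gM M) := by
  exact completelyLogConcave_of_hasLorentzianHessians (coeff_gM_nonneg M) (gM_isHomogeneous M)
    fun d hd => hasLorentzianHessians_of_egfCoeff M d 0 (gM M) (fun s => by rw [add_zero])
      (hd ▸ gM_isHomogeneous M) (by simp [hd])
end
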